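/- Let a_1,…,a_q be q distinct non-zero complex numbers, let l_1,…,l_q be positive integers (or +∞) with q ≥ 1, let n be a non-negative integer, and let n_1,…,n_k, t_1,…,t_k be positive integers (k ≥ 1). Let F be a family of meromorphic functions on a domain D such that for every f ∈ F and every i = 1,…,q, all zeros of f^n (f^{n_1})^{(t_1)} ⋯ (f^{n_k})^{(t_k)} − a_i have multiplicity at least l_i. Assume (a) n_j ≥ t_j for all 1 ≤ j ≤ k and l_i ≥ 2 for all 1 ≤ i ≤ q, and (b) Σ_{i=1}^q 1/l_i < (qn − 2 + Σ_{j=1}^k q(n_j − t_j)) / (n + Σ_{j=1}^k (n_j + t_j)). Then F is normal in D. -/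

import Mathlib

open Complex Topology Filter Set MeasureTheory
open scoped ENNReal NNReal Classical

noncomputable section


/-- The chordal (spherical) distance on the Riemann sphere `ℂ ∪ {∞}`. -/
def sphDist (a b : OnePoint ℂ) : ℝ :=
  Option.elim a (Option.elim b 0 fun w => 1 / Real.sqrt (1 + ‖w‖ ^ 2))
    fun z => Option.elim b (1 / Real.sqrt (1 + ‖z‖ ^ 2))
      fun w => ‖z - w‖ / (Real.sqrt (1 + ‖z‖ ^ 2) * Real.sqrt (1 + ‖w‖ ^ 2))

/-- The natural Riemann-sphere-valued version of a meromorphic function: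
at points where the function blows up (poles) the value is `∞`. -/
def toSphere (f : ℂ → ℂ) : ℂ → OnePoint ℂ := fun z =>
  if Tendsto (fun w => ‖f w‖) (𝓝[≠] z) atTop then OnePoint.infty else (f z : OnePoint ℂ)

/-- A meromorphic function given by an honest representative: at each point of `D` it is
either continuous (analytic points) or blows up (a pole). -/
def MeromorphicNiceOn (f : ℂ → ℂ) (D : Set ℂ) : Prop :=
  MeromorphicOn f D ∧ ∀ z ∈ D, ContinuousAt f z ∨ Tendsto (fun w => ‖f w‖) (𝓝[≠] z) atTop

/-- The order (multiplicity) of a meromorphic function at a point: positive for a zero of that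
multiplicity, negative of the multiplicity for a pole, `⊤` if the function vanishes identically
near the point, and junk value `0` when not defined. -/
def merOrder (f : ℂ → ℂ) (z : ℂ) : WithTop ℤ :=
  if ∀ᶠ w in 𝓝[≠] z, f w = 0 then ⊤
  else if h : ∃ n : ℤ, ∃ g : ℂ → ℂ, AnalyticAt ℂ g z ∧ g z ≠ 0 ∧
      ∀ᶠ w in 𝓝[≠] z, f w = (w - z) ^ n * g w
    then (h.choose : WithTop ℤ) else 0

/-- `F j → g` spherically uniformly on compact subsets of `D`. -/
def ConvSphLocUnif (F : ℕ → ℂ → ℂ) (g : ℂ → ℂ) (D : Set ℂ) : Prop :=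
  ∀ K ⊆ D, IsCompact K → ∀ ε > 0, ∀ᶠ j in atTop, ∀ z ∈ K,
    sphDist (toSphere (F j) z) (toSphere g z) < ε

/-- `F j → ∞` spherically uniformly on compact subsets of `D`. -/
def ConvInftyLocUnif (F : ℕ → ℂ → ℂ) (D : Set ℂ) : Prop :=
  ∀ K ⊆ D, IsCompact K → ∀ ε > 0, ∀ᶠ j in atTop, ∀ z ∈ K,
    sphDist (toSphere (F j) z) OnePoint.infty < ε

/-- A family of meromorphic functions is normal in `D` if every sequence from the family has a
subsequence converging spherically uniformly on compact subsets of `D` to a meromorphic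
function or to `∞`. -/
def NormalFamilyOn (𝓕 : Set (ℂ → ℂ)) (D : Set ℂ) : Prop :=
  ∀ f : ℕ → ℂ → ℂ, (∀ j, f j ∈ 𝓕) → ∃ φ : ℕ → ℕ, StrictMono φ ∧
    ((∃ g : ℂ → ℂ, MeromorphicNiceOn g D ∧ ConvSphLocUnif (fun j => f (φ j)) g D) ∨
      ConvInftyLocUnif (fun j => f (φ j)) D)

/-- A sequence of meromorphic functions is normal in `D` if every subsequence has a further
subsequence converging spherically uniformly on compact subsets of `D` to a meromorphic
function or to `∞`. -/
def NormalSeqOn (f : ℕ → ℂ → ℂ) (D : Set ℂ) : Prop :=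
  ∀ φ : ℕ → ℕ, StrictMono φ → ∃ σ : ℕ → ℕ, StrictMono σ ∧
    ((∃ g : ℂ → ℂ, MeromorphicNiceOn g D ∧ ConvSphLocUnif (fun j => f (φ (σ j))) g D) ∨
      ConvInftyLocUnif (fun j => f (φ (σ j))) D)

/-- The logarithmic derivative of a zero-free analytic function inside a disc is controlled by the
circle average of `|log ‖g‖|`. -/
theorem norm_logDeriv_le_of_ne_zero {g : ℂ → ℂ} {R : ℝ}
    (hg : AnalyticOnNhd ℂ g (Metric.closedBall 0 R)) (h0 : ∀ z ∈ Metric.closedBall 0 R, g z ≠ 0)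
    {z : ℂ} (hz : z ∈ Metric.ball 0 R) :
    ‖logDeriv g z‖ ≤ 2 * R / (R - ‖z‖) ^ 2 *
      Real.circleAverage (fun w ↦ |Real.log ‖g w‖|) 0 R := by
  have hR : 0 < R := Metric.pos_of_mem_ball hz
  have hzR : ‖z‖ < R := by simpa using hz
  set u : ℂ → ℝ := fun w ↦ Real.log ‖g w‖ with hu
  have hharm : InnerProductSpace.HarmonicOnNhd u (Metric.closedBall 0 R) := fun w hw ↦
    (hg w hw).harmonicAt_log_norm (h0 w hw)
  have hcont : ContinuousOn u (Metric.closedBall 0 R) := fun w hw ↦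
    ((hg w hw).continuousAt.norm.log (norm_ne_zero_iff.2 (h0 w hw))).continuousWithinAt
  have hcont' : ContinuousOn u (Metric.sphere 0 |R|) := by
    rw [abs_of_pos hR]; exact hcont.mono Metric.sphere_subset_closedBall
  have hcint : CircleIntegrable u 0 R := hcont'.circleIntegrable'
  have hintC : CircleIntegrable (fun w ↦ (u w : ℂ)) 0 R :=
    (continuous_ofReal.comp_continuousOn hcont').circleIntegrable'
  set H : ℂ → ℂ := fun w ↦ Real.circleAverage
    (fun ζ ↦ herglotzRieszKernel 0 w ζ • (u ζ : ℂ)) 0 R with hH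
  have hHre : ∀ w ∈ Metric.ball (0 : ℂ) R, (H w).re = u w := fun w hw ↦ by
    rw [hH]
    simp only
    rw [re_circleAverage_herglotzRieszKernel_smul hcint hw,
      hharm.circleAverage_re_herglotzRieszKernel_smul hw]
  have hHd : ∀ w ∈ Metric.ball (0 : ℂ) R, HasDerivAt H (Real.circleAverage
      (fun ζ ↦ (2 * ζ / (ζ - w) ^ 2) • (u ζ : ℂ)) 0 R) w := fun w hw ↦
    hasDerivAt_circleAverage_herglotzRieszKernel_smul hintC hw
  have hball : Metric.ball (0 : ℂ) R ∈ 𝓝 z := Metric.isOpen_ball.mem_nhds hz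
  have hzc := Metric.ball_subset_closedBall hz
  have hnorm : ∀ w ∈ Metric.ball (0 : ℂ) R, ‖g w * exp (-H w)‖ = 1 := fun w hw ↦ by
    have : 0 < ‖g w‖ := norm_pos_iff.2 (h0 w (Metric.ball_subset_closedBall hw))
    rw [norm_mul, norm_exp, neg_re, hHre w hw, Real.exp_neg, hu]
    simp only
    rw [Real.exp_log this, mul_inv_cancel₀ this.ne']
  have hconst : ∀ᶠ w in 𝓝 z, g w * exp (-H w) = g z * exp (-H z) := by
    apply Complex.eventually_eq_of_isLocalMax_norm (f := fun w ↦ g w * exp (-H w))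
    · filter_upwards [hball] with w hw
      exact (hg w (Metric.ball_subset_closedBall hw)).differentiableAt.mul
        (hHd w hw).differentiableAt.neg.cexp
    · filter_upwards [hball] with w hw
      simp only [Function.comp_apply]
      rw [hnorm w hw, hnorm z hz]
  have hderiv : HasDerivAt (fun w ↦ g w * exp (-H w)) 0 z :=
    (hasDerivAt_const z (g z * exp (-H z))).congr_of_eventuallyEq hconst
  have h2 := (hg z hzc).differentiableAt.hasDerivAt.mul ((hHd z hz).neg.cexp)
  have h3 := hderiv.unique h2
  have hlog : logDeriv g z = Real.circleAverage
      (fun ζ ↦ (2 * ζ / (ζ - z) ^ 2) • (u ζ : ℂ)) 0 R := by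
    rw [logDeriv_apply, div_eq_iff (h0 z hzc)]
    have he : exp (-H z) ≠ 0 := exp_ne_zero _
    apply mul_right_cancel₀ he
    linear_combination -h3
  rw [hlog]
  have hc1 : ContinuousOn (fun ζ ↦ ‖2 * ζ / (ζ - z) ^ 2‖ * |u ζ|) (Metric.sphere 0 |R|) := by
    refine ContinuousOn.mul (ContinuousOn.norm ?_) hcont'.abs
    refine ContinuousOn.div (by fun_prop) (by fun_prop) fun ζ hζ ↦ ?_
    refine pow_ne_zero _ (sub_ne_zero.2 ?_)
    rintro rfl
    rw [abs_of_pos hR] at hζ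
    simp at hζ; linarith
  calc ‖Real.circleAverage (fun ζ ↦ (2 * ζ / (ζ - z) ^ 2) • (u ζ : ℂ)) 0 R‖
      ≤ Real.circleAverage (fun ζ ↦ ‖2 * ζ / (ζ - z) ^ 2‖ * |u ζ|) 0 R := by
        rw [Real.circleAverage, Real.circleAverage, norm_smul, smul_eq_mul, Real.norm_of_nonneg
          (by positivity)]
        gcongr
        refine (intervalIntegral.norm_integral_le_integral_norm Real.two_pi_pos.le).trans ?_
        simp
    _ ≤ Real.circleAverage (fun ζ ↦ 2 * R / (R - ‖z‖) ^ 2 * |u ζ|) 0 R := by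
        refine Real.circleAverage_mono hc1.circleIntegrable'
          (ContinuousOn.mul continuousOn_const hcont'.abs).circleIntegrable' fun ζ hζ ↦ ?_
        rw [abs_of_pos hR] at hζ
        have hζ' : ‖ζ‖ = R := by simpa using hζ
        gcongr
        rw [norm_div, norm_mul, norm_pow, hζ']
        simp only [Complex.norm_ofNat]
        have : R - ‖z‖ ≤ ‖ζ - z‖ := by
          have := norm_sub_norm_le ζ z
          rwa [hζ'] at this
        have h0' : 0 < R - ‖z‖ := by linarith
        gcongr
    _ = _ := by
        have := Real.circleAverage_fun_smul (a := 2 * R / (R - ‖z‖) ^ 2)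
          (f := fun ζ ↦ |u ζ|) (c := 0) (R := R)
        simpa [smul_eq_mul] using this

theorem intervalIntegrable_abs_sin_rpow (a b : ℝ) :
    IntervalIntegrable (fun x ↦ |Real.sin x| ^ (-(1 / 2) : ℝ)) volume a b := by
  set F : ℝ → ℝ := fun x ↦ |Real.sin x| ^ (-(1 / 2) : ℝ) with hF
  have hmeas : Measurable F := by
    rw [hF]; exact (Real.measurable_sin.abs).pow_const _
  have hper : Function.Periodic F Real.pi := fun x ↦ by
    simp [hF, Real.sin_add_pi]
  have h1 : IntervalIntegrable F volume 0 (Real.pi / 2) := by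
    have hb : IntervalIntegrable (fun x : ℝ ↦ (2 / Real.pi) ^ (-(1 / 2) : ℝ) * x ^ (-(1 / 2) : ℝ))
        volume 0 (Real.pi / 2) :=
      (intervalIntegral.intervalIntegrable_rpow' (by norm_num)).const_mul _
    refine hb.mono_fun hmeas.aestronglyMeasurable ?_
    refine (ae_restrict_iff' measurableSet_uIoc).2 (Eventually.of_forall fun x hx ↦ ?_)
    rw [uIoc_of_le Real.pi_div_two_pos.le] at hx
    have hx0 : 0 < x := hx.1
    have hs : 2 / Real.pi * x ≤ Real.sin x := Real.mul_le_sin hx0.le hx.2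
    have hp : 0 < 2 / Real.pi * x := by have := Real.pi_pos; positivity
    simp only [hF]
    rw [← Real.mul_rpow (by have := Real.pi_pos; positivity) hx0.le, abs_of_pos (hp.trans_le hs),
      Real.norm_of_nonneg (Real.rpow_nonneg (hp.trans_le hs).le _),
      Real.norm_of_nonneg (Real.rpow_nonneg hp.le _)]
    exact Real.rpow_le_rpow_of_nonpos hp hs (by norm_num)
  have h2 : IntervalIntegrable F volume (Real.pi / 2) Real.pi := by
    have h := (h1.comp_sub_left Real.pi).symm
    simp only [sub_zero] at h
    have e : (fun x ↦ F (Real.pi - x)) = F := by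
      ext x; simp [hF, Real.sin_pi_sub]
    rw [e] at h
    convert h using 1; ring
  exact hper.intervalIntegrable₀ Real.pi_ne_zero (h1.trans h2) a b

/-- Circle averages of `‖z - a‖ ^ (-1/2)` are bounded uniformly in the centre `a`. -/
theorem exists_circleAverage_norm_sub_rpow_le :
    ∃ C : ℝ, 0 ≤ C ∧ ∀ r : ℝ, 1 ≤ r → ∀ a : ℂ,
      CircleIntegrable (fun z ↦ ‖z - a‖ ^ (-(1 / 2) : ℝ)) 0 r ∧
      Real.circleAverage (fun z ↦ ‖z - a‖ ^ (-(1 / 2) : ℝ)) 0 r ≤ C := by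
  set F : ℝ → ℝ := fun x ↦ |Real.sin x| ^ (-(1 / 2) : ℝ) with hF
  have hFi : ∀ a b, IntervalIntegrable F volume a b := intervalIntegrable_abs_sin_rpow
  have hper : Function.Periodic F (2 * Real.pi) := fun x ↦ by simp [hF]
  refine ⟨(2 * Real.pi)⁻¹ * ∫ x in 0..2 * Real.pi, F x, ?_, fun r hr a ↦ ?_⟩
  · have := Real.pi_pos
    refine mul_nonneg (by positivity) (intervalIntegral.integral_nonneg (by positivity)
      fun x _ ↦ by simp only [hF]; positivity)
  have hFs : IntervalIntegrable (fun θ ↦ F (θ - arg a)) volume 0 (2 * Real.pi) := by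
    have := (hFi (0 - arg a) (2 * Real.pi - arg a)).comp_sub_right (arg a)
    simpa using this
  have hmeas : Measurable (fun θ ↦ ‖circleMap 0 r θ - a‖ ^ (-(1 / 2) : ℝ)) := by
    have : Measurable (circleMap 0 r) := (continuous_circleMap 0 r).measurable
    fun_prop
  have hnull : ∀ᵐ θ ∂(volume : Measure ℝ), Real.sin (θ - arg a) ≠ 0 := by
    have hc : {θ : ℝ | Real.sin (θ - arg a) = 0}.Countable := by
      refine (countable_range (fun n : ℤ ↦ (n : ℝ) * Real.pi + arg a)).mono fun θ hθ ↦ ?_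
      obtain ⟨n, hn⟩ := Real.sin_eq_zero_iff.1 hθ
      exact ⟨n, by simp only; linarith⟩
    filter_upwards [hc.ae_notMem volume] with θ hθ using hθ
  have hle : ∀ᵐ θ ∂(volume : Measure ℝ),
      ‖circleMap 0 r θ - a‖ ^ (-(1 / 2) : ℝ) ≤ F (θ - arg a) := by
    filter_upwards [hnull] with θ hθ
    refine Real.rpow_le_rpow_of_nonpos (abs_pos.2 hθ) ?_ (by norm_num)
    have h1 : ‖circleMap 0 r θ - a‖ = ‖(r : ℂ) * exp ((θ - arg a : ℝ) * I) - ‖a‖‖ := by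
      have h2 : circleMap 0 r θ - a
          = ((r : ℂ) * exp ((θ - arg a : ℝ) * I) - ‖a‖) * exp (arg a * I) := by
        rw [sub_mul, norm_mul_exp_arg_mul_I, mul_assoc, ← exp_add, circleMap, zero_add]
        push_cast
        ring_nf
      rw [h2, norm_mul, norm_exp_ofReal_mul_I, mul_one]
    rw [h1]
    refine le_trans ?_ (abs_im_le_norm _)
    rw [sub_im, ofReal_im, sub_zero, im_ofReal_mul, exp_ofReal_mul_I_im, abs_mul]
    have : 1 ≤ |r| := hr.trans (le_abs_self r)
    nlinarith [abs_nonneg (Real.sin (θ - arg a))]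
  have hcint : CircleIntegrable (fun z ↦ ‖z - a‖ ^ (-(1 / 2) : ℝ)) 0 r := by
    refine hFs.mono_fun hmeas.aestronglyMeasurable (ae_restrict_of_ae ?_)
    filter_upwards [hle] with θ hθ
    rw [Real.norm_of_nonneg (by positivity)]
    exact hθ.trans (le_abs_self _)
  refine ⟨hcint, ?_⟩
  rw [Real.circleAverage, smul_eq_mul]
  have := Real.pi_pos
  gcongr
  calc ∫ θ in 0..2 * Real.pi, ‖circleMap 0 r θ - a‖ ^ (-(1 / 2) : ℝ)
      ≤ ∫ θ in 0..2 * Real.pi, F (θ - arg a) :=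
        intervalIntegral.integral_mono_ae (by positivity) hcint hFs hle
    _ = ∫ x in 0..2 * Real.pi, F x := by
        rw [intervalIntegral.integral_comp_sub_right]
        have := hper.intervalIntegral_add_eq (0 - arg a) 0
        rw [show 2 * Real.pi - arg a = 0 - arg a + 2 * Real.pi by ring, this, zero_add]

open Function.locallyFinsuppWithin in
/-- A nonnegative divisor has total mass at most `N(R) / log (R / ρ)` in the disc of radius `ρ`. -/
theorem sum_mul_log_le_logCounting {D : Function.locallyFinsupp ℂ ℤ} (hD : 0 ≤ D) {s : Finset ℂ}
    {ρ R : ℝ} (hs : ∀ a ∈ s, ‖a‖ ≤ ρ) (hρ : 1 ≤ ρ) (hR : ρ ≤ R) :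
    (∑ a ∈ s, (D a : ℝ)) * (Real.log R - Real.log ρ) ≤ logCounting D R := by
  set E : Function.locallyFinsupp ℂ ℤ := ∑ a ∈ s, single a (D a) with hE
  have hED : E ≤ D := by
    intro z
    have h1 : E z = ∑ a ∈ s, (if z = a then D a else 0) := by
      rw [hE]
      simp
    rw [h1, Finset.sum_ite_eq]
    split_ifs
    · exact le_rfl
    · exact hD z
  refine le_trans ?_ (logCounting_le hED (hρ.trans hR))
  rw [hE, map_sum, Finset.sum_apply, Finset.sum_mul]
  refine Finset.sum_le_sum fun a ha ↦ ?_
  rw [logCounting_single_eq_log_sub_const ((hs a ha).trans hR)]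
  have h0 : (0 : ℝ) ≤ D a := by exact_mod_cast hD a
  refine mul_le_mul_of_nonneg_left (sub_le_sub_left ?_ _) h0
  rcases eq_or_ne a 0 with rfl | h
  · simpa using Real.log_nonneg hρ
  · exact Real.log_le_log (norm_pos_iff.2 h) (hs a ha)

theorem norm_logDeriv_canonicalFactor_le {R : ℝ} {a z : ℂ} (ha : a ∈ Metric.ball 0 R)
    (hz : z ∈ Metric.ball 0 R) (haz : z ≠ a) :
    ‖logDeriv (canonicalFactor R a) z‖ ≤ 1 / (R - ‖z‖) + 1 / ‖z - a‖ := by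
  have hR : 0 < R := Metric.pos_of_mem_ball hz
  have hzR : ‖z‖ < R := by simpa using hz
  have haR : ‖a‖ < R := by simpa using ha
  have hsub : z - a ≠ 0 := sub_ne_zero.2 haz
  have hRC : (R : ℂ) ≠ 0 := ofReal_ne_zero.2 hR.ne'
  have hnum : R * (R - ‖z‖) ≤ ‖(R : ℂ) ^ 2 - (starRingEnd ℂ) a * z‖ := by
    have h1 := norm_sub_norm_le ((R : ℂ) ^ 2) ((starRingEnd ℂ) a * z)
    rw [norm_mul, norm_pow, RCLike.norm_conj, norm_real, Real.norm_of_nonneg hR.le] at h1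
    nlinarith [norm_nonneg z, norm_nonneg a]
  have hpos : 0 < R * (R - ‖z‖) := mul_pos hR (by linarith)
  have hne : (R : ℂ) ^ 2 - (starRingEnd ℂ) a * z ≠ 0 := norm_pos_iff.1 (hpos.trans_le hnum)
  have hd1 : HasDerivAt (fun z : ℂ ↦ (R : ℂ) ^ 2 - (starRingEnd ℂ) a * z)
      (-(starRingEnd ℂ) a) z := by
    simpa using ((hasDerivAt_id z).const_mul ((starRingEnd ℂ) a)).const_sub ((R : ℂ) ^ 2)
  have hd2 : HasDerivAt (fun z : ℂ ↦ (R : ℂ) * (z - a)) R z := by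
    simpa using ((hasDerivAt_id z).sub_const a).const_mul (R : ℂ)
  have heq : logDeriv (canonicalFactor R a) z =
      -(starRingEnd ℂ) a / ((R : ℂ) ^ 2 - (starRingEnd ℂ) a * z) - 1 / (z - a) := by
    have h := hd1.div hd2 (mul_ne_zero hRC hsub)
    rw [logDeriv_apply, canonicalFactor_def, show (fun z ↦ ((R : ℂ) ^ 2 - (starRingEnd ℂ) a * z) /
      (R * (z - a))) = (fun z : ℂ ↦ (R : ℂ) ^ 2 - (starRingEnd ℂ) a * z) /
        (fun z : ℂ ↦ (R : ℂ) * (z - a)) from rfl, h.deriv]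
    simp only [Pi.div_apply]
    field_simp
  rw [heq]
  refine (norm_sub_le _ _).trans (add_le_add ?_ ?_)
  · rw [norm_div, norm_neg, RCLike.norm_conj]
    calc ‖a‖ / _ ≤ R / (R * (R - ‖z‖)) := by gcongr
      _ = 1 / (R - ‖z‖) := by field_simp
  · simp

/-- Pointwise bound for the logarithmic derivative of a meromorphic function on a disc whose
boundary circle carries neither zeros nor poles. -/
theorem eventually_norm_logDeriv_le {f : ℂ → ℂ} (hf : Meromorphic f)
    (hf' : ∀ z, meromorphicOrderAt f z ≠ ⊤) {R : ℝ} (hR : 0 < R)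
    (hsph : ∀ z ∈ Metric.sphere (0 : ℂ) R, meromorphicOrderAt f z = 0)
    {s : Finset ℂ} (hs : ∀ a, a ∈ s ↔ MeromorphicOn.divisor f (Metric.ball 0 R) a ≠ 0) :
    ∀ᶠ z in codiscreteWithin (Metric.ball 0 R),
      ‖logDeriv f z‖ ≤ 2 * R / (R - ‖z‖) ^ 2 *
        Real.circleAverage (fun w ↦ |Real.log ‖f w‖|) 0 R +
        ∑ a ∈ s, |(MeromorphicOn.divisor f (Metric.ball 0 R) a : ℝ)| *
          (1 / (R - ‖z‖) + 1 / ‖z - a‖) := by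
  set B : Set ℂ := Metric.ball 0 R with hB
  set d := MeromorphicOn.divisor f B with hd
  have hsB : ∀ a ∈ s, a ∈ B := fun a ha ↦ by
    by_contra h
    exact (hs a).1 ha (d.apply_eq_zero_of_notMem h)
  obtain ⟨g, hg⟩ := hf.meromorphicOn.exists_canonicalDecomp (R := R)
    fun u ↦ hf' u
  set P : ℂ → ℂ := ∏ a ∈ s, canonicalFactor R a ^ (-d a) with hP
  have hPeq : (∏ᶠ u, canonicalFactor R u ^ (-d u)) = P := by
    rw [finprod_eq_prod_of_mulSupport_subset]
    intro a ha
    rw [Finset.mem_coe, hs]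
    intro h
    exact ha (by simp [h])
  have hfPg : f =ᶠ[codiscreteWithin (Metric.closedBall 0 R)] P * g := by
    have := hg.eventuallyEq
    rwa [hPeq] at this
  have hPmer : Meromorphic P := by
    rw [hP]
    exact Meromorphic.prod fun a _ z ↦ (meromorphic_canonicalFactor R a z).zpow _
  have hPsph : ∀ z ∈ Metric.sphere (0 : ℂ) R, ‖P z‖ = 1 := fun z hz ↦ by
    rw [hP, Finset.prod_apply, norm_prod]
    refine Finset.prod_eq_one fun a ha ↦ ?_
    rw [Pi.pow_apply, norm_zpow, norm_canonicalFactor_eval_circle_eq_one (hsB a ha) hz, one_zpow]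
  have hnt : (Metric.closedBall (0 : ℂ) R).Nontrivial :=
    ⟨(0 : ℂ), Metric.mem_closedBall_self hR.le, (R : ℂ), by simp [abs_of_pos hR], by
      simpa [eq_comm] using hR.ne'⟩
  have hord : ∀ z ∈ Metric.closedBall (0 : ℂ) R, meromorphicOrderAt g z = 0 := by
    intro z hz
    by_cases hzB : z ∈ B
    · exact (hg.meromorphicNFOn hz).meromorphicOrderAt_eq_zero_iff.2 (hg.ne_zero z hzB)
    have hzS : z ∈ Metric.sphere (0 : ℂ) R := by
      simp only [hB, Metric.mem_ball, not_lt, Metric.mem_closedBall, Metric.mem_sphere] at hz hzB ⊢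
      exact le_antisymm hz hzB
    have hacc : AccPt z (𝓟 (Metric.closedBall (0 : ℂ) R)) :=
      (convex_closedBall (0 : ℂ) R).isPreconnected.preperfect_of_nontrivial hnt z hz
    have hmul := MeromorphicAt.eventuallyEq_nhdsNE_of_eventuallyEq_codiscreteWithin (hf z)
      ((hPmer z).mul (hg.meromorphicNFOn hz).meromorphicAt) hz hacc hfPg
    have h1 := meromorphicOrderAt_congr hmul
    have hPan : AnalyticAt ℂ P z := by
      rw [hP]
      refine Finset.analyticAt_prod _ fun a ha ↦ ?_
      have hza : z ≠ a := by rintro rfl; exact hzB (hsB z ha)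
      exact (analyticOnNhd_canonicalFactor R a z hza).zpow
        (canonicalFactor_ne_zero (hsB a ha) hz hza)
    have hP0 : meromorphicOrderAt P z = 0 := by
      rw [hPan.meromorphicNFAt.meromorphicOrderAt_eq_zero_iff, ← norm_pos_iff, hPsph z hzS]
      exact one_pos
    rwa [hsph z hzS, meromorphicOrderAt_mul (hPmer z) (hg.meromorphicNFOn hz).meromorphicAt,
      hP0, zero_add, eq_comm] at h1
  have hgan : AnalyticOnNhd ℂ g (Metric.closedBall 0 R) := fun z hz ↦
    (hg.meromorphicNFOn hz).meromorphicOrderAt_nonneg_iff_analyticAt.1 (hord z hz).ge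
  have hgne : ∀ z ∈ Metric.closedBall (0 : ℂ) R, g z ≠ 0 := fun z hz ↦
    (hg.meromorphicNFOn hz).meromorphicOrderAt_eq_zero_iff.1 (hord z hz)
  have havg : Real.circleAverage (fun w ↦ |Real.log ‖f w‖|) 0 R =
      Real.circleAverage (fun w ↦ |Real.log ‖g w‖|) 0 R := by
    refine Real.circleAverage_congr_codiscreteWithin ?_ hR.ne'
    rw [abs_of_pos hR]
    filter_upwards [codiscreteWithin_mono Metric.sphere_subset_closedBall hfPg,
      self_mem_codiscreteWithin (Metric.sphere (0 : ℂ) R)] with z h1 h2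
    rw [h1, Pi.mul_apply, norm_mul, hPsph z h2, one_mul]
  have hfPgB : f =ᶠ[codiscreteWithin B] P * g :=
    codiscreteWithin_mono Metric.ball_subset_closedBall hfPg
  have hderiv : deriv f =ᶠ[codiscreteWithin B] deriv (P * g) :=
    MeromorphicOn.deriv_eventuallyEq_codiscreteWithin (fun z _ ↦ hf z)
      (fun z hz ↦ (hPmer z).mul (hgan z (Metric.ball_subset_closedBall hz)).meromorphicAt) hfPgB
  have hPan : ∀ z ∈ B, (∀ a ∈ s, z ≠ a) → ∀ a ∈ s, AnalyticAt ℂ (canonicalFactor R a) z ∧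
      canonicalFactor R a z ≠ 0 := fun z hz hza a ha ↦
    ⟨analyticOnNhd_canonicalFactor R a z (hza a ha),
      canonicalFactor_ne_zero (hsB a ha) (Metric.ball_subset_closedBall hz) (hza a ha)⟩
  have hsc : ∀ᶠ z in codiscreteWithin B, z ∉ (s : Set ℂ) :=
    compl_finite_mem_codiscreteWithin s.finite_toSet
  filter_upwards [hfPgB, hderiv, hsc, self_mem_codiscreteWithin B] with z h1 h2 h3 hzB
  have hza : ∀ a ∈ s, z ≠ a := by rintro a ha rfl; exact h3 ha
  have hzc := Metric.ball_subset_closedBall hzB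
  have h4 : logDeriv f z = logDeriv (P * g) z := by
    rw [logDeriv_apply, logDeriv_apply, h1, h2]
  have hfac := hPan z hzB hza
  have hPz : P z ≠ 0 := by
    rw [hP, Finset.prod_apply]
    exact Finset.prod_ne_zero_iff.2 fun a ha ↦ zpow_ne_zero _ (hfac a ha).2
  have hPd : DifferentiableAt ℂ P z := by
    rw [hP]
    exact (Finset.analyticAt_prod _ fun a ha ↦
      (hfac a ha).1.zpow (hfac a ha).2).differentiableAt
  have h5 : logDeriv P z = ∑ a ∈ s, (-d a : ℂ) * logDeriv (canonicalFactor R a) z := by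
    have : P = fun z ↦ ∏ a ∈ s, (canonicalFactor R a ^ (-d a)) z := by
      ext; simp [hP]
    rw [this, logDeriv_prod (f := fun a ↦ canonicalFactor R a ^ (-d a))
      (fun a ha ↦ zpow_ne_zero _ (hfac a ha).2)
      fun a ha ↦ ((hfac a ha).1.zpow (hfac a ha).2).differentiableAt]
    refine Finset.sum_congr rfl fun a ha ↦ ?_
    have := logDeriv_fun_zpow (hfac a ha).1.differentiableAt (-d a)
    rw [Pi.pow_def, this]
    push_cast
    rfl
  rw [h4, show P * g = fun z ↦ P z * g z from rfl, logDeriv_mul z hPz (hgne z hzc) hPd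
    (hgan z hzc).differentiableAt, h5, havg, add_comm]
  refine (norm_add_le _ _).trans (add_le_add (norm_logDeriv_le_of_ne_zero hgan hgne hzB) ?_)
  refine (norm_sum_le _ _).trans (Finset.sum_le_sum fun a ha ↦ ?_)
  rw [norm_mul, norm_neg, norm_intCast]
  gcongr
  exact norm_logDeriv_canonicalFactor_le (hsB a ha) hzB (hza a ha)

section

open ValueDistribution in
/-- A concavity bound: the proximity function is controlled by the mean of any majorant of the
square root. -/
theorem proximity_top_le_two_mul_log {U : ℂ → ℝ} {f : ℂ → ℂ} (hf : Meromorphic f) {r V : ℝ}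
    (hr : 0 < r) (hU : CircleIntegrable U 0 r) (h1 : ∀ z, 1 ≤ U z)
    (hle : ∀ᶠ z in codiscreteWithin (Metric.sphere (0 : ℂ) r), Real.sqrt ‖f z‖ ≤ U z)
    (hV0 : 0 < V) (hV : Real.circleAverage U 0 r ≤ V) :
    proximity f ⊤ r ≤ 2 * Real.log V := by
  set B : ℂ → ℝ := fun z ↦ V⁻¹ * 2 * U z + (2 * Real.log V - 2) with hB
  have hUB : CircleIntegrable (fun z ↦ V⁻¹ * 2 * U z) 0 r := by
    exact hU.const_smul (a := V⁻¹ * 2)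
  have hcB : CircleIntegrable (fun _ : ℂ ↦ 2 * Real.log V - 2) 0 r := circleIntegrable_const _ _ _
  have hBint : CircleIntegrable B 0 r := hUB.add hcB
  have hposlog : ∀ᶠ z in codiscreteWithin (Metric.sphere (0 : ℂ) r),
      Real.posLog ‖f z‖ ≤ B z := by
    filter_upwards [hle] with z hz
    have hU0 : 0 < U z := one_pos.trans_le (h1 z)
    have h2 : Real.posLog ‖f z‖ ≤ Real.posLog (U z ^ 2) := by
      refine Real.posLog_le_posLog (norm_nonneg _) ?_
      rw [← Real.sqrt_le_left (by positivity)]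
      exact hz
    have h3 : Real.posLog (U z ^ 2) = 2 * Real.log (U z) := by
      rw [Real.posLog_eq_log, Real.log_pow]
      · norm_num
      · rw [abs_of_nonneg (by positivity)]; exact one_le_pow₀ (h1 z)
    have h4 := Real.log_le_sub_one_of_pos (div_pos hU0 hV0)
    rw [Real.log_div hU0.ne' hV0.ne', div_eq_inv_mul] at h4
    rw [h3] at h2
    simp only [hB]
    linarith
  have hcint := (hf.meromorphicOn (s := Metric.sphere 0 |r|)).circleIntegrable_posLog_norm
  have hcongr : (fun z ↦ Real.posLog ‖f z‖) =ᶠ[codiscreteWithin (Metric.sphere (0 : ℂ) |r|)]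
      fun z ↦ min (Real.posLog ‖f z‖) (B z) := by
    rw [abs_of_pos hr]
    filter_upwards [hposlog] with z hz
    exact (min_eq_left hz).symm
  rw [proximity_top, Real.circleAverage_congr_codiscreteWithin hcongr hr.ne']
  refine (Real.circleAverage_mono (hcint.congr_codiscreteWithin hcongr) hBint
    fun z _ ↦ min_le_right _ _).trans ?_
  rw [hB, Real.circleAverage_fun_add hUB hcB, Real.circleAverage_const]
  have : Real.circleAverage (fun z ↦ V⁻¹ * 2 * U z) 0 r = V⁻¹ * 2 * Real.circleAverage U 0 r := by
    simpa [smul_eq_mul] using Real.circleAverage_fun_smul (a := V⁻¹ * 2) (f := U) (c := 0) (R := r)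
  rw [this]
  have : V⁻¹ * 2 * Real.circleAverage U 0 r ≤ V⁻¹ * 2 * V := by gcongr
  have h5 : V⁻¹ * 2 * V = 2 := by field_simp
  linarith


theorem Real.abs_log_eq_posLog_add_posLog_inv (x : ℝ) :
    |Real.log x| = Real.posLog x + Real.posLog x⁻¹ := by
  rw [← Real.half_mul_log_add_log_abs, ← Real.half_mul_log_add_log_abs, Real.log_inv, abs_neg]
  ring

open ValueDistribution in
theorem circleAverage_abs_log_norm_eq {f : ℂ → ℂ} (hf : Meromorphic f) (r : ℝ) :
    Real.circleAverage (fun z ↦ |Real.log ‖f z‖|) 0 r = proximity f ⊤ r + proximity f⁻¹ ⊤ r := by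
  rw [proximity_top, proximity_top, ← Real.circleAverage_fun_add]
  · simp [Real.abs_log_eq_posLog_add_posLog_inv]
  · exact (hf.meromorphicOn (s := Metric.sphere 0 |r|)).circleIntegrable_posLog_norm
  · exact (hf.inv.meromorphicOn (s := Metric.sphere 0 |r|)).circleIntegrable_posLog_norm

set_option maxHeartbeats 1000000 in
open ValueDistribution MeromorphicOn in
/-- The lemma on the logarithmic derivative. -/
theorem exists_proximity_logDeriv_le {f : ℂ → ℂ} (hf : Meromorphic f)
    (hf' : ∀ z, meromorphicOrderAt f z ≠ ⊤) :
    ∃ C : ℝ, 0 ≤ C ∧ ∀ r R, 1 ≤ r → r < R → proximity (logDeriv f) ⊤ r ≤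
      C * (1 + Real.posLog (characteristic f ⊤ R) + Real.log (R / (R - r))) := by
  obtain ⟨C2, hC2, h2⟩ := exists_circleAverage_norm_sub_rpow_le
  set C0 := max |Real.log ‖f 0‖| |Real.log ‖meromorphicTrailingCoeffAt f 0‖| with hC0
  have hC0n : 0 ≤ C0 := (abs_nonneg _).trans (le_max_left _ _)
  have hfmt : ∀ R, characteristic f⁻¹ ⊤ R ≤ characteristic f ⊤ R + C0 := fun R ↦ by
    have := characteristic_sub_characteristic_inv_le hf (R := R)
    rw [abs_le] at this
    linarith [this.1]
  have key : ∀ r R, 1 ≤ r → r < R → proximity (logDeriv f) ⊤ r ≤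
      2 * Real.log ((4 + C2) * (3 * (R / (R - r))) ^ 2 *
        (1 + (2 * characteristic f ⊤ R + C0))) := by
    intro r R hr hrR
    have hr0 : 0 < r := one_pos.trans_le hr
    have hR0 : 0 < R := hr0.trans hrR
    have hR1 : 1 ≤ R := hr.trans hrR.le
    set δ := (R - r) / 3 with hδ
    have hδ0 : 0 < δ := by rw [hδ]; linarith
    set T := characteristic f ⊤ R with hT
    have hT0 : 0 ≤ T := characteristic_nonneg hR1
    set X := 2 * T + C0 with hX
    have hX0 : 0 ≤ X := by positivity
    set y := R / δ with hy
    have hyeq : 3 * (R / (R - r)) = y := by rw [hy, hδ]; field_simp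
    have hy1 : 1 ≤ y := by rw [hy, one_le_div hδ0, hδ]; linarith
    have hSfin := divisor_ball_support_finite (f := f) (R := R) (c := 0) (hf.meromorphicOn)
    obtain ⟨R', hR', hR'n⟩ := ((Set.Ioo_infinite (show r + δ < r + 2 * δ by linarith)).sdiff
      (hSfin.image fun a ↦ ‖a‖)).nonempty
    have hR'0 : 0 < R' := by linarith [hR'.1]
    have hR'1 : 1 ≤ R' := by linarith [hR'.1]
    have hR'R : R' < R := by have := hR'.2; rw [hδ] at this hδ0; linarith
    have hR'd : δ ≤ R - R' := by have := hR'.2; linarith [show 3 * δ = R - r by rw [hδ]; ring]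
    have hsph : ∀ z ∈ Metric.sphere (0 : ℂ) R', meromorphicOrderAt f z = 0 := by
      intro z hz
      have hzn : ‖z‖ = R' := by simpa using hz
      have hzB : z ∈ Metric.ball (0 : ℂ) R := by simpa [hzn] using hR'R
      have hd0 : divisor f (Metric.ball 0 R) z = 0 := by
        by_contra h
        exact hR'n ⟨z, h, hzn⟩
      rw [divisor_apply hf.meromorphicOn hzB, WithTop.untop₀_eq_zero] at hd0
      exact hd0.resolve_right (hf' z)
    set s : Finset ℂ := (divisor_ball_support_finite (f := f) (R := R') (c := 0)
      hf.meromorphicOn).toFinset with hs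
    have hsd : ∀ a, a ∈ s ↔ divisor f (Metric.ball 0 R') a ≠ 0 := fun a ↦ by simp [hs]
    have hpt := eventually_norm_logDeriv_le hf hf' hR'0 hsph hsd
    set A := Real.circleAverage (fun w ↦ |Real.log ‖f w‖|) 0 R' with hA
    have hA0 : 0 ≤ A := by
      rw [hA, circleAverage_abs_log_norm_eq hf]
      exact add_nonneg (proximity_nonneg _) (proximity_nonneg _)
    have hprox : ∀ g : ℂ → ℂ, proximity g ⊤ R' ≤ characteristic g ⊤ R' := fun g ↦
      le_add_of_nonneg_right (logCounting_nonneg hR'1)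
    have hmono : characteristic f ⊤ R' ≤ T :=
      characteristic_monotoneOn hf hR'0 hR0 hR'R.le
    have hAX : A ≤ X := by
      rw [hA, circleAverage_abs_log_norm_eq hf]
      linarith [hprox f, hprox f⁻¹, hfmt R']
    set d := divisor f (Metric.ball 0 R') with hd
    have hsB : ∀ a ∈ s, a ∈ Metric.ball (0 : ℂ) R' := fun a ha ↦ by
      by_contra h
      exact (hsd a).1 ha (d.apply_eq_zero_of_notMem h)
    set M := ∑ a ∈ s, |(d a : ℝ)| with hM
    have hM0 : 0 ≤ M := Finset.sum_nonneg fun _ _ ↦ abs_nonneg _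
    have hMX : M ≤ X * y := by
      have hp := sum_mul_log_le_logCounting (D := (divisor f univ)⁺) (posPart_nonneg _)
        (s := s) (ρ := R') (R := R) (fun a ha ↦ (mem_ball_zero_iff.1 (hsB a ha)).le) hR'1 hR'R.le
      have hn := sum_mul_log_le_logCounting (D := (divisor f univ)⁻) (negPart_nonneg _)
        (s := s) (ρ := R') (R := R) (fun a ha ↦ (mem_ball_zero_iff.1 (hsB a ha)).le) hR'1 hR'R.le
      rw [← logCounting_zero] at hp
      rw [← logCounting_top] at hn
      have hN1 : logCounting f ⊤ R ≤ T := le_add_of_nonneg_left (proximity_nonneg _)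
      have hN2 : logCounting f 0 R ≤ T + C0 := by
        refine le_trans ?_ (hfmt R)
        rw [← logCounting_inv]
        exact le_add_of_nonneg_left (proximity_nonneg _)
      have hlog : δ / R ≤ Real.log R - Real.log R' := by
        have := Real.log_le_sub_one_of_pos (div_pos hR'0 hR0)
        rw [Real.log_div hR'0.ne' hR0.ne'] at this
        have h3 : δ / R ≤ (R - R') / R := by gcongr
        have h4 : (R - R') / R = 1 - R' / R := by field_simp
        linarith
      have hsum : M = ∑ a ∈ s, ((divisor f univ)⁺ a : ℝ) + ∑ a ∈ s, ((divisor f univ)⁻ a : ℝ) := by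
        rw [hM, ← Finset.sum_add_distrib]
        refine Finset.sum_congr rfl fun a ha ↦ ?_
        have hda : d a = divisor f univ a := by
          rw [hd, divisor_apply hf.meromorphicOn (hsB a ha),
            divisor_apply hf.meromorphicOn (mem_univ a)]
        rw [hda, ← Int.cast_abs, ← Int.cast_add]
        congr 1
        rw [Function.locallyFinsuppWithin.posPart_apply,
          Function.locallyFinsuppWithin.negPart_apply]
        exact (posPart_add_negPart _).symm
      have h5 : M * (δ / R) ≤ X := by
        calc M * (δ / R) ≤ M * (Real.log R - Real.log R') := by gcongr
          _ ≤ X := by rw [hsum, add_mul]; linarith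
      rw [hy]
      calc M = M * (δ / R) * (R / δ) := by field_simp
        _ ≤ X * (R / δ) := by gcongr
    set U : ℂ → ℝ := fun z ↦ (1 + 2 * y ^ 2 * X + M * y) +
      ∑ a ∈ s, |(d a : ℝ)| * ‖z - a‖ ^ (-(1 / 2) : ℝ) with hU
    have hUs : ∀ a ∈ s, CircleIntegrable
        (fun z : ℂ ↦ |(d a : ℝ)| * ‖z - a‖ ^ (-(1 / 2) : ℝ)) 0 r := fun a _ ↦
      (h2 r hr a).1.const_smul (a := |(d a : ℝ)|)
    have hUint2 : CircleIntegrable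
        (fun z : ℂ ↦ ∑ a ∈ s, |(d a : ℝ)| * ‖z - a‖ ^ (-(1 / 2) : ℝ)) 0 r :=
      CircleIntegrable.fun_sum s hUs
    have hUint : CircleIntegrable U 0 r := (circleIntegrable_const _ _ _).add hUint2
    have hU1 : ∀ z, 1 ≤ U z := fun z ↦ by
      have : 0 ≤ ∑ a ∈ s, |(d a : ℝ)| * ‖z - a‖ ^ (-(1 / 2) : ℝ) :=
        Finset.sum_nonneg fun a _ ↦ by positivity
      have h3 : 0 ≤ 2 * y ^ 2 * X + M * y := by positivity
      simp only [hU]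
      linarith
    have hUavg : Real.circleAverage U 0 r ≤ (4 + C2) * y ^ 2 * (1 + X) := by
      rw [hU, Real.circleAverage_fun_add (circleIntegrable_const _ _ _) hUint2,
        Real.circleAverage_const, Real.circleAverage_fun_sum hUs]
      have h3 : ∑ a ∈ s, Real.circleAverage
          (fun z : ℂ ↦ |(d a : ℝ)| * ‖z - a‖ ^ (-(1 / 2) : ℝ)) 0 r ≤ M * C2 := by
        rw [hM, Finset.sum_mul]
        refine Finset.sum_le_sum fun a _ ↦ ?_
        have := Real.circleAverage_fun_smul (a := |(d a : ℝ)|)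
          (f := fun z : ℂ ↦ ‖z - a‖ ^ (-(1 / 2) : ℝ)) (c := 0) (R := r)
        simp only [smul_eq_mul] at this
        rw [this]
        exact mul_le_mul_of_nonneg_left (h2 r hr a).2 (abs_nonneg _)
      have h4 : M * y ≤ X * y ^ 2 := by nlinarith
      have h5 : M * C2 ≤ X * y ^ 2 * C2 := by
        refine mul_le_mul_of_nonneg_right ?_ hC2
        nlinarith
      have h6 : 1 ≤ y ^ 2 := one_le_pow₀ hy1
      have h7 : 0 ≤ y ^ 2 * X := by positivity
      have h8 : 0 ≤ C2 * y ^ 2 := by positivity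
      nlinarith
    have hbound : ∀ᶠ z in codiscreteWithin (Metric.sphere (0 : ℂ) r),
        Real.sqrt ‖logDeriv f z‖ ≤ U z := by
      have hsub : Metric.sphere (0 : ℂ) r ⊆ Metric.ball 0 R' :=
        Metric.sphere_subset_ball (by linarith [hR'.1])
      filter_upwards [codiscreteWithin_mono hsub hpt,
        self_mem_codiscreteWithin (Metric.sphere (0 : ℂ) r)] with z hz hzr
      have hzn : ‖z‖ = r := by simpa using hzr
      rw [hzn] at hz
      have hδR' : δ ≤ R' - r := by linarith [hR'.1]
      have hdy : 1 / δ ≤ y := by rw [hy]; gcongr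
      have e1 : 2 * R' / (R' - r) ^ 2 * A ≤ 2 * y ^ 2 * X := by
        have : 2 * R' / (R' - r) ^ 2 ≤ 2 * y ^ 2 := by
          calc 2 * R' / (R' - r) ^ 2 ≤ 2 * (R * R) / δ ^ 2 := by
                gcongr
                nlinarith
            _ = 2 * y ^ 2 := by rw [hy, div_pow R δ, pow_two R, mul_div_assoc]
        gcongr
      have e2 : 1 / (R' - r) ≤ y := le_trans (by gcongr) hdy
      have hc1 : ∀ a ∈ s, 1 ≤ |(d a : ℝ)| := fun a ha ↦ by
        have := Int.one_le_abs ((hsd a).1 ha)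
        exact_mod_cast this
      set W := ∑ a ∈ s, |(d a : ℝ)| * ‖z - a‖ ^ (-(1 / 2) : ℝ) with hW
      have hW0 : 0 ≤ W := Finset.sum_nonneg fun a _ ↦ by positivity
      have e3 : ∑ a ∈ s, |(d a : ℝ)| * (1 / ‖z - a‖) ≤ W ^ 2 := by
        refine le_trans ?_ (Finset.sum_sq_le_sq_sum_of_nonneg fun a _ ↦ by positivity)
        refine Finset.sum_le_sum fun a ha ↦ ?_
        have h3 : (‖z - a‖ ^ (-(1 / 2) : ℝ)) ^ 2 = 1 / ‖z - a‖ := by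
          rw [← Real.rpow_natCast, ← Real.rpow_mul (norm_nonneg _)]
          norm_num
          exact Real.rpow_neg_one _
        rw [mul_pow, h3]
        have h4 : |(d a : ℝ)| ≤ |(d a : ℝ)| ^ 2 := le_self_pow₀ (hc1 a ha) two_ne_zero
        gcongr
      have e4 : ‖logDeriv f z‖ ≤ 2 * y ^ 2 * X + M * y + W ^ 2 := by
        refine hz.trans ?_
        have : ∑ a ∈ s, |(d a : ℝ)| * (1 / (R' - r) + 1 / ‖z - a‖) ≤ M * y + W ^ 2 := by
          simp only [mul_add, Finset.sum_add_distrib]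
          refine add_le_add ?_ e3
          rw [← Finset.sum_mul]
          gcongr
        linarith
      rw [Real.sqrt_le_left (one_pos.trans_le (hU1 z)).le]
      refine e4.trans ?_
      have hUz : U z = 1 + 2 * y ^ 2 * X + M * y + W := rfl
      rw [hUz]
      have h3 : 0 ≤ 2 * y ^ 2 * X := by positivity
      have h4 : 0 ≤ M * y := by positivity
      nlinarith [mul_nonneg h3 hW0, mul_nonneg h4 hW0, mul_nonneg h3 h4]
    have := proximity_top_le_two_mul_log (U := U) (hf.deriv.div hf) hr0 hUint hU1 hbound
      (by positivity) hUavg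
    rw [hyeq]
    exact this
  refine ⟨2 * (Real.log (4 + C2) + 2 * Real.log 3 + Real.log (3 + C0) + 3), ?_, ?_⟩
  · have := Real.log_nonneg (show 1 ≤ 4 + C2 by linarith)
    have := Real.log_nonneg (show 1 ≤ 3 + C0 by linarith)
    have := Real.log_nonneg (show (1 : ℝ) ≤ 3 by norm_num)
    positivity
  · intro r R hr hrR
    refine (key r R hr hrR).trans ?_
    set T := characteristic f ⊤ R with hT
    have hR1 : 1 ≤ R := hr.trans hrR.le
    have hT0 : 0 ≤ T := characteristic_nonneg hR1
    have hz : 1 ≤ R / (R - r) := by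
      rw [one_le_div (by linarith)]
      linarith
    have hX : 1 + (2 * T + C0) ≤ (3 + C0) * max 1 T := by
      have h3 := le_max_left 1 T
      have h4 := le_max_right 1 T
      nlinarith
    have hlog1 : Real.log (1 + (2 * T + C0)) ≤ Real.log (3 + C0) + Real.posLog T := by
      refine (Real.log_le_log (by positivity) hX).trans ?_
      rw [Real.log_mul (by positivity) (by positivity), Real.posLog_eq_log_max_one hT0]
    rw [Real.log_mul (by positivity) (by positivity), Real.log_mul (by positivity) (by positivity),
      Real.log_pow, Real.log_mul (by positivity) (by positivity)]
    have := Real.log_nonneg (show 1 ≤ 4 + C2 by linarith)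
    have := Real.log_nonneg (show 1 ≤ 3 + C0 by linarith)
    have := Real.log_nonneg (show (1 : ℝ) ≤ 3 by norm_num)
    have := Real.log_nonneg hz
    have := Real.posLog_nonneg (x := T)
    push_cast
    set p := Real.log (4 + C2)
    set p' := Real.log (3 + C0)
    set p'' := Real.log 3
    set L := Real.log (R / (R - r))
    set P := Real.posLog T
    have e : 0 ≤ (p + 2 * p'' + p') * (P + L) := by positivity
    nlinarith

end

section

theorem eventually_codiscrete_iff {X : Type*} [TopologicalSpace X] {p : X → Prop} :
    (∀ᶠ x in codiscrete X, p x) ↔ ∀ x, ∀ᶠ y in 𝓝[≠] x, p y := by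
  rw [Filter.Eventually, mem_codiscrete]
  simp only [disjoint_principal_right, compl_compl]
  rfl

theorem Meromorphic.deriv_eventuallyEq_logDeriv_mul {f : ℂ → ℂ} (hf : Meromorphic f) :
    deriv f =ᶠ[codiscrete ℂ] logDeriv f * f := by
  refine eventually_codiscrete_iff.2 fun z ↦ ?_
  rcases (hf z).eventually_eq_zero_or_eventually_ne_zero with h | h
  · filter_upwards [eventually_nhdsNE_eventually_nhds_iff.2 h, h] with w hw hw0
    have h1 : f =ᶠ[𝓝 w] fun _ ↦ 0 := hw
    simp [h1.deriv_eq, hw0]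
  · filter_upwards [h] with w hw
    rw [Pi.mul_apply, logDeriv_apply, div_mul_cancel₀ _ hw]

theorem Meromorphic.eventually_eq_zero_of_order_eq_top {f : ℂ → ℂ} (hf : Meromorphic f) {z : ℂ}
    (hz : meromorphicOrderAt f z = ⊤) : f =ᶠ[codiscrete ℂ] 0 := by
  refine eventually_codiscrete_iff.2 fun w ↦ ?_
  by_contra h
  exact hf.exists_meromorphicOrderAt_ne_top_iff_forall.1
    ⟨w, mt meromorphicOrderAt_eq_top_iff.1 h⟩ z hz

theorem Meromorphic.eventually_ne_zero {f : ℂ → ℂ} (hf : Meromorphic f)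
    (h : ∀ z, meromorphicOrderAt f z ≠ ⊤) : ∀ᶠ z in codiscrete ℂ, f z ≠ 0 :=
  eventually_codiscrete_iff.2 fun z ↦ (meromorphicOrderAt_ne_top_iff_eventually_ne_zero (hf z)).1
    (h z)

theorem meromorphicOrderAt_deriv_eq_top {f : ℂ → ℂ} {z : ℂ} (h : meromorphicOrderAt f z = ⊤) :
    meromorphicOrderAt (deriv f) z = ⊤ := by
  rw [meromorphicOrderAt_eq_top_iff] at h ⊢
  filter_upwards [eventually_nhdsNE_eventually_nhds_iff.2 h] with w hw
  have h1 : f =ᶠ[𝓝 w] fun _ ↦ 0 := hw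
  simp [h1.deriv_eq]

theorem Filter.EventuallyEq.deriv_nhdsNE {f g : ℂ → ℂ} {z : ℂ} (h : f =ᶠ[𝓝[≠] z] g) :
    deriv f =ᶠ[𝓝[≠] z] deriv g := by
  filter_upwards [eventually_nhdsNE_eventually_nhds_iff.2 h] with w hw
  exact EventuallyEq.deriv_eq hw

theorem zero_le_meromorphicOrderAt_deriv {f : ℂ → ℂ} {z : ℂ} (hf : MeromorphicAt f z)
    (h : 0 ≤ meromorphicOrderAt f z) : 0 ≤ meromorphicOrderAt (deriv f) z := by
  have han : AnalyticAt ℂ (toMeromorphicNFAt f z) z := by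
    have hNF := meromorphicNFAt_toMeromorphicNFAt (f := f) (x := z)
    rw [← hNF.meromorphicOrderAt_nonneg_iff_analyticAt,
      ← meromorphicOrderAt_congr hf.eq_nhdsNE_toMeromorphicNFAt]
    exact h
  rw [meromorphicOrderAt_congr hf.eq_nhdsNE_toMeromorphicNFAt.deriv_nhdsNE]
  exact han.deriv.meromorphicOrderAt_nonneg

theorem sub_one_le_meromorphicOrderAt_deriv {f : ℂ → ℂ} {z : ℂ} (hf : MeromorphicAt f z) {n : ℤ}
    (h : n ≤ meromorphicOrderAt f z) : (n - 1 : ℤ) ≤ meromorphicOrderAt (deriv f) z := by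
  by_cases htop : meromorphicOrderAt f z = ⊤
  · rw [meromorphicOrderAt_deriv_eq_top htop]
    exact le_top
  obtain ⟨m, hm⟩ := WithTop.ne_top_iff_exists.1 htop
  rw [← hm, WithTop.coe_le_coe] at h
  rcases eq_or_ne m 0 with rfl | h0
  · refine le_trans ?_ (zero_le_meromorphicOrderAt_deriv hf hm.le)
    exact_mod_cast (by omega : n - 1 ≤ 0)
  · rw [meromorphicOrderAt_deriv_eq_sub_one (by exact_mod_cast h0) hm.symm, WithTop.coe_le_coe]
    omega

open ValueDistribution MeromorphicOn in
theorem logCounting_deriv_top_le {f : ℂ → ℂ} (hf : Meromorphic f) {r : ℝ} (hr : 1 ≤ r) :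
    logCounting (deriv f) ⊤ r ≤ 2 * logCounting f ⊤ r := by
  have : (divisor (deriv f) univ)⁻ ≤ (divisor f univ)⁻ + (divisor f univ)⁻ := by
    intro z
    rw [Function.locallyFinsuppWithin.coe_add, Pi.add_apply]
    simp only [Function.locallyFinsuppWithin.negPart_apply,
      divisor_apply hf.meromorphicOn (mem_univ z),
      divisor_apply hf.deriv.meromorphicOn (mem_univ z)]
    by_cases htop : meromorphicOrderAt f z = ⊤
    · simp [htop, meromorphicOrderAt_deriv_eq_top htop]
    obtain ⟨m, hm⟩ := WithTop.ne_top_iff_exists.1 htop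
    by_cases htop' : meromorphicOrderAt (deriv f) z = ⊤
    · simp only [htop', WithTop.untop₀_top, negPart_zero]
      exact add_nonneg (negPart_nonneg _) (negPart_nonneg _)
    obtain ⟨k, hk⟩ := WithTop.ne_top_iff_exists.1 htop'
    have h1 := sub_one_le_meromorphicOrderAt_deriv (hf z) hm.le
    rw [← hk, WithTop.coe_le_coe] at h1
    rw [← hm, ← hk, WithTop.untop₀_coe, WithTop.untop₀_coe]
    simp only [negPart_def]
    have h2 : 0 ≤ m → 0 ≤ k := fun h ↦ by
      have := zero_le_meromorphicOrderAt_deriv (hf z) (by rw [← hm]; exact_mod_cast h)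
      rw [← hk] at this
      exact_mod_cast this
    rcases le_or_gt 0 m with h | h
    · have := h2 h
      simp [h, this]
    · rw [max_eq_left (by omega : 0 ≤ -m)]
      omega
  have h2 := Function.locallyFinsuppWithin.logCounting_le this hr
  rw [map_add, ← logCounting_top, ← logCounting_top, Pi.add_apply] at h2
  linarith

end

section

open ValueDistribution MeromorphicOn

/-- The error terms of Nevanlinna theory for the function `g`. -/
def IsNevanlinnaSmall (g : ℂ → ℂ) (s : ℝ → ℝ) : Prop :=
  ∃ C : ℝ, 0 ≤ C ∧ ∀ r R, 1 ≤ r → r < R →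
    s r ≤ C * (1 + Real.posLog (characteristic g ⊤ R) + Real.log (R / (R - r)))

/-- The functions whose characteristic is controlled by that of `g`, at a larger radius. -/
def IsNevanlinnaDominated (g f : ℂ → ℂ) : Prop :=
  ∃ C : ℝ, 0 ≤ C ∧ ∀ r R, 1 ≤ r → r < R →
    characteristic f ⊤ r ≤ C * (R / (R - r)) * (1 + characteristic g ⊤ R)

theorem one_le_div_sub {r R : ℝ} (hr : 1 ≤ r) (hR : r < R) : 1 ≤ R / (R - r) := by
  rw [one_le_div (by linarith)]
  linarith

theorem one_le_nevanlinna_error {g : ℂ → ℂ} {r R : ℝ} (hr : 1 ≤ r) (hR : r < R) :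
    1 ≤ 1 + Real.posLog (characteristic g ⊤ R) + Real.log (R / (R - r)) := by
  have h1 := Real.posLog_nonneg (x := characteristic g ⊤ R)
  have h2 := Real.log_nonneg (one_le_div_sub hr hR)
  linarith

namespace IsNevanlinnaSmall

variable {g : ℂ → ℂ} {s s' : ℝ → ℝ}

theorem mono (h : IsNevanlinnaSmall g s) (hs : ∀ r, 1 ≤ r → s' r ≤ s r) :
    IsNevanlinnaSmall g s' := by
  obtain ⟨C, hC, h⟩ := h
  exact ⟨C, hC, fun r R hr hR ↦ (hs r hr).trans (h r R hr hR)⟩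

theorem add (h : IsNevanlinnaSmall g s) (h' : IsNevanlinnaSmall g s') :
    IsNevanlinnaSmall g (fun r ↦ s r + s' r) := by
  obtain ⟨C, hC, h⟩ := h
  obtain ⟨C', hC', h'⟩ := h'
  refine ⟨C + C', by positivity, fun r R hr hR ↦ ?_⟩
  rw [add_mul]
  exact add_le_add (h r R hr hR) (h' r R hr hR)

theorem const (c : ℝ) : IsNevanlinnaSmall g (fun _ ↦ c) := by
  refine ⟨|c|, abs_nonneg _, fun r R hr hR ↦ ?_⟩
  have := one_le_nevanlinna_error (g := g) hr hR
  nlinarith [le_abs_self c, abs_nonneg c]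

theorem const_mul (h : IsNevanlinnaSmall g s) {c : ℝ} (hc : 0 ≤ c) :
    IsNevanlinnaSmall g (fun r ↦ c * s r) := by
  obtain ⟨C, hC, h⟩ := h
  refine ⟨c * C, by positivity, fun r R hr hR ↦ ?_⟩
  rw [mul_assoc]
  exact mul_le_mul_of_nonneg_left (h r R hr hR) hc

theorem sum {ι : Type*} (u : Finset ι) {s : ι → ℝ → ℝ} (h : ∀ i ∈ u, IsNevanlinnaSmall g (s i)) :
    IsNevanlinnaSmall g (fun r ↦ ∑ i ∈ u, s i r) := by
  induction u using Finset.cons_induction with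
  | empty => simpa using const 0
  | cons a u ha ih =>
    simp only [Finset.sum_cons]
    exact (h a (by simp)).add (ih fun i hi ↦ h i (by simp [hi]))

end IsNevanlinnaSmall

namespace IsNevanlinnaDominated

variable {g f f' : ℂ → ℂ}

theorem of_eventuallyEq (h : IsNevanlinnaDominated g f) (hf : f' =ᶠ[codiscrete ℂ] f) :
    IsNevanlinnaDominated g f' := by
  obtain ⟨C, hC, h⟩ := h
  refine ⟨C, hC, fun r R hr hR ↦ ?_⟩
  rw [characteristic_congr_codiscrete hf (by linarith)]
  exact h r R hr hR

theorem refl (hg : Meromorphic g) : IsNevanlinnaDominated g g := by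
  refine ⟨1, zero_le_one, fun r R hr hR ↦ ?_⟩
  have h1 := characteristic_monotoneOn hg (show r ∈ Ioi 0 from one_pos.trans_le hr)
    (show R ∈ Ioi 0 from one_pos.trans_le (hr.trans hR.le)) hR.le
  have h2 := one_le_div_sub hr hR
  have h3 : 0 ≤ characteristic g ⊤ R := characteristic_nonneg (hr.trans hR.le)
  nlinarith

theorem const (c : ℂ) : IsNevanlinnaDominated g (fun _ ↦ c) := by
  refine ⟨Real.posLog ‖c‖, Real.posLog_nonneg, fun r R hr hR ↦ ?_⟩
  have h2 := one_le_div_sub hr hR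
  have h3 : 0 ≤ characteristic g ⊤ R := characteristic_nonneg (hr.trans hR.le)
  have h4 : characteristic (fun _ : ℂ ↦ c) ⊤ r = Real.posLog ‖c‖ := by
    rw [characteristic, Pi.add_apply, proximity_const, logCounting_const]
    simp
  have h5 := Real.posLog_nonneg (x := ‖c‖)
  rw [h4, mul_assoc]
  refine le_mul_of_one_le_right h5 ?_
  nlinarith

theorem add (h : IsNevanlinnaDominated g f) (h' : IsNevanlinnaDominated g f')
    (hf : Meromorphic f) (hf' : Meromorphic f') : IsNevanlinnaDominated g (f + f') := by
  obtain ⟨C, hC, h⟩ := h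
  obtain ⟨C', hC', h'⟩ := h'
  refine ⟨C + C' + Real.log 2, by positivity, fun r R hr hR ↦ ?_⟩
  have h2 := one_le_div_sub hr hR
  have h3 : 0 ≤ characteristic g ⊤ R := characteristic_nonneg (hr.trans hR.le)
  have h4 := characteristic_add_top_le hf hf' hr
  have h5 := Real.log_nonneg (show (1 : ℝ) ≤ 2 by norm_num)
  have h6 : Real.log 2 ≤ Real.log 2 * (R / (R - r) * (1 + characteristic g ⊤ R)) := by
    refine le_mul_of_one_le_right h5 ?_
    nlinarith
  linarith [h r R hr hR, h' r R hr hR]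

theorem mul (h : IsNevanlinnaDominated g f) (h' : IsNevanlinnaDominated g f')
    (hf : Meromorphic f) (hf' : Meromorphic f') : IsNevanlinnaDominated g (f * f') := by
  by_cases h0 : ∀ z, meromorphicOrderAt f z ≠ ⊤
  swap
  · push Not at h0
    obtain ⟨z, hz⟩ := h0
    refine (const 0).of_eventuallyEq ?_
    filter_upwards [hf.eventually_eq_zero_of_order_eq_top hz] with w hw
    simp [hw]
  by_cases h0' : ∀ z, meromorphicOrderAt f' z ≠ ⊤
  swap
  · push Not at h0'
    obtain ⟨z, hz⟩ := h0'
    refine (const 0).of_eventuallyEq ?_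
    filter_upwards [hf'.eventually_eq_zero_of_order_eq_top hz] with w hw
    simp [hw]
  obtain ⟨C, hC, h⟩ := h
  obtain ⟨C', hC', h'⟩ := h'
  refine ⟨C + C', by positivity, fun r R hr hR ↦ ?_⟩
  refine (characteristic_mul_top_le hr hf h0 hf' h0').trans ?_
  rw [Pi.add_apply, add_mul, add_mul]
  exact add_le_add (h r R hr hR) (h' r R hr hR)

theorem pow (h : IsNevanlinnaDominated g f) (hf : Meromorphic f) (n : ℕ) :
    IsNevanlinnaDominated g (f ^ n) := by
  induction n with
  | zero => exact const 1
  | succ n ih =>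
    rw [pow_succ]
    exact ih.mul h (fun z ↦ (hf z).pow n) hf

theorem prod {ι : Type*} (s : Finset ι) {f : ι → ℂ → ℂ}
    (h : ∀ i ∈ s, IsNevanlinnaDominated g (f i)) (hf : ∀ i, Meromorphic (f i)) :
    IsNevanlinnaDominated g (∏ i ∈ s, f i) := by
  induction s using Finset.cons_induction with
  | empty => exact const 1
  | cons a s ha ih =>
    rw [Finset.prod_cons]
    exact (h a (by simp)).mul (ih fun i hi ↦ h i (by simp [hi])) (hf a)
      (Meromorphic.prod fun i _ ↦ hf i)

/-- The logarithmic derivative of a dominated function has small proximity function. -/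
theorem isNevanlinnaSmall_proximity_logDeriv (h : IsNevanlinnaDominated g f) (hf : Meromorphic f) :
    IsNevanlinnaSmall g (proximity (logDeriv f) ⊤) := by
  by_cases h0 : ∀ z, meromorphicOrderAt f z ≠ ⊤
  swap
  · push Not at h0
    obtain ⟨z, hz⟩ := h0
    refine (IsNevanlinnaSmall.const 0).mono fun r hr ↦ ?_
    have : logDeriv f =ᶠ[codiscrete ℂ] fun _ ↦ 0 := by
      filter_upwards [hf.eventually_eq_zero_of_order_eq_top hz] with w hw
      simp [logDeriv_apply, hw]
    rw [proximity_congr_codiscrete this (by linarith), proximity_const]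
    simp
  obtain ⟨C, hC, hC'⟩ := exists_proximity_logDeriv_le hf h0
  obtain ⟨B, hB, hB'⟩ := h
  have hB0 := Real.posLog_nonneg (x := B)
  refine ⟨C * (2 + Real.posLog B + 3 * Real.log 2), by positivity,
    fun r R hr hR ↦ ?_⟩
  set ρ := (r + R) / 2 with hρ
  have hrρ : r < ρ := by linarith
  have hρR : ρ < R := by linarith
  have h1 := hC' r ρ hr hrρ
  have h2 := hB' ρ R (hr.trans hrρ.le) hρR
  set T := characteristic g ⊤ R with hT
  have hT0 : 0 ≤ T := characteristic_nonneg (hr.trans hR.le)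
  have h3 := one_le_div_sub hr hR
  have h4 : R / (R - ρ) = 2 * (R / (R - r)) := by
    rw [show R - ρ = (R - r) / 2 by rw [hρ]; ring]
    field_simp
  have h5 : ρ / (ρ - r) ≤ 2 * (R / (R - r)) := by
    rw [show ρ - r = (R - r) / 2 by rw [hρ]; ring, div_div_eq_mul_div, mul_comm, mul_div_assoc]
    gcongr
  have h6 : Real.log (ρ / (ρ - r)) ≤ Real.log 2 + Real.log (R / (R - r)) := by
    rw [← Real.log_mul (by norm_num) (by positivity)]
    exact Real.log_le_log (by have := one_le_div_sub hr hrρ; linarith) h5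
  have h7 : Real.posLog (characteristic f ⊤ ρ) ≤
      Real.posLog B + Real.log 2 + Real.log (R / (R - r)) + (Real.log 2 + Real.posLog T) := by
    rw [h4] at h2
    refine (Real.posLog_le_posLog (characteristic_nonneg (hr.trans hrρ.le)) h2).trans ?_
    refine Real.posLog_mul.trans ?_
    have e1 : Real.posLog (B * (2 * (R / (R - r)))) ≤
        Real.posLog B + (Real.log 2 + Real.log (R / (R - r))) := by
      refine Real.posLog_mul.trans ?_
      rw [← Real.log_mul (by norm_num) (by positivity), Real.posLog_eq_log (x := 2 * _)]
      rw [abs_of_nonneg (by positivity)]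
      linarith
    have e2 : Real.posLog (1 + T) ≤ Real.log 2 + Real.posLog T := by
      have := Real.posLog_add (x := 1) (y := T)
      simpa using this
    linarith
  have hl2 := Real.log_nonneg (show (1 : ℝ) ≤ 2 by norm_num)
  have hL := Real.log_nonneg h3
  have hP := Real.posLog_nonneg (x := T)
  have hPB := Real.posLog_nonneg (x := B)
  refine h1.trans ?_
  rw [mul_assoc]
  refine mul_le_mul_of_nonneg_left ?_ hC
  set L := Real.log (R / (R - r))
  set P := Real.posLog T
  nlinarith [mul_nonneg (add_nonneg hPB hl2) (add_nonneg hL hP)]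

theorem deriv (h : IsNevanlinnaDominated g f) (hf : Meromorphic f) :
    IsNevanlinnaDominated g (deriv f) := by
  obtain ⟨B, hB, hB'⟩ := h.isNevanlinnaSmall_proximity_logDeriv hf
  obtain ⟨C, hC, hC'⟩ := h
  refine ⟨2 * C + 2 * B, by positivity, fun r R hr hR ↦ ?_⟩
  have h1 := hB' r R hr hR
  have h2 := hC' r R hr hR
  set T := characteristic g ⊤ R with hT
  have hT0 : 0 ≤ T := characteristic_nonneg (hr.trans hR.le)
  have h3 := one_le_div_sub hr hR
  have h4 : proximity (_root_.deriv f) ⊤ r ≤ proximity (logDeriv f) ⊤ r + proximity f ⊤ r := by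
    rw [proximity_congr_codiscrete hf.deriv_eventuallyEq_logDeriv_mul (by linarith)]
    exact proximity_mul_top_le (hf.deriv.div hf) hf r
  have h5 := logCounting_deriv_top_le hf hr
  have h6 : 0 ≤ proximity f ⊤ r := proximity_nonneg r
  have h7 : characteristic f ⊤ r = proximity f ⊤ r + logCounting f ⊤ r := rfl
  have h8 : characteristic (_root_.deriv f) ⊤ r =
    proximity (_root_.deriv f) ⊤ r + logCounting (_root_.deriv f) ⊤ r := rfl
  have h9 : Real.posLog T ≤ T := by
    rw [Real.posLog_apply]
    exact max_le hT0 (Real.log_le_self hT0)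
  have h10 : Real.log (R / (R - r)) ≤ R / (R - r) := Real.log_le_self (by linarith)
  set y := R / (R - r)
  have h11 : B * (1 + Real.posLog T + Real.log y) ≤ B * (2 * y * (1 + T)) := by
    refine mul_le_mul_of_nonneg_left ?_ hB
    nlinarith
  nlinarith

theorem iteratedDeriv (h : IsNevanlinnaDominated g f) (hf : Meromorphic f) (t : ℕ) :
    IsNevanlinnaDominated g (iteratedDeriv t f) := by
  induction t with
  | zero => simpa [iteratedDeriv_zero] using h
  | succ t ih =>
    rw [iteratedDeriv_succ]
    exact ih.deriv (by rw [iteratedDeriv_eq_iterate]; exact hf.iterated_deriv)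

end IsNevanlinnaDominated

end

section

open ValueDistribution MeromorphicOn

/-- Borel's growth lemma. -/
theorem exists_le_two_mul_of_monotoneOn {T : ℝ → ℝ} (hT : MonotoneOn T (Ioi 0)) {r₀ : ℝ}
    (hr₀ : 1 ≤ r₀) (h2 : 2 ≤ T r₀) : ∃ r ≥ r₀, T (r * (1 + 1 / T r)) ≤ 2 * T r := by
  by_contra! hcon
  set ρ : ℕ → ℝ := fun k ↦ (fun r ↦ r * (1 + 1 / T r))^[k] r₀ with hρ
  have hsucc : ∀ k, ρ (k + 1) = ρ k * (1 + 1 / T (ρ k)) := fun k ↦ by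
    simp only [hρ, Function.iterate_succ_apply']
  have key : ∀ k, r₀ ≤ ρ k ∧ 2 * 2 ^ k ≤ T (ρ k) ∧ ρ k ≤ r₀ * Real.exp (1 - (1 / 2) ^ k) := by
    intro k
    induction k with
    | zero => simpa [hρ] using h2
    | succ k ih =>
      obtain ⟨h1, h3, h4⟩ := ih
      have hpos : (0 : ℝ) < 2 * 2 ^ k := by positivity
      have hTpos : 0 < T (ρ k) := hpos.trans_le h3
      refine ⟨?_, ?_, ?_⟩
      · rw [hsucc]
        refine h1.trans (le_mul_of_one_le_right (by linarith) ?_)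
        have : 0 ≤ 1 / T (ρ k) := by positivity
        linarith
      · rw [hsucc]
        have := hcon (ρ k) h1
        rw [pow_succ]
        linarith
      · rw [hsucc]
        have h5 : 1 + 1 / T (ρ k) ≤ Real.exp ((1 / 2) ^ k - (1 / 2) ^ (k + 1)) := by
          have h6 : 1 / T (ρ k) ≤ (1 / 2) ^ k - (1 / 2) ^ (k + 1) := by
            calc 1 / T (ρ k) ≤ 1 / (2 * 2 ^ k) := by gcongr
              _ = (1 / 2) ^ k - (1 / 2) ^ (k + 1) := by
                rw [pow_succ, div_pow, one_pow]; field_simp; norm_num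
          have h7 := Real.add_one_le_exp ((1 / 2 : ℝ) ^ k - (1 / 2) ^ (k + 1))
          linarith
        calc ρ k * (1 + 1 / T (ρ k)) ≤ r₀ * Real.exp (1 - (1 / 2) ^ k) *
              Real.exp ((1 / 2) ^ k - (1 / 2) ^ (k + 1)) := by
              gcongr
          _ = _ := by rw [mul_assoc, ← Real.exp_add]; congr 2; ring
  obtain ⟨k, hk⟩ := pow_unbounded_of_one_lt (T (r₀ * Real.exp 1)) one_lt_two
  obtain ⟨h1, h3, h4⟩ := key k
  have h5 : ρ k ≤ r₀ * Real.exp 1 := h4.trans (by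
    gcongr
    have : (0 : ℝ) ≤ (1 / 2) ^ k := by positivity
    linarith)
  have h6 := hT (show ρ k ∈ Ioi 0 from by have : 0 < ρ k := by linarith
                                          exact this)
    (show r₀ * Real.exp 1 ∈ Ioi 0 from mul_pos (by linarith) (Real.exp_pos 1)) h5
  have h7 : (0 : ℝ) < 2 ^ k := by positivity
  linarith

theorem not_isNevanlinnaSmall_characteristic {g : ℂ → ℂ} (hg : Meromorphic g)
    (hunb : ∀ M, ∃ r, 1 ≤ r ∧ M ≤ characteristic g ⊤ r) {c : ℝ} (hc : 0 < c) :
    ¬ IsNevanlinnaSmall g (fun r ↦ c * characteristic g ⊤ r) := by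
  rintro ⟨C, hC, h⟩
  have hlim : ∀ᶠ x : ℝ in atTop, C * (1 + Real.log (2 * x) + Real.log (x + 1)) < c * x := by
    have h1 : ∀ᶠ x : ℝ in atTop, Real.log x ≤ c / (4 * (C + 1)) * x := by
      have := Real.isLittleO_log_id_atTop.def (show 0 < c / (4 * (C + 1)) by positivity)
      filter_upwards [this, eventually_ge_atTop 1] with x hx hx1
      simpa [abs_of_nonneg (Real.log_nonneg hx1), abs_of_nonneg (zero_le_one.trans hx1)] using hx
    filter_upwards [h1, eventually_gt_atTop (8 * (C + 1) / c), eventually_ge_atTop 1]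
      with x hx hx2 hx1
    have e1 : Real.log (2 * x) ≤ 1 + Real.log x := by
      rw [Real.log_mul (by norm_num) (by linarith)]
      have := Real.log_le_sub_one_of_pos (show (0 : ℝ) < 2 by norm_num)
      linarith
    have e2 : Real.log (x + 1) ≤ 1 + Real.log x :=
      (Real.log_le_log (by linarith) (by linarith : x + 1 ≤ 2 * x)).trans e1
    have e3 : (C + 1) * Real.log x ≤ c * x / 4 := by
      calc (C + 1) * Real.log x ≤ (C + 1) * (c / (4 * (C + 1)) * x) := by gcongr
        _ = c * x / 4 := by field_simp
    rw [div_lt_iff₀ hc] at hx2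
    have e4 : 0 ≤ Real.log x := Real.log_nonneg hx1
    nlinarith
  obtain ⟨M, hM⟩ := eventually_atTop.1 hlim
  obtain ⟨r₀, hr₀, hTr₀⟩ := hunb (max M 2)
  have hmono := characteristic_monotoneOn hg
  obtain ⟨r, hr, hTr⟩ := exists_le_two_mul_of_monotoneOn hmono hr₀ ((le_max_right _ _).trans hTr₀)
  have hr1 : 1 ≤ r := hr₀.trans hr
  set x := characteristic g ⊤ r with hx
  have hx0 : max M 2 ≤ x := hTr₀.trans (hmono (show (0 : ℝ) < r₀ by linarith)
    (show (0 : ℝ) < r by linarith) hr)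
  have hx2 : 2 ≤ x := (le_max_right _ _).trans hx0
  have hxp : 0 < 1 / x := by positivity
  have hrR : r < r * (1 + 1 / x) := by nlinarith
  have h1 := h r (r * (1 + 1 / x)) hr1 hrR
  have h2 : r * (1 + 1 / x) / (r * (1 + 1 / x) - r) = x + 1 := by field_simp; ring
  have h3 : Real.posLog (characteristic g ⊤ (r * (1 + 1 / x))) ≤ Real.log (2 * x) := by
    refine (Real.posLog_le_posLog (characteristic_nonneg (hr1.trans hrR.le)) hTr).trans_eq ?_
    rw [Real.posLog_eq_log]
    rw [abs_of_nonneg (by linarith)]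
    linarith
  rw [h2] at h1
  have h4 := hM x ((le_max_left _ _).trans hx0)
  have h5 := mul_le_mul_of_nonneg_left h3 hC
  nlinarith

theorem characteristic_sub_const_le {g : ℂ → ℂ} (hg : Meromorphic g) (b : ℂ) {r : ℝ} (hr : 1 ≤ r) :
    characteristic (fun z ↦ g z - b) ⊤ r ≤
      characteristic g ⊤ r + (Real.posLog ‖b‖ + Real.log 2) := by
  have h := characteristic_add_top_le hg (Meromorphic.const (-b)) hr
  have h4 : characteristic (fun _ : ℂ ↦ -b) ⊤ r = Real.posLog ‖b‖ := by
    rw [characteristic, Pi.add_apply, proximity_const, logCounting_const]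
    simp
  rw [h4] at h
  have : (g + fun _ ↦ -b) = fun z ↦ g z - b := by ext; simp [sub_eq_add_neg]
  rw [this] at h
  linarith

theorem le_characteristic_sub_const {g : ℂ → ℂ} (hg : Meromorphic g) (b : ℂ) {r : ℝ} (hr : 1 ≤ r) :
    characteristic g ⊤ r ≤
      characteristic (fun z ↦ g z - b) ⊤ r + (Real.posLog ‖b‖ + Real.log 2) := by
  have h := characteristic_sub_const_le (g := fun z ↦ g z - b)
    (hg.sub (Meromorphic.const b)) (-b) hr
  simpa using h

/-- The first main theorem for the value `0`, with an unspecified constant. -/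
theorem exists_characteristic_eq_proximity_inv_add {g : ℂ → ℂ} (hg : Meromorphic g) :
    ∃ C, ∀ r, |characteristic g ⊤ r - (proximity g⁻¹ ⊤ r + logCounting g 0 r)| ≤ C := by
  refine ⟨max |Real.log ‖g 0‖| |Real.log ‖meromorphicTrailingCoeffAt g 0‖|, fun r ↦ ?_⟩
  have h := characteristic_sub_characteristic_inv_le hg (R := r)
  rwa [show characteristic g⁻¹ ⊤ r = proximity g⁻¹ ⊤ r + logCounting g 0 r by
    rw [← logCounting_inv]; rfl] at h

theorem exists_le_logCounting_of_pos {D : Function.locallyFinsupp ℂ ℤ} (hD : 0 ≤ D) {z : ℂ}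
    (hz : 0 < D z) (M : ℝ) : ∃ r, 1 ≤ r ∧
      M ≤ Function.locallyFinsuppWithin.logCounting D r := by
  set ρ := max 1 ‖z‖ with hρ
  have hρ1 : 1 ≤ ρ := le_max_left _ _
  set r := ρ * Real.exp |M| with hr
  have h1 : ρ ≤ r := le_mul_of_one_le_right (by linarith) (Real.one_le_exp (abs_nonneg M))
  refine ⟨r, hρ1.trans h1, ?_⟩
  have h2 := sum_mul_log_le_logCounting hD (s := {z}) (ρ := ρ) (R := r)
    (by simp [hρ]) hρ1 h1
  have h3 : (1 : ℝ) ≤ D z := by exact_mod_cast hz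
  have h4 : Real.log r - Real.log ρ = |M| := by
    rw [hr, Real.log_mul (by linarith) (Real.exp_pos _).ne', Real.log_exp]
    ring
  rw [Finset.sum_singleton, h4] at h2
  have := le_abs_self M
  nlinarith [abs_nonneg M]

/-- The characteristic function of a nonconstant meromorphic function is unbounded. -/
theorem exists_le_characteristic {g : ℂ → ℂ} (hg : Meromorphic g)
    (hnc : ∀ b : ℂ, ∀ z, meromorphicOrderAt (fun w ↦ g w - b) z ≠ ⊤) (M : ℝ) :
    ∃ r, 1 ≤ r ∧ M ≤ characteristic g ⊤ r := by
  by_cases hpole : meromorphicOrderAt g 0 < 0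
  · have hD : 0 < (divisor g univ)⁻ 0 := by
      rw [Function.locallyFinsuppWithin.negPart_apply, divisor_apply hg.meromorphicOn (mem_univ _)]
      obtain ⟨n, hn⟩ := WithTop.ne_top_iff_exists.1 hpole.ne_top
      rw [← hn] at hpole ⊢
      have : n < 0 := by exact_mod_cast hpole
      simp only [WithTop.untop₀_coe, negPart_def]
      simpa using this
    obtain ⟨r, hr, h⟩ := exists_le_logCounting_of_pos (negPart_nonneg _) hD M
    refine ⟨r, hr, h.trans ?_⟩
    rw [← logCounting_top]
    exact le_add_of_nonneg_left (proximity_nonneg r)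
  · push Not at hpole
    obtain ⟨b, hb⟩ : ∃ b, Tendsto g (𝓝[≠] 0) (𝓝 b) :=
      (tendsto_nhds_iff_meromorphicOrderAt_nonneg (hg 0)).2 hpole
    have hgb : Meromorphic fun w ↦ g w - b := hg.sub (Meromorphic.const b)
    have hord : 0 < meromorphicOrderAt (fun w ↦ g w - b) 0 := by
      rw [← tendsto_zero_iff_meromorphicOrderAt_pos (hgb 0)]
      simpa using hb.sub_const b
    have hD : 0 < (divisor (fun w ↦ g w - b) univ)⁺ 0 := by
      rw [Function.locallyFinsuppWithin.posPart_apply, divisor_apply hgb.meromorphicOn (mem_univ _)]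
      obtain ⟨n, hn⟩ := WithTop.ne_top_iff_exists.1 (hnc b 0)
      rw [← hn] at hord ⊢
      have : 0 < n := by exact_mod_cast hord
      simp only [WithTop.untop₀_coe, posPart_def]
      simpa using this
    obtain ⟨C, hC⟩ := exists_characteristic_eq_proximity_inv_add hgb
    obtain ⟨r, hr, h⟩ := exists_le_logCounting_of_pos (posPart_nonneg _) hD
      (M + C + (Real.posLog ‖b‖ + Real.log 2))
    refine ⟨r, hr, ?_⟩
    rw [← logCounting_zero] at h
    have h1 := abs_le.1 (hC r)
    have h2 := characteristic_sub_const_le hg b hr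
    have h3 : 0 ≤ proximity (fun w ↦ g w - b)⁻¹ ⊤ r := proximity_nonneg r
    linarith [h1.1]

end

section

open ValueDistribution MeromorphicOn

theorem circleAverage_mono_codiscrete {f₁ f₂ : ℂ → ℝ} {r : ℝ} (hr : 0 < r)
    (hf₁ : CircleIntegrable f₁ 0 r) (hf₂ : CircleIntegrable f₂ 0 r)
    (h : ∀ᶠ z in codiscrete ℂ, f₁ z ≤ f₂ z) :
    Real.circleAverage f₁ 0 r ≤ Real.circleAverage f₂ 0 r := by
  have hcongr : f₁ =ᶠ[codiscreteWithin (Metric.sphere (0 : ℂ) |r|)] fun z ↦ min (f₁ z) (f₂ z) := by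
    filter_upwards [Filter.codiscreteWithin_mono (subset_univ _) h] with z hz
    exact (min_eq_left hz).symm
  rw [Real.circleAverage_congr_codiscreteWithin hcongr hr.ne']
  exact Real.circleAverage_mono (hf₁.congr_codiscreteWithin hcongr) hf₂
    fun z _ ↦ min_le_right _ _

/-- Only one of finitely many distinct values can be approached at a time. -/
theorem exists_sum_posLog_inv_sub_le (B : Finset ℂ) : ∃ C : ℝ, 0 ≤ C ∧ ∀ w : ℂ,
    ∑ b ∈ B, Real.posLog ‖(w - b)⁻¹‖ ≤ C ∨
      ∃ c ∈ B, ∑ b ∈ B, Real.posLog ‖(w - b)⁻¹‖ ≤ C + Real.posLog ‖(w - c)⁻¹‖ := by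
  induction B using Finset.induction_on with
  | empty => exact ⟨0, le_rfl, fun w ↦ Or.inl (by simp)⟩
  | insert c B hc ih =>
    obtain ⟨C, hC, h⟩ := ih
    obtain ⟨ε, hε, hε'⟩ := Metric.isOpen_iff.1 B.finite_toSet.isClosed.isOpen_compl c
      (by simpa using hc)
    set L := Real.posLog (2 / ε) with hL
    have hL0 : 0 ≤ L := Real.posLog_nonneg
    have hfar : ∀ w b : ℂ, ε / 2 ≤ ‖w - b‖ → Real.posLog ‖(w - b)⁻¹‖ ≤ L := by
      intro w b hwb
      refine Real.posLog_le_posLog (norm_nonneg _) ?_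
      rw [norm_inv, ← inv_div]
      exact inv_anti₀ (by positivity) hwb
    refine ⟨C + L + B.card * L, by positivity, fun w ↦ ?_⟩
    have hBL : 0 ≤ B.card * L := by positivity
    simp only [Finset.sum_insert hc]
    rcases le_or_gt (ε / 2) ‖w - c‖ with hw | hw
    · have h1 := hfar w c hw
      rcases h w with h2 | ⟨d, hd, h2⟩
      · left; linarith
      · right; exact ⟨d, by simp [hd], by linarith⟩
    · right
      refine ⟨c, by simp, ?_⟩
      have h1 : ∑ b ∈ B, Real.posLog ‖(w - b)⁻¹‖ ≤ B.card * L := by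
        rw [← nsmul_eq_mul]
        refine Finset.sum_le_card_nsmul _ _ _ fun b hb ↦ hfar w b ?_
        have h3 : ε ≤ ‖b - c‖ := by
          by_contra! h4
          exact hε' (by simpa [dist_eq_norm] using h4) (by simpa using hb)
        have h4 := norm_sub_le_norm_sub_add_norm_sub b w c
        rw [norm_sub_rev b w] at h4
        linarith
      linarith

theorem exists_sum_posLog_le (B : Finset ℂ) : ∃ C : ℝ, 0 ≤ C ∧ ∀ w w' : ℂ, w' ≠ 0 →
    ∑ b ∈ B, Real.posLog ‖(w - b)⁻¹‖ ≤
      C + Real.posLog ‖w'⁻¹‖ + ∑ b ∈ B, Real.posLog ‖w' / (w - b)‖ := by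
  obtain ⟨C, hC, h⟩ := exists_sum_posLog_inv_sub_le B
  refine ⟨C, hC, fun w w' hw' ↦ ?_⟩
  have h0 : 0 ≤ Real.posLog ‖w'⁻¹‖ := Real.posLog_nonneg
  have h1 : ∀ b ∈ B, 0 ≤ Real.posLog ‖w' / (w - b)‖ := fun _ _ ↦ Real.posLog_nonneg
  rcases h w with h2 | ⟨c, hc, h2⟩
  · linarith [Finset.sum_nonneg h1]
  · have h3 := Finset.single_le_sum h1 hc
    have h4 : Real.posLog ‖(w - c)⁻¹‖ ≤ Real.posLog ‖w'⁻¹‖ + Real.posLog ‖w' / (w - c)‖ := by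
      rw [show (w - c)⁻¹ = w'⁻¹ * (w' / (w - c)) by field_simp, norm_mul]
      exact Real.posLog_mul
    linarith

theorem proximity_prod_top_le {ι : Type*} (s : Finset ι) {f : ι → ℂ → ℂ}
    (hf : ∀ i, Meromorphic (f i)) (r : ℝ) :
    proximity (∏ i ∈ s, f i) ⊤ r ≤ ∑ i ∈ s, proximity (f i) ⊤ r := by
  induction s using Finset.induction_on with
  | empty =>
    have : (∏ i ∈ (∅ : Finset ι), f i) = fun _ ↦ 1 := by ext; simp
    rw [this, proximity_const]
    simp
  | insert a s ha ih =>
    rw [Finset.prod_insert ha, Finset.sum_insert ha]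
    exact (proximity_mul_top_le (hf a) (Meromorphic.prod fun i _ ↦ hf i) r).trans
      (by rw [Pi.add_apply]; linarith)

/-- Several proximity functions are controlled simultaneously by that of the inverse of the
derivative. -/
theorem sum_proximity_inv_sub_le {g G : ℂ → ℂ} (hdom : IsNevanlinnaDominated g G)
    (hG : Meromorphic G) (hG' : ∀ z, meromorphicOrderAt (deriv G) z ≠ ⊤) (B : Finset ℂ) :
    ∃ s, IsNevanlinnaSmall g s ∧ ∀ r, 1 ≤ r →
      ∑ b ∈ B, proximity (fun z ↦ G z - b)⁻¹ ⊤ r ≤ proximity (deriv G)⁻¹ ⊤ r + s r := by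
  obtain ⟨C, hC, h⟩ := exists_sum_posLog_le B
  have hGb : ∀ b, Meromorphic fun z ↦ G z - b := fun b ↦ hG.sub (Meromorphic.const b)
  have hdomb : ∀ b, IsNevanlinnaDominated g fun z ↦ G z - b := fun b ↦ by
    have := hdom.add (IsNevanlinnaDominated.const (-b)) hG (Meromorphic.const (-b))
    convert this using 1
    ext z
    simp [sub_eq_add_neg]
  refine ⟨_, (IsNevanlinnaSmall.const C).add (IsNevanlinnaSmall.sum B fun b _ ↦
    (hdomb b).isNevanlinnaSmall_proximity_logDeriv (hGb b)), fun r hr ↦ ?_⟩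
  have hcint : ∀ {f : ℂ → ℂ}, Meromorphic f → CircleIntegrable (fun z ↦ Real.posLog ‖f z‖) 0 r :=
    fun hf ↦ (hf.meromorphicOn (s := Metric.sphere 0 |r|)).circleIntegrable_posLog_norm
  simp only [proximity_top]
  have e1 : ∑ b ∈ B, Real.circleAverage (fun z ↦ Real.posLog ‖(fun z ↦ G z - b)⁻¹ z‖) 0 r =
      Real.circleAverage (fun z ↦ ∑ b ∈ B, Real.posLog ‖(fun z ↦ G z - b)⁻¹ z‖) 0 r :=
    (Real.circleAverage_fun_sum fun b _ ↦ hcint (hGb b).inv).symm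
  have e2 : ∑ b ∈ B, Real.circleAverage (fun z ↦ Real.posLog ‖logDeriv (fun z ↦ G z - b) z‖) 0 r =
      Real.circleAverage (fun z ↦ ∑ b ∈ B, Real.posLog ‖logDeriv (fun z ↦ G z - b) z‖) 0 r :=
    (Real.circleAverage_fun_sum fun b _ ↦ hcint ((hGb b).deriv.div (hGb b))).symm
  have i1 : CircleIntegrable (fun z ↦ ∑ b ∈ B, Real.posLog ‖(fun z ↦ G z - b)⁻¹ z‖) 0 r :=
    CircleIntegrable.fun_sum B fun b _ ↦ hcint (hGb b).inv
  have i2 : CircleIntegrable (fun z ↦ ∑ b ∈ B, Real.posLog ‖logDeriv (fun z ↦ G z - b) z‖) 0 r :=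
    CircleIntegrable.fun_sum B fun b _ ↦ hcint ((hGb b).deriv.div (hGb b))
  have i3 : CircleIntegrable (fun z ↦ Real.posLog ‖(deriv G)⁻¹ z‖) 0 r := hcint hG.deriv.inv
  have i4 : CircleIntegrable (fun _ : ℂ ↦ C) 0 r := circleIntegrable_const _ _ _
  have key := circleAverage_mono_codiscrete (by linarith) i1 ((i4.fun_add i3).fun_add i2) <| by
    filter_upwards [hG.deriv.eventually_ne_zero hG'] with z hz
    have := h (G z) (deriv G z) hz
    simpa [logDeriv_apply] using this
  rw [Real.circleAverage_fun_add (i4.fun_add i3) i2, Real.circleAverage_fun_add i4 i3,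
    Real.circleAverage_const] at key
  rw [e1, e2]
  linarith

end

section

open ValueDistribution MeromorphicOn

theorem Meromorphic.iteratedDeriv {f : ℂ → ℂ} (hf : Meromorphic f) (t : ℕ) :
    Meromorphic (iteratedDeriv t f) := by
  rw [iteratedDeriv_eq_iterate]
  exact hf.iterated_deriv

/-- A function with vanishing derivative is constant. -/
theorem Meromorphic.exists_eventuallyEq_const {F : ℂ → ℂ} (hF : Meromorphic F) {z : ℂ}
    (hz : meromorphicOrderAt (deriv F) z = ⊤) : ∃ c : ℂ, F =ᶠ[codiscrete ℂ] fun _ ↦ c := by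
  have h1 : ∀ᶠ w in 𝓝[≠] z, AnalyticAt ℂ F w := (hF z).eventually_analyticAt
  have h2 := eventually_nhdsNE_eventually_nhds_iff.2 (meromorphicOrderAt_eq_top_iff.1 hz)
  obtain ⟨w, hw, hw2⟩ := (h1.and h2).exists
  obtain ⟨ε, hε, hε'⟩ := Metric.eventually_nhds_iff_ball.1 (hw.eventually_analyticAt.and hw2)
  refine ⟨F w, ?_⟩
  have h3 : ∀ y ∈ Metric.ball w ε, F y = F w := fun y hy ↦
    (convex_ball w ε).is_const_of_fderivWithin_eq_zero (𝕜 := ℂ)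
      (fun x hx ↦ ((hε' x hx).1.differentiableAt).differentiableWithinAt)
      (fun x hx ↦ by
        rw [fderivWithin_of_isOpen Metric.isOpen_ball hx]
        ext
        simpa using (hε' x hx).2) hy (Metric.mem_ball_self hε)
  have h4 : meromorphicOrderAt (fun y ↦ F y - F w) w = ⊤ := by
    rw [meromorphicOrderAt_eq_top_iff]
    filter_upwards [mem_nhdsWithin_of_mem_nhds (Metric.ball_mem_nhds w hε)] with y hy
    rw [h3 y hy, sub_self]
  filter_upwards [(hF.sub (Meromorphic.const (F w))).eventually_eq_zero_of_order_eq_top h4]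
    with y hy
  exact sub_eq_zero.1 hy

theorem isNevanlinnaSmall_proximity_iteratedDeriv_div {g h : ℂ → ℂ}
    (hd : IsNevanlinnaDominated g h) (hh : Meromorphic h) (t : ℕ) :
    IsNevanlinnaSmall g (proximity (iteratedDeriv t h / h) ⊤) := by
  induction t with
  | zero =>
    refine (IsNevanlinnaSmall.const 0).mono fun r hr ↦ ?_
    rw [proximity_top]
    have : (fun z ↦ Real.posLog ‖(iteratedDeriv 0 h / h) z‖) = fun _ ↦ 0 := by
      ext z
      rcases eq_or_ne (h z) 0 with h0 | h0
      · simp [h0]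
      · simp [div_self h0]
    rw [this, Real.circleAverage_const]
  | succ t ih =>
    have h1 := (hd.iteratedDeriv hh t).isNevanlinnaSmall_proximity_logDeriv (hh.iteratedDeriv t)
    refine (h1.add ih).mono fun r hr ↦ ?_
    have h2 : iteratedDeriv (t + 1) h / h =ᶠ[codiscrete ℂ]
        logDeriv (iteratedDeriv t h) * (iteratedDeriv t h / h) := by
      filter_upwards [(hh.iteratedDeriv t).deriv_eventuallyEq_logDeriv_mul] with z hz
      rw [Pi.div_apply, iteratedDeriv_succ, hz]
      simp [mul_div_assoc]
    rw [proximity_congr_codiscrete h2 (by linarith)]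
    exact proximity_mul_top_le ((hh.iteratedDeriv t).deriv.div (hh.iteratedDeriv t))
      ((hh.iteratedDeriv t).div hh) r

/-- A bound for the proximity function of the inverse of `g`. -/
theorem mul_proximity_inv_le {g F Q : ℂ → ℂ} {m : ℕ} (hF : Meromorphic F) (hQ : Meromorphic Q)
    (hFQ : F =ᶠ[codiscrete ℂ] g ^ m * Q) (hF0 : ∀ z, meromorphicOrderAt F z ≠ ⊤) {r : ℝ}
    (hr : 1 ≤ r) : m * proximity g⁻¹ ⊤ r ≤ proximity F⁻¹ ⊤ r + proximity Q ⊤ r := by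
  have h1 : g⁻¹ ^ m =ᶠ[codiscrete ℂ] F⁻¹ * Q := by
    filter_upwards [hFQ, hF.eventually_ne_zero hF0] with z hz hz0
    rw [hz, Pi.mul_apply, Pi.pow_apply] at hz0
    have h2 := left_ne_zero_of_mul hz0
    have h3 := right_ne_zero_of_mul hz0
    rw [Pi.mul_apply, Pi.inv_apply, hz, Pi.pow_apply, Pi.mul_apply, Pi.pow_apply,
      Pi.inv_apply, inv_pow]
    field_simp
  have h2 := proximity_mul_top_le hF.inv hQ r
  rw [← proximity_congr_codiscrete h1 (by linarith), proximity_pow_top] at h2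
  simpa using h2

theorem proximity_le_mul {g F Q : ℂ → ℂ} {m : ℕ} (hg : Meromorphic g) (hQ : Meromorphic Q)
    (hFQ : F =ᶠ[codiscrete ℂ] g ^ m * Q) {r : ℝ}
    (hr : 1 ≤ r) : proximity F ⊤ r ≤ m * proximity g ⊤ r + proximity Q ⊤ r := by
  have h2 := proximity_mul_top_le (f₁ := g ^ m) (fun z ↦ (hg z).pow m) hQ r
  rw [← proximity_congr_codiscrete hFQ (by linarith), Pi.add_apply, proximity_pow_top] at h2
  simpa using h2

theorem false_of_deriv_eq_zero {g F Q : ℂ → ℂ} {m : ℕ} (hg : Meromorphic g)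
    (hnc : ∀ b : ℂ, ∀ z, meromorphicOrderAt (fun w ↦ g w - b) z ≠ ⊤)
    (hF : Meromorphic F) (hQ : Meromorphic Q) (hQs : IsNevanlinnaSmall g (proximity Q ⊤))
    (hm : 1 ≤ m) (hFQ : F =ᶠ[codiscrete ℂ] g ^ m * Q) (hF0 : ∀ z, meromorphicOrderAt F z ≠ ⊤)
    {z₀ : ℂ} (hF' : meromorphicOrderAt (deriv F) z₀ = ⊤)
    (hzero : ∀ z, 0 < meromorphicOrderAt g z → 0 < meromorphicOrderAt F z) : False := by
  obtain ⟨c, hc⟩ := hF.exists_eventuallyEq_const hF'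
  have hc0 : c ≠ 0 := by
    rintro rfl
    exact hF0 0 (meromorphicOrderAt_eq_top_iff.2 (eventually_codiscrete_iff.1 hc 0))
  have hord : ∀ z, meromorphicOrderAt F z = 0 := fun z ↦ by
    rw [meromorphicOrderAt_congr (eventually_codiscrete_iff.1 hc z), meromorphicOrderAt_const,
      if_neg hc0]
  have hN : ∀ r, logCounting g 0 r = 0 := fun r ↦ by
    rw [logCounting_zero]
    have : (divisor g univ)⁺ = 0 := by
      ext z
      rw [Function.locallyFinsuppWithin.posPart_apply, divisor_apply hg.meromorphicOn (mem_univ z)]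
      have h1 : ¬ 0 < meromorphicOrderAt g z := fun h ↦ by simpa [hord z] using hzero z h
      simp only [posPart_def, Function.locallyFinsuppWithin.coe_zero, Pi.zero_apply]
      have h2 : (meromorphicOrderAt g z).untop₀ ≤ 0 := by
        have := hnc 0 z
        simp only [sub_zero] at this
        obtain ⟨p, hp⟩ := WithTop.ne_top_iff_exists.1 this
        rw [← hp] at h1 ⊢
        simpa using h1
      exact max_eq_right h2
    simp [this]
  obtain ⟨C, hC⟩ := exists_characteristic_eq_proximity_inv_add hg
  refine not_isNevanlinnaSmall_characteristic hg (exists_le_characteristic hg hnc) one_pos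
    ((hQs.add (IsNevanlinnaSmall.const (Real.posLog ‖c⁻¹‖ + C))).mono fun r hr ↦ ?_)
  have h1 := mul_proximity_inv_le hF hQ hFQ hF0 hr
  have h2 : proximity F⁻¹ ⊤ r = Real.posLog ‖c⁻¹‖ := by
    have : F⁻¹ =ᶠ[codiscrete ℂ] fun _ ↦ c⁻¹ := by
      filter_upwards [hc] with z hz
      simp [hz]
    rw [proximity_congr_codiscrete this (by linarith), proximity_const]
  have h3 := (abs_le.1 (hC r)).2
  rw [hN] at h3
  have h4 : (1 : ℝ) ≤ m := by exact_mod_cast hm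
  have h5 : 0 ≤ proximity g⁻¹ ⊤ r := proximity_nonneg r
  nlinarith

end

section

open ValueDistribution MeromorphicOn

theorem tendsto_of_meromorphicOrderAt_sub_pos {G : ℂ → ℂ} {z b : ℂ} (hG : MeromorphicAt G z)
    (h : 0 < meromorphicOrderAt (fun w ↦ G w - b) z) : Tendsto G (𝓝[≠] z) (𝓝 b) := by
  replace h := (tendsto_zero_iff_meromorphicOrderAt_pos (hG.sub (MeromorphicAt.const b z))).2 h
  simpa using h.add_const b

theorem nevanlinna_order_inequality {ι : Type*} [Fintype ι] {N τ : ℕ} {p P P' : ℤ} {d : ι → ℤ}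
    (h1 : N * p - τ ≤ P) (h2 : 0 ≤ p → 0 ≤ P) (h3 : P - 1 ≤ P') (h4 : 0 ≤ P → 0 ≤ P')
    (h5 : P ≠ 0 → ∀ i, d i ≤ 0) (h6 : ∀ i j, i ≠ j → d i ≤ 0 ∨ d j ≤ 0) :
    N * p⁺ + P'⁻ + ∑ i, (d i)⁺ ≤
      P⁻ + P'⁺ + (τ + 1) * p⁺ + p⁻ + ∑ i, ((d i)⁺ - min (d i)⁺ P'⁺) := by
  rw [Finset.sum_sub_distrib]
  set x := ∑ i, min (d i)⁺ P'⁺ with hx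
  have hx0 : P ≠ 0 → x = 0 := fun h ↦ Finset.sum_eq_zero fun i _ ↦ by
    rw [posPart_eq_zero.2 (h5 h i)]
    exact min_eq_left (posPart_nonneg _)
  have hxP : x ≤ P'⁺ := by
    by_cases hd : ∃ i, 0 < d i
    · obtain ⟨i, hi⟩ := hd
      rw [hx, Finset.sum_eq_single i]
      · exact min_le_right _ _
      · intro j _ hj
        have : d j ≤ 0 := (h6 i j hj.symm).resolve_left (by omega)
        rw [posPart_eq_zero.2 this]
        exact min_eq_left (posPart_nonneg _)
      · simp
    · push Not at hd
      have : x = 0 := Finset.sum_eq_zero fun i _ ↦ by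
        rw [posPart_eq_zero.2 (hd i)]
        exact min_eq_left (posPart_nonneg _)
      rw [this]
      exact posPart_nonneg _
  suffices N * p⁺ + P'⁻ + x ≤ P⁻ + P'⁺ + (τ + 1) * p⁺ + p⁻ by linarith
  simp only [posPart_def, negPart_def] at *
  rcases le_or_gt p 0 with hp | hp
  · rw [max_eq_right hp, mul_zero, mul_zero]
    rcases lt_trichotomy P 0 with hP | hP | hP
    · have := hx0 (by omega)
      have hp0 : p < 0 := by by_contra; omega
      simp only [Int.max_def] at *
      split_ifs at * <;> omega
    · have := h4 (by omega)
      simp only [Int.max_def] at *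
      split_ifs at * <;> omega
    · have := h4 (by omega)
      simp only [Int.max_def] at *
      split_ifs at * <;> omega
  · have hP := h2 hp.le
    have hP' := h4 hP
    have h7 : ((τ : ℤ) + 1) ≤ (τ + 1) * p := le_mul_of_one_le_right (by positivity) (by omega)
    rw [max_eq_left hp.le, max_eq_left hP', max_eq_right (by omega : -P' ≤ 0),
      max_eq_right (by omega : -P ≤ 0), max_eq_right (by omega : -p ≤ 0)]
    rw [max_eq_left hP'] at hxP
    rcases eq_or_ne P 0 with h0 | h0
    · linarith
    · have := hx0 h0
      linarith

theorem nevanlinna_counting_inequality {ι : Type*} [Fintype ι] {N τ : ℕ} {g G : ℂ → ℂ} {a : ι → ℂ}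
    (hg : Meromorphic g) (hg0 : ∀ z, meromorphicOrderAt g z ≠ ⊤) (hG : Meromorphic G)
    (hG0 : ∀ z, meromorphicOrderAt G z ≠ ⊤) (hG' : ∀ z, meromorphicOrderAt (deriv G) z ≠ ⊤)
    (ha : ∀ i, a i ≠ 0) (hinj : Function.Injective a)
    (hord : ∀ z, ∀ p : ℤ, meromorphicOrderAt g z = p →
      ((N * p - τ : ℤ) : WithTop ℤ) ≤ meromorphicOrderAt G z)
    (hord0 : ∀ z, 0 ≤ meromorphicOrderAt g z → 0 ≤ meromorphicOrderAt G z)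
    {E : ι → Function.locallyFinsupp ℂ ℤ}
    (hE : ∀ i, E i = (divisor (fun w ↦ G w - a i) univ)⁺ -
      (divisor (fun w ↦ G w - a i) univ)⁺ ⊓ (divisor (deriv G) univ)⁺) {r : ℝ} (hr : 1 ≤ r) :
    N * logCounting g 0 r + logCounting (deriv G) ⊤ r + ∑ i, logCounting (fun w ↦ G w - a i) 0 r ≤
      logCounting G ⊤ r + logCounting (deriv G) 0 r + (τ + 1) * logCounting g 0 r +
        logCounting g ⊤ r +
        ∑ i, Function.locallyFinsuppWithin.logCounting (E i) r := by
  have hGa : ∀ i, Meromorphic fun w ↦ G w - a i := fun i ↦ hG.sub (Meromorphic.const _)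
  have key : N • (divisor g univ)⁺ + (divisor (deriv G) univ)⁻ +
      ∑ i, (divisor (fun w ↦ G w - a i) univ)⁺ ≤ (divisor G univ)⁻ + (divisor (deriv G) univ)⁺ +
        (τ + 1) • (divisor g univ)⁺ + (divisor g univ)⁻ + ∑ i, E i := by
    intro z
    simp only [hE, Function.locallyFinsuppWithin.coe_add, Pi.add_apply,
      Function.locallyFinsuppWithin.coe_sub, Pi.sub_apply,
      Function.locallyFinsuppWithin.coe_nsmul, Pi.smul_apply,
      Function.locallyFinsuppWithin.coe_sum, Finset.sum_apply,
      Function.locallyFinsuppWithin.min_apply,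
      Function.locallyFinsuppWithin.posPart_apply, Function.locallyFinsuppWithin.negPart_apply,
      divisor_apply hg.meromorphicOn (mem_univ z), divisor_apply hG.meromorphicOn (mem_univ z),
      divisor_apply hG.deriv.meromorphicOn (mem_univ z),
      divisor_apply (hGa _).meromorphicOn (mem_univ z)]
    obtain ⟨p, hp⟩ := WithTop.ne_top_iff_exists.1 (hg0 z)
    obtain ⟨P, hP⟩ := WithTop.ne_top_iff_exists.1 (hG0 z)
    obtain ⟨P', hP'⟩ := WithTop.ne_top_iff_exists.1 (hG' z)
    have hd : ∀ i, 0 < (meromorphicOrderAt (fun w ↦ G w - a i) z).untop₀ →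
        Tendsto G (𝓝[≠] z) (𝓝 (a i)) := fun i hi ↦
      tendsto_of_meromorphicOrderAt_sub_pos (hG z) (by
        by_contra! h
        obtain ⟨m, hm⟩ := WithTop.ne_top_iff_exists.1 (h.trans_lt (WithTop.coe_lt_top (0 : ℤ))).ne
        rw [← hm] at h hi
        rw [WithTop.untop₀_coe] at hi
        exact absurd (WithTop.coe_le_coe.1 h) (by omega))
    have := nevanlinna_order_inequality (ι := ι) (N := N) (τ := τ) (p := p) (P := P) (P' := P')
      (d := fun i ↦ (meromorphicOrderAt (fun w ↦ G w - a i) z).untop₀) ?_ ?_ ?_ ?_ ?_ ?_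
    · rw [← hp, ← hP, ← hP']
      simpa using this
    · have := hord z p hp.symm
      rw [← hP] at this
      exact_mod_cast this
    · intro h
      have := hord0 z (by rw [← hp]; exact_mod_cast h)
      rw [← hP] at this
      exact_mod_cast this
    · have := sub_one_le_meromorphicOrderAt_deriv (hG z) hP.le
      rw [← hP'] at this
      exact_mod_cast this
    · intro h
      have := zero_le_meromorphicOrderAt_deriv (hG z) (by rw [← hP]; exact_mod_cast h)
      rw [← hP'] at this
      exact_mod_cast this
    · intro h i
      by_contra! hi
      have h1 := hd i hi
      have h2 : 0 ≤ meromorphicOrderAt G z :=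
        (tendsto_nhds_iff_meromorphicOrderAt_nonneg (hG z)).1 ⟨_, h1⟩
      have h3 : 0 < meromorphicOrderAt G z := by
        refine h2.lt_of_ne fun h0 ↦ h ?_
        rw [← hP] at h0
        exact_mod_cast h0.symm
      exact ha i (tendsto_nhds_unique h1 ((tendsto_zero_iff_meromorphicOrderAt_pos (hG z)).2 h3))
    · intro i j hij
      by_contra! h
      exact hij (hinj (tendsto_nhds_unique (hd i h.1) (hd j h.2)))
  have h := Function.locallyFinsuppWithin.logCounting_le key hr
  simp only [map_add, map_sum, map_nsmul, Pi.add_apply, Finset.sum_apply,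
    ← logCounting_zero, ← logCounting_top, nsmul_eq_mul] at h
  exact_mod_cast h

end

section

open ValueDistribution MeromorphicOn

/-- The ramified part of the counting function of a totally ramified value. -/
theorem logCounting_ramified_le {G : ℂ → ℂ} {a : ℂ} {l : ℕ∞} (hl : l ≠ 0) (hG : Meromorphic G)
    (hG' : ∀ z, meromorphicOrderAt (deriv G) z ≠ ⊤)
    (h : ∀ z, 0 < meromorphicOrderAt (fun w ↦ G w - a) z →
      l.map (fun x : ℕ ↦ (x : ℤ)) ≤ meromorphicOrderAt (fun w ↦ G w - a) z) {r : ℝ} (hr : 1 ≤ r) :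
    Function.locallyFinsuppWithin.logCounting ((divisor (fun w ↦ G w - a) univ)⁺ -
      (divisor (fun w ↦ G w - a) univ)⁺ ⊓ (divisor (deriv G) univ)⁺) r ≤
        ((l : ℝ≥0∞)⁻¹).toReal * logCounting (fun w ↦ G w - a) 0 r := by
  have hGa : Meromorphic fun w ↦ G w - a := hG.sub (Meromorphic.const _)
  have hder : deriv (fun w ↦ G w - a) = deriv G := by ext; simp
  have htop : ∀ z, meromorphicOrderAt (fun w ↦ G w - a) z ≠ ⊤ := fun z hz ↦ hG' z (by
    rw [← hder]; exact meromorphicOrderAt_deriv_eq_top hz)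
  induction l using ENat.recTopCoe with
  | top =>
    have h0 : (divisor (fun w ↦ G w - a) univ)⁺ = 0 := by
      ext z
      rw [Function.locallyFinsuppWithin.posPart_apply, divisor_apply hGa.meromorphicOn (mem_univ z)]
      obtain ⟨d, hd⟩ := WithTop.ne_top_iff_exists.1 (htop z)
      rw [← hd, WithTop.untop₀_coe, posPart_def]
      refine max_eq_right ?_
      by_contra! h1
      have h2 := h z (by rw [← hd]; exact_mod_cast h1)
      exact htop z (top_le_iff.1 h2)
    simp [h0]
  | coe l =>
    have hl0 : l ≠ 0 := by exact_mod_cast hl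
    have key : l • ((divisor (fun w ↦ G w - a) univ)⁺ -
        (divisor (fun w ↦ G w - a) univ)⁺ ⊓ (divisor (deriv G) univ)⁺) ≤
          (divisor (fun w ↦ G w - a) univ)⁺ := by
      intro z
      simp only [Function.locallyFinsuppWithin.coe_sub, Pi.sub_apply,
        Function.locallyFinsuppWithin.coe_nsmul, Pi.smul_apply,
        Function.locallyFinsuppWithin.min_apply,
        Function.locallyFinsuppWithin.posPart_apply,
        divisor_apply hG.deriv.meromorphicOn (mem_univ z),
        divisor_apply hGa.meromorphicOn (mem_univ z)]
      obtain ⟨d, hd⟩ := WithTop.ne_top_iff_exists.1 (htop z)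
      obtain ⟨P, hP⟩ := WithTop.ne_top_iff_exists.1 (hG' z)
      have h1 := sub_one_le_meromorphicOrderAt_deriv (hGa z) hd.le
      rw [hder, ← hP, WithTop.coe_le_coe] at h1
      rw [← hd, ← hP, WithTop.untop₀_coe, WithTop.untop₀_coe]
      rcases le_or_gt d 0 with h0 | h0
      · rw [posPart_eq_zero.2 h0, min_eq_left (posPart_nonneg _)]
        simp
      · have h2 := h z (by rw [← hd]; exact_mod_cast h0)
        rw [← hd] at h2
        have h3 : (l : ℤ) ≤ d := by
          rw [ENat.map_natCast] at h2
          exact WithTop.coe_le_coe.1 h2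
        have h4 : d⁺ - min d⁺ P⁺ ≤ 1 := by
          simp only [posPart_def, Int.max_def, Int.min_def]
          split_ifs <;> omega
        rw [nsmul_eq_mul]
        calc (l : ℤ) * (d⁺ - min d⁺ P⁺) ≤ l * 1 := by gcongr
          _ ≤ d⁺ := by rw [mul_one, posPart_def]; exact h3.trans (le_max_left _ _)
    have h2 := Function.locallyFinsuppWithin.logCounting_le key hr
    rw [map_nsmul, ← logCounting_zero, Pi.smul_apply, nsmul_eq_mul] at h2
    have hlp : (0 : ℝ) < l := by exact_mod_cast Nat.pos_of_ne_zero hl0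
    rw [ENNReal.toReal_inv]
    simp only [ENat.toENNReal_coe, ENNReal.toReal_natCast]
    rw [inv_mul_eq_div, le_div_iff₀ hlp]
    linarith

theorem false_of_totally_ramified {q : ℕ} (hq : 1 ≤ q) {N τ : ℕ} (hτN : τ < N) {g G Q : ℂ → ℂ}
    {a : Fin q → ℂ} {l : Fin q → ℕ∞} (hl0 : ∀ i, l i ≠ 0)
    (hg : Meromorphic g) (hnc : ∀ b : ℂ, ∀ z, meromorphicOrderAt (fun w ↦ g w - b) z ≠ ⊤)
    (hG : Meromorphic G) (hdom : IsNevanlinnaDominated g G)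
    (hQ : Meromorphic Q) (hQs : IsNevanlinnaSmall g (proximity Q ⊤))
    (hGQ : G =ᶠ[codiscrete ℂ] g ^ N * Q)
    (hG' : ∀ z, meromorphicOrderAt (deriv G) z ≠ ⊤)
    (ha : ∀ i, a i ≠ 0) (hinj : Function.Injective a)
    (hord : ∀ z, ∀ p : ℤ, meromorphicOrderAt g z = p →
      ((N * p - τ : ℤ) : WithTop ℤ) ≤ meromorphicOrderAt G z)
    (hord0 : ∀ z, 0 ≤ meromorphicOrderAt g z → 0 ≤ meromorphicOrderAt G z)
    (hl : ∀ i z, 0 < meromorphicOrderAt (fun w ↦ G w - a i) z →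
      (l i).map (fun x : ℕ ↦ (x : ℤ)) ≤ meromorphicOrderAt (fun w ↦ G w - a i) z)
    (hsum : (N + τ : ℝ) * ∑ i, ((l i : ℝ≥0∞)⁻¹).toReal < q * (N - τ) - 2) : False := by
  have hg0 : ∀ z, meromorphicOrderAt g z ≠ ⊤ := fun z ↦ by simpa using hnc 0 z
  have hG0 : ∀ z, meromorphicOrderAt G z ≠ ⊤ := fun z hz ↦
    hG' z (meromorphicOrderAt_deriv_eq_top hz)
  have hGa : ∀ i, Meromorphic fun w ↦ G w - a i := fun i ↦ hG.sub (Meromorphic.const _)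
  set lam : Fin q → ℝ := fun i ↦ ((l i : ℝ≥0∞)⁻¹).toReal with hlam
  have hlam0 : ∀ i, 0 ≤ lam i := fun i ↦ ENNReal.toReal_nonneg
  set Λ := ∑ i, lam i with hΛ
  have hΛ0 : 0 ≤ Λ := Finset.sum_nonneg fun i _ ↦ hlam0 i
  obtain ⟨C0, hC0⟩ := exists_characteristic_eq_proximity_inv_add hg
  obtain ⟨C1, hC1⟩ := exists_characteristic_eq_proximity_inv_add hG
  obtain ⟨C2, hC2⟩ := exists_characteristic_eq_proximity_inv_add hG.deriv
  choose C3 hC3 using fun i ↦ exists_characteristic_eq_proximity_inv_add (hGa i)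
  set C4 : Fin q → ℝ := fun i ↦ Real.posLog ‖a i‖ + Real.log 2 with hC4
  obtain ⟨s1, hs1, hs1'⟩ := sum_proximity_inv_sub_le hdom hG hG' (insert 0 (Finset.univ.image a))
  have hs2 := hdom.isNevanlinnaSmall_proximity_logDeriv hG
  set c : ℝ := q * (N - τ) - 2 - (N + τ) * Λ with hc
  have hcpos : 0 < c := by linarith
  have hq1 : (1 : ℝ) ≤ q := by exact_mod_cast hq
  have hNτ : (τ : ℝ) + 1 ≤ N := by exact_mod_cast hτN
  set A : ℝ := ∑ i, (C3 i + C4 i) + N * C0 + C2 + ∑ i, lam i * (C3 i + C4 i) + (τ + 1) * C0 +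
    (q - 1) * (C1 + (N - τ) * C0)
  refine not_isNevanlinnaSmall_characteristic hg (exists_le_characteristic hg hnc) hcpos
    ((((hQs.const_mul (c := q + Λ) (by positivity)).add (hs1.add hs2)).add
      (IsNevanlinnaSmall.const A)).mono fun r hr ↦ ?_)
  set T := characteristic g ⊤ r
  set TG := characteristic G ⊤ r
  have T0 : 0 ≤ T := characteristic_nonneg hr
  have dT : T = proximity g ⊤ r + logCounting g ⊤ r := rfl
  have dTG : TG = proximity G ⊤ r + logCounting G ⊤ r := rfl
  have dT' : characteristic (deriv G) ⊤ r = proximity (deriv G) ⊤ r + logCounting (deriv G) ⊤ r :=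
    rfl
  have p0 : 0 ≤ proximity g ⊤ r := proximity_nonneg r
  have p1 : 0 ≤ proximity g⁻¹ ⊤ r := proximity_nonneg r
  have pQ : 0 ≤ proximity Q ⊤ r := proximity_nonneg r
  have n0 : 0 ≤ logCounting g ⊤ r := logCounting_nonneg hr
  have n1 : 0 ≤ logCounting g 0 r := logCounting_nonneg hr
  have f1 : ∀ i, TG ≤ proximity (fun w ↦ G w - a i)⁻¹ ⊤ r + logCounting (fun w ↦ G w - a i) 0 r +
      (C3 i + C4 i) := fun i ↦ by
    have := le_characteristic_sub_const hG (a i) hr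
    have h2 := (abs_le.1 (hC3 i r)).2
    simp only [hC4]
    linarith
  have f1' : ∀ i, logCounting (fun w ↦ G w - a i) 0 r ≤ TG + (C3 i + C4 i) := fun i ↦ by
    have := characteristic_sub_const_le hG (a i) hr
    have h2 := (abs_le.1 (hC3 i r)).1
    have h3 : 0 ≤ proximity (fun w ↦ G w - a i)⁻¹ ⊤ r := proximity_nonneg r
    simp only [hC4]
    linarith
  have f1s : q * TG ≤ ∑ i, proximity (fun w ↦ G w - a i)⁻¹ ⊤ r +
      ∑ i, logCounting (fun w ↦ G w - a i) 0 r + ∑ i, (C3 i + C4 i) := by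
    have := Finset.sum_le_sum fun i (_ : i ∈ Finset.univ) ↦ f1 i
    simpa [Finset.sum_add_distrib] using this
  have f2 := abs_le.1 (hC0 r)
  have f3 := mul_proximity_inv_le hG hQ hGQ hG0 hr
  have f4 := hs1' r hr
  rw [Finset.sum_insert (by simpa using ha), Finset.sum_image hinj.injOn] at f4
  have e4 : (fun z ↦ G z - 0)⁻¹ = G⁻¹ := by simp
  rw [e4] at f4
  have f5 := abs_le.1 (hC2 r)
  have f6 : proximity (deriv G) ⊤ r ≤ proximity (logDeriv G) ⊤ r + proximity G ⊤ r := by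
    rw [proximity_congr_codiscrete hG.deriv_eventuallyEq_logDeriv_mul (by linarith)]
    exact proximity_mul_top_le (hG.deriv.div hG) hG r
  have f7 := nevanlinna_counting_inequality hg hg0 hG hG0 hG' ha hinj hord hord0
    (fun i ↦ rfl) hr
  have f8 := Finset.sum_le_sum fun i (_ : i ∈ Finset.univ) ↦
    (logCounting_ramified_le (hl0 i) hG hG' (hl i) hr).trans
      (mul_le_mul_of_nonneg_left (f1' i) (hlam0 i))
  have f8' : ∑ i, lam i * (TG + (C3 i + C4 i)) = Λ * TG + ∑ i, lam i * (C3 i + C4 i) := by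
    rw [hΛ, Finset.sum_mul, ← Finset.sum_add_distrib]
    exact Finset.sum_congr rfl fun i _ ↦ by ring
  rw [f8'] at f8
  have f10 : (N - τ : ℝ) * logCounting g 0 r ≤ logCounting G 0 r := by
    have key : (N - τ) • (divisor g univ)⁺ ≤ (divisor G univ)⁺ := by
      intro z
      simp only [Function.locallyFinsuppWithin.coe_nsmul, Pi.smul_apply,
        Function.locallyFinsuppWithin.posPart_apply, divisor_apply hg.meromorphicOn (mem_univ z),
        divisor_apply hG.meromorphicOn (mem_univ z)]
      obtain ⟨p, hp⟩ := WithTop.ne_top_iff_exists.1 (hg0 z)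
      obtain ⟨P, hP⟩ := WithTop.ne_top_iff_exists.1 (hG0 z)
      have h1 := hord z p hp.symm
      rw [← hP, WithTop.coe_le_coe] at h1
      rw [← hp, ← hP, WithTop.untop₀_coe, WithTop.untop₀_coe, nsmul_eq_mul, Nat.cast_sub hτN.le,
        posPart_def, posPart_def]
      rcases le_or_gt p 0 with h0 | h0
      · rw [max_eq_right h0, mul_zero]
        exact le_max_right _ _
      · rw [max_eq_left h0.le]
        exact le_trans (by nlinarith [Int.natCast_nonneg τ]) (le_max_left _ _)
    have h2 := Function.locallyFinsuppWithin.logCounting_le key hr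
    rw [map_nsmul, ← logCounting_zero, ← logCounting_zero, Pi.smul_apply, nsmul_eq_mul,
      Nat.cast_sub hτN.le] at h2
    exact h2
  have f11 : logCounting G ⊤ r ≤ (N + τ : ℝ) * logCounting g ⊤ r := by
    have key : (divisor G univ)⁻ ≤ (N + τ) • (divisor g univ)⁻ := by
      intro z
      simp only [Function.locallyFinsuppWithin.coe_nsmul, Pi.smul_apply,
        Function.locallyFinsuppWithin.negPart_apply, divisor_apply hg.meromorphicOn (mem_univ z),
        divisor_apply hG.meromorphicOn (mem_univ z)]
      obtain ⟨p, hp⟩ := WithTop.ne_top_iff_exists.1 (hg0 z)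
      obtain ⟨P, hP⟩ := WithTop.ne_top_iff_exists.1 (hG0 z)
      have h1 := hord z p hp.symm
      rw [← hP, WithTop.coe_le_coe] at h1
      rw [← hp, ← hP, WithTop.untop₀_coe, WithTop.untop₀_coe, nsmul_eq_mul, Nat.cast_add,
        negPart_def, negPart_def]
      rcases le_or_gt 0 p with h0 | h0
      · have h2 := hord0 z (by rw [← hp]; exact_mod_cast h0)
        rw [← hP] at h2
        have h3 : 0 ≤ P := by exact_mod_cast h2
        rw [max_eq_right (by omega : -P ≤ 0)]
        positivity
      · rw [max_eq_left (by omega : 0 ≤ -p)]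
        refine max_le (by nlinarith [Int.natCast_nonneg τ]) ?_
        have : (0 : ℤ) ≤ -p := by omega
        positivity
    have h2 := Function.locallyFinsuppWithin.logCounting_le key hr
    rw [map_nsmul, ← logCounting_top, ← logCounting_top, Pi.smul_apply, nsmul_eq_mul,
      Nat.cast_add] at h2
    exact h2
  have f12 := abs_le.1 (hC1 r)
  have f13 := proximity_le_mul hg hQ hGQ hr
  have u1 : (N - τ : ℝ) * T ≤ TG + proximity Q ⊤ r + (C1 + (N - τ) * C0) := by
    have h1 : (N - τ : ℝ) * T ≤ (N - τ : ℝ) * (proximity g⁻¹ ⊤ r + logCounting g 0 r + C0) :=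
      mul_le_mul_of_nonneg_left (by linarith [f2.2]) (by linarith)
    have h2 : (N - τ : ℝ) * proximity g⁻¹ ⊤ r ≤ N * proximity g⁻¹ ⊤ r :=
      mul_le_mul_of_nonneg_right (by linarith [(Nat.cast_nonneg τ : (0 : ℝ) ≤ τ)]) p1
    linarith [f12.1]
  have u2 : TG ≤ (N + τ) * T + proximity Q ⊤ r := by
    have h2 : (N : ℝ) * proximity g ⊤ r ≤ (N + τ) * proximity g ⊤ r :=
      mul_le_mul_of_nonneg_right (by linarith [(Nat.cast_nonneg τ : (0 : ℝ) ≤ τ)]) p0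
    rw [dT, dTG]
    linarith
  have u3 := mul_le_mul_of_nonneg_left u1 (by linarith : (0 : ℝ) ≤ q - 1)
  have u4 := mul_le_mul_of_nonneg_left u2 hΛ0
  have u5 : (N : ℝ) * T ≤ N * (proximity g⁻¹ ⊤ r + logCounting g 0 r + C0) :=
    mul_le_mul_of_nonneg_left (by linarith [f2.2]) (by positivity)
  have u6 : (τ + 1 : ℝ) * logCounting g 0 r ≤ (τ + 1) * (T + C0) :=
    mul_le_mul_of_nonneg_left (by linarith [f2.1]) (by positivity)
  have u7 : logCounting g ⊤ r ≤ T := by linarith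
  simp only [hc, A]
  linarith [f5.1]

end

section

open ValueDistribution MeromorphicOn

/-- The differential monomial `fⁿ (f^{n₁})^{(t₁)} ⋯ (f^{n_k})^{(t_k)}`. -/
def diffMonomial {k : ℕ} (n : ℕ) (nn tt : Fin k → ℕ) (f : ℂ → ℂ) : ℂ → ℂ :=
  fun w ↦ f w ^ n * ∏ j, iteratedDeriv (tt j) (f ^ nn j) w

theorem MeromorphicAt.iteratedDeriv {h : ℂ → ℂ} {z : ℂ} (hh : MeromorphicAt h z) (t : ℕ) :
    MeromorphicAt (iteratedDeriv t h) z := by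
  induction t with
  | zero => rwa [iteratedDeriv_zero]
  | succ t ih => rw [iteratedDeriv_succ]; exact ih.deriv

theorem sub_le_meromorphicOrderAt_iteratedDeriv {h : ℂ → ℂ} {z : ℂ} (hh : MeromorphicAt h z)
    {p : ℤ} (hp : p ≤ meromorphicOrderAt h z) (t : ℕ) :
    ((p - t : ℤ) : WithTop ℤ) ≤ meromorphicOrderAt (iteratedDeriv t h) z := by
  induction t with
  | zero => simpa using hp
  | succ t ih =>
    rw [iteratedDeriv_succ, Nat.cast_add, Nat.cast_one, ← sub_sub]
    exact sub_one_le_meromorphicOrderAt_deriv (hh.iteratedDeriv t) ih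

theorem zero_le_meromorphicOrderAt_iteratedDeriv {h : ℂ → ℂ} {z : ℂ} (hh : MeromorphicAt h z)
    (hp : 0 ≤ meromorphicOrderAt h z) (t : ℕ) :
    0 ≤ meromorphicOrderAt (iteratedDeriv t h) z := by
  induction t with
  | zero => simpa using hp
  | succ t ih =>
    rw [iteratedDeriv_succ]
    exact zero_le_meromorphicOrderAt_deriv (hh.iteratedDeriv t) ih

theorem meromorphicOrderAt_iteratedDeriv_of_neg {h : ℂ → ℂ} {z : ℂ}
    {p : ℤ} (hp : meromorphicOrderAt h z = p) (hp0 : p < 0) (t : ℕ) :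
    meromorphicOrderAt (iteratedDeriv t h) z = ((p - t : ℤ) : WithTop ℤ) := by
  induction t with
  | zero => simpa using hp
  | succ t ih =>
    rw [iteratedDeriv_succ, Nat.cast_add, Nat.cast_one, ← sub_sub]
    refine meromorphicOrderAt_deriv_eq_sub_one ?_ ih
    have : p - t ≠ 0 := by omega
    exact_mod_cast this

section diffMonomial

variable {k n : ℕ} {nn tt : Fin k → ℕ} {g : ℂ → ℂ}

theorem MeromorphicAt.diffMonomial {z : ℂ} (hg : MeromorphicAt g z) :
    MeromorphicAt (diffMonomial n nn tt g) z :=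
  (hg.pow n).mul (MeromorphicAt.fun_prod fun j _ ↦ (hg.pow (nn j)).iteratedDeriv (tt j))

theorem meromorphicOrderAt_diffMonomial {z : ℂ} (hg : MeromorphicAt g z) :
    meromorphicOrderAt (diffMonomial n nn tt g) z = meromorphicOrderAt (g ^ n) z +
      ∑ j, meromorphicOrderAt (iteratedDeriv (tt j) (g ^ nn j)) z := by
  have hj : ∀ j ∈ Finset.univ, MeromorphicAt (iteratedDeriv (tt j) (g ^ nn j)) z :=
    fun j _ ↦ (hg.pow (nn j)).iteratedDeriv (tt j)
  have := meromorphicOrderAt_mul (hg.pow n) (MeromorphicAt.fun_prod hj)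
  rw [meromorphicOrderAt_fun_prod hj] at this
  exact this

theorem meromorphicOrderAt_pow_eq {z : ℂ} (hg : MeromorphicAt g z) {p : ℤ}
    (hp : meromorphicOrderAt g z = p) (m : ℕ) :
    meromorphicOrderAt (g ^ m) z = ((m * p : ℤ) : WithTop ℤ) := by
  rw [meromorphicOrderAt_pow hg, hp]
  rfl

theorem le_meromorphicOrderAt_diffMonomial {z : ℂ} (hg : MeromorphicAt g z) {p : ℤ}
    (hp : meromorphicOrderAt g z = p) :
    ((((n + ∑ j, nn j : ℕ) : ℤ) * p - ((∑ j, tt j : ℕ) : ℤ) : ℤ) : WithTop ℤ) ≤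
      meromorphicOrderAt (diffMonomial n nn tt g) z := by
  rw [meromorphicOrderAt_diffMonomial hg, meromorphicOrderAt_pow_eq hg hp]
  have h1 : ∀ j ∈ Finset.univ, ((nn j * p - tt j : ℤ) : WithTop ℤ) ≤
      meromorphicOrderAt (iteratedDeriv (tt j) (g ^ nn j)) z := fun j _ ↦
    sub_le_meromorphicOrderAt_iteratedDeriv (hg.pow _) (meromorphicOrderAt_pow_eq hg hp _).ge _
  refine le_trans (le_of_eq ?_) (add_le_add le_rfl (Finset.sum_le_sum h1))
  rw [← WithTop.coe_sum, ← WithTop.coe_add]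
  congr 1
  push_cast
  rw [Finset.sum_sub_distrib, ← Finset.sum_mul]
  ring

theorem zero_le_meromorphicOrderAt_diffMonomial {z : ℂ} (hg : MeromorphicAt g z)
    (h : 0 ≤ meromorphicOrderAt g z) : 0 ≤ meromorphicOrderAt (diffMonomial n nn tt g) z := by
  have hpow : ∀ m : ℕ, 0 ≤ meromorphicOrderAt (g ^ m) z := fun m ↦ by
    obtain ⟨c, hc⟩ := (tendsto_nhds_iff_meromorphicOrderAt_nonneg hg).2 h
    exact (tendsto_nhds_iff_meromorphicOrderAt_nonneg (hg.pow m)).1 ⟨_, hc.pow m⟩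
  rw [meromorphicOrderAt_diffMonomial hg]
  exact add_nonneg (hpow n) (Finset.sum_nonneg fun j _ ↦
    zero_le_meromorphicOrderAt_iteratedDeriv (hg.pow _) (hpow _) _)

theorem meromorphicOrderAt_diffMonomial_neg {z : ℂ} (hg : MeromorphicAt g z) (hk : 1 ≤ k)
    (hnn : ∀ j, 1 ≤ nn j) (h : meromorphicOrderAt g z < 0) :
    meromorphicOrderAt (diffMonomial n nn tt g) z < 0 := by
  obtain ⟨p, hp⟩ := WithTop.ne_top_iff_exists.1 h.ne_top
  rw [← hp] at h
  have h0 : p < 0 := by exact_mod_cast h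
  have h1 : ∀ j, nn j * p < 0 := fun j ↦ by have := hnn j; nlinarith
  rw [meromorphicOrderAt_diffMonomial hg, meromorphicOrderAt_pow_eq hg hp.symm,
    Finset.sum_congr rfl fun j _ ↦ meromorphicOrderAt_iteratedDeriv_of_neg
      (meromorphicOrderAt_pow_eq hg hp.symm (nn j)) (h1 j) (tt j), ← WithTop.coe_sum,
    ← WithTop.coe_add]
  have h2 : ∑ j, ((nn j * p - tt j : ℤ)) < 0 := by
    refine Finset.sum_neg (fun j _ ↦ by have := h1 j; omega) ⟨⟨0, hk⟩, Finset.mem_univ _⟩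
  have h3 : (n : ℤ) * p ≤ 0 := by nlinarith
  exact_mod_cast (by linarith : (n : ℤ) * p + ∑ j, ((nn j * p - tt j : ℤ)) < 0)

theorem diffMonomial_eventuallyEq (hg : Meromorphic g) (hg0 : ∀ z, meromorphicOrderAt g z ≠ ⊤) :
    diffMonomial n nn tt g =ᶠ[codiscrete ℂ]
      g ^ (n + ∑ j, nn j) * ∏ j, (iteratedDeriv (tt j) (g ^ nn j) / g ^ nn j) := by
  filter_upwards [hg.eventually_ne_zero hg0] with z hz
  simp only [diffMonomial, Pi.mul_apply, Pi.pow_apply, Finset.prod_apply, Pi.div_apply]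
  rw [Finset.prod_div_distrib, Finset.prod_pow_eq_pow_sum, pow_add]
  field_simp

theorem IsNevanlinnaDominated.diffMonomial (hg : Meromorphic g) :
    IsNevanlinnaDominated g (diffMonomial n nn tt g) := by
  have hp : ∀ m : ℕ, Meromorphic (g ^ m) := fun m z ↦ (hg z).pow m
  have h := ((IsNevanlinnaDominated.refl hg).pow hg n).mul
    (IsNevanlinnaDominated.prod Finset.univ
      (fun j _ ↦ ((IsNevanlinnaDominated.refl hg).pow hg (nn j)).iteratedDeriv (hp _) (tt j))
      fun j ↦ (hp _).iteratedDeriv _) (hp n) (Meromorphic.prod fun j _ ↦ (hp _).iteratedDeriv _)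
  convert h using 1
  ext z
  simp [_root_.diffMonomial]

theorem false_of_iteratedDeriv_pow_eq_zero (hg : Meromorphic g)
    (hnc : ∀ b : ℂ, ∀ z, meromorphicOrderAt (fun w ↦ g w - b) z ≠ ⊤) {m t : ℕ} (htm : t ≤ m)
    {z₀ : ℂ} (h : meromorphicOrderAt (iteratedDeriv t (g ^ m)) z₀ = ⊤) : False := by
  have hg0 : ∀ z, meromorphicOrderAt g z ≠ ⊤ := fun z ↦ by simpa using hnc 0 z
  have hp : ∀ m : ℕ, Meromorphic (g ^ m) := fun m z ↦ (hg z).pow m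
  induction t with
  | zero =>
    obtain ⟨p, hpp⟩ := WithTop.ne_top_iff_exists.1 (hg0 z₀)
    rw [iteratedDeriv_zero, meromorphicOrderAt_pow_eq (hg z₀) hpp.symm] at h
    exact WithTop.coe_ne_top h
  | succ t ih =>
    rw [iteratedDeriv_succ] at h
    refine false_of_deriv_eq_zero (m := m) hg hnc ((hp m).iteratedDeriv t)
      (((hp m).iteratedDeriv t).div (hp m))
      (isNevanlinnaSmall_proximity_iteratedDeriv_div ((IsNevanlinnaDominated.refl hg).pow hg m)
        (hp m) t) (by omega) ?_ ?_ h ?_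
    · filter_upwards [hg.eventually_ne_zero hg0] with z hz
      simp only [Pi.mul_apply, Pi.pow_apply, Pi.div_apply]
      field_simp
    · refine ((hp m).iteratedDeriv t).exists_meromorphicOrderAt_ne_top_iff_forall.1
        ⟨z₀, fun h' ↦ ih (by omega) h'⟩
    · intro z hz
      obtain ⟨p, hpp⟩ := WithTop.ne_top_iff_exists.1 (hg0 z)
      rw [← hpp] at hz
      have h0 : 0 < p := by exact_mod_cast hz
      refine lt_of_lt_of_le ?_ (sub_le_meromorphicOrderAt_iteratedDeriv (hp m z)
        (meromorphicOrderAt_pow_eq (hg z) hpp.symm m).ge t)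
      have h1 : (t : ℤ) + 1 ≤ m := by exact_mod_cast htm
      have : 0 < m * p - t := by nlinarith
      exact_mod_cast this

/-- Nonconstant meromorphic functions in the plane have no differential monomial with too many
totally ramified values. -/
theorem not_diffMonomial_totally_ramified {q : ℕ} (hq : 1 ≤ q) {a : Fin q → ℂ} {l : Fin q → ℕ∞}
    (hl0 : ∀ i, l i ≠ 0) (hk : 1 ≤ k) (hnn : ∀ j, 1 ≤ nn j) (hnt : ∀ j, tt j ≤ nn j)
    (hτN : ∑ j, tt j < n + ∑ j, nn j)
    (hg : Meromorphic g) (hnc : ∀ b : ℂ, ∀ z, meromorphicOrderAt (fun w ↦ g w - b) z ≠ ⊤)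
    (ha : ∀ i, a i ≠ 0) (hinj : Function.Injective a)
    (hl : ∀ i z, 0 ≤ meromorphicOrderAt g z →
      0 < meromorphicOrderAt (fun w ↦ diffMonomial n nn tt g w - a i) z →
      (l i).map (fun x : ℕ ↦ (x : ℤ)) ≤
        meromorphicOrderAt (fun w ↦ diffMonomial n nn tt g w - a i) z)
    (hsum : ((n + ∑ j, nn j : ℕ) + (∑ j, tt j : ℕ) : ℝ) * ∑ i, ((l i : ℝ≥0∞)⁻¹).toReal <
      q * ((n + ∑ j, nn j : ℕ) - (∑ j, tt j : ℕ)) - 2) : False := by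
  have hg0 : ∀ z, meromorphicOrderAt g z ≠ ⊤ := fun z ↦ by simpa using hnc 0 z
  have hp : ∀ m : ℕ, Meromorphic (g ^ m) := fun m z ↦ (hg z).pow m
  have hG : Meromorphic (diffMonomial n nn tt g) := fun z ↦ (hg z).diffMonomial
  have hQ : Meromorphic (∏ j, (iteratedDeriv (tt j) (g ^ nn j) / g ^ nn j)) :=
    Meromorphic.prod fun j _ ↦ ((hp _).iteratedDeriv _).div (hp _)
  have hQs : IsNevanlinnaSmall g
      (proximity (∏ j, (iteratedDeriv (tt j) (g ^ nn j) / g ^ nn j)) ⊤) := by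
    refine (IsNevanlinnaSmall.sum Finset.univ fun j _ ↦
      (isNevanlinnaSmall_proximity_iteratedDeriv_div
        ((IsNevanlinnaDominated.refl hg).pow hg (nn j)) (hp _) (tt j))).mono fun r _ ↦ ?_
    exact proximity_prod_top_le Finset.univ (fun j ↦ ((hp _).iteratedDeriv _).div (hp _)) r
  have hord : ∀ z, ∀ p : ℤ, meromorphicOrderAt g z = p → _ := fun z p hz ↦
    le_meromorphicOrderAt_diffMonomial (n := n) (nn := nn) (tt := tt) (hg z) hz
  by_cases hG' : ∀ z, meromorphicOrderAt (deriv (diffMonomial n nn tt g)) z ≠ ⊤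
  · refine false_of_totally_ramified hq hτN hl0 hg hnc hG (.diffMonomial hg) hQ hQs
      (diffMonomial_eventuallyEq hg hg0) hG' ha hinj hord
      (fun z hz ↦ zero_le_meromorphicOrderAt_diffMonomial (hg z) hz) (fun i z hz ↦ ?_) hsum
    refine hl i z ?_ hz
    by_contra! hneg
    have h1 := meromorphicOrderAt_diffMonomial_neg (n := n) (nn := nn) (tt := tt) (hg z) hk hnn hneg
    exact h1.not_ge ((tendsto_nhds_iff_meromorphicOrderAt_nonneg (hG z)).1
      ⟨_, tendsto_of_meromorphicOrderAt_sub_pos (hG z) hz⟩)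
  push Not at hG'
  obtain ⟨z₀, hz₀⟩ := hG'
  by_cases hG0 : ∀ z, meromorphicOrderAt (diffMonomial n nn tt g) z ≠ ⊤
  · refine false_of_deriv_eq_zero hg hnc hG hQ hQs (by omega) (diffMonomial_eventuallyEq hg hg0) hG0
      hz₀ fun z hz ↦ ?_
    obtain ⟨p, hpp⟩ := WithTop.ne_top_iff_exists.1 (hg0 z)
    rw [← hpp] at hz
    have h0 : 0 < p := by exact_mod_cast hz
    refine lt_of_lt_of_le ?_ (hord z p hpp.symm)
    have h1 : ((∑ j, tt j : ℕ) : ℤ) + 1 ≤ ((n + ∑ j, nn j : ℕ) : ℤ) := by exact_mod_cast hτN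
    have h2 : 0 ≤ ((∑ j, tt j : ℕ) : ℤ) := Int.natCast_nonneg _
    have : 0 < ((n + ∑ j, nn j : ℕ) : ℤ) * p - ((∑ j, tt j : ℕ) : ℤ) := by nlinarith
    exact_mod_cast this
  · push Not at hG0
    obtain ⟨z₁, hz₁⟩ := hG0
    by_cases hj : ∃ j, meromorphicOrderAt (iteratedDeriv (tt j) (g ^ nn j)) z₁ = ⊤
    · obtain ⟨j, hj⟩ := hj
      exact false_of_iteratedDeriv_pow_eq_zero hg hnc (hnt j) hj
    · push Not at hj
      obtain ⟨p, hpp⟩ := WithTop.ne_top_iff_exists.1 (hg0 z₁)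
      rw [meromorphicOrderAt_diffMonomial (hg z₁),
        meromorphicOrderAt_pow_eq (hg z₁) hpp.symm] at hz₁
      rw [WithTop.add_eq_top, WithTop.sum_eq_top] at hz₁
      rcases hz₁ with h | ⟨j, _, h⟩
      · exact WithTop.coe_ne_top h
      · exact hj j h

end diffMonomial

end

/-- The inversion `z ↦ 1 / z` of the Riemann sphere. -/
def sphInv (x : OnePoint ℂ) : OnePoint ℂ :=
  x.elim ((0 : ℂ) : OnePoint ℂ) fun z ↦ if z = 0 then OnePoint.infty else ((z⁻¹ : ℂ) : OnePoint ℂ)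

@[simp] theorem sphInv_infty : sphInv OnePoint.infty = ((0 : ℂ) : OnePoint ℂ) := rfl

theorem sphInv_coe (z : ℂ) : sphInv (z : OnePoint ℂ) =
    if z = 0 then OnePoint.infty else ((z⁻¹ : ℂ) : OnePoint ℂ) := rfl

@[simp] theorem sphInv_coe_zero : sphInv ((0 : ℂ) : OnePoint ℂ) = OnePoint.infty := by
  simp [sphInv_coe]

theorem sphInv_coe_of_ne {z : ℂ} (hz : z ≠ 0) :
    sphInv (z : OnePoint ℂ) = ((z⁻¹ : ℂ) : OnePoint ℂ) := by
  simp [sphInv_coe, hz]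

@[simp] theorem sphInv_sphInv (x : OnePoint ℂ) : sphInv (sphInv x) = x := by
  induction x using OnePoint.rec with
  | infty => simp
  | coe z =>
    by_cases hz : z = 0
    · subst hz; simp
    · rw [sphInv_coe_of_ne hz, sphInv_coe_of_ne (inv_ne_zero hz), inv_inv]

theorem tendsto_coe_cobounded :
    Tendsto (fun z : ℂ ↦ (z : OnePoint ℂ)) (Bornology.cobounded ℂ) (𝓝 OnePoint.infty) := by
  have := @OnePoint.tendsto_coe_infty ℂ _
  rwa [coclosedCompact_eq_cocompact, ← Metric.cobounded_eq_cocompact] at this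

theorem continuous_sphInv : Continuous sphInv := by
  rw [continuous_iff_continuousAt]
  intro x
  induction x using OnePoint.rec with
  | infty =>
    rw [OnePoint.continuousAt_infty', coclosedCompact_eq_cocompact,
      ← Metric.cobounded_eq_cocompact, sphInv_infty]
    have h1 : Tendsto (fun z : ℂ ↦ ((z⁻¹ : ℂ) : OnePoint ℂ)) (Bornology.cobounded ℂ)
        (𝓝 ((0 : ℂ) : OnePoint ℂ)) :=
      (OnePoint.continuous_coe.tendsto (0 : ℂ)).comp tendsto_inv₀_cobounded
    refine h1.congr' ?_
    filter_upwards [Bornology.eventually_ne_cobounded (0 : ℂ)] with z hz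
    exact (sphInv_coe_of_ne hz).symm
  | coe z =>
    rw [OnePoint.continuousAt_coe]
    by_cases hz : z = 0
    · subst hz
      rw [continuousAt_iff_punctured_nhds]
      have h1 : Tendsto (fun z : ℂ ↦ ((z⁻¹ : ℂ) : OnePoint ℂ)) (𝓝[≠] 0) (𝓝 OnePoint.infty) :=
        tendsto_coe_cobounded.comp tendsto_inv₀_nhdsNE_zero
      simp only [Function.comp, sphInv_coe_zero]
      refine h1.congr' ?_
      filter_upwards [self_mem_nhdsWithin] with z hz
      exact (sphInv_coe_of_ne hz).symm
    · have h1 : ContinuousAt (fun z : ℂ ↦ ((z⁻¹ : ℂ) : OnePoint ℂ)) z :=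
        OnePoint.continuous_coe.continuousAt.comp (continuousAt_inv₀ hz)
      refine h1.congr ?_
      filter_upwards [eventually_ne_nhds hz] with w hw
      exact (sphInv_coe_of_ne hw).symm

/-- On the ball `B(z, ρ)`, the sphere-valued map `s` is given by a holomorphic function bounded
by `M`. -/
def InChart (s : ℂ → OnePoint ℂ) (z : ℂ) (ρ M : ℝ) : Prop :=
  ∃ u : ℂ → ℂ, DifferentiableOn ℂ u (Metric.ball z ρ) ∧
    ∀ w ∈ Metric.ball z ρ, ‖u w‖ ≤ M ∧ s w = (u w : OnePoint ℂ)

theorem InChart.mono {s : ℂ → OnePoint ℂ} {z z' : ℂ} {ρ ρ' M M' : ℝ} (h : InChart s z ρ M)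
    (hb : Metric.ball z' ρ' ⊆ Metric.ball z ρ) (hM : M ≤ M') : InChart s z' ρ' M' := by
  obtain ⟨u, hu, h⟩ := h
  exact ⟨u, hu.mono hb, fun w hw ↦ ⟨(h w (hb hw)).1.trans hM, (h w (hb hw)).2⟩⟩

theorem InChart.sphInv {s : ℂ → OnePoint ℂ} {z : ℂ} {ρ m : ℝ} {u : ℂ → ℂ}
    (hu : DifferentiableOn ℂ u (Metric.ball z ρ)) (hm : 0 < m)
    (h : ∀ w ∈ Metric.ball z ρ, m ≤ ‖u w‖ ∧ s w = (u w : OnePoint ℂ)) :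
    InChart (sphInv ∘ s) z ρ m⁻¹ := by
  have h0 : ∀ w ∈ Metric.ball z ρ, u w ≠ 0 := fun w hw ↦
    norm_pos_iff.1 (hm.trans_le (h w hw).1)
  refine ⟨fun w ↦ (u w)⁻¹, hu.inv h0, fun w hw ↦ ⟨?_, ?_⟩⟩
  · rw [norm_inv]; exact inv_anti₀ hm (h w hw).1
  · rw [Function.comp, (h w hw).2, sphInv_coe_of_ne (h0 w hw)]

theorem sphInv_map_mul {c : ℂ} (hc : c ≠ 0) (x : OnePoint ℂ) :
    sphInv (OnePoint.map (c * ·) x) = OnePoint.map (c⁻¹ * ·) (sphInv x) := by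
  induction x using OnePoint.rec with
  | infty => simp
  | coe z =>
    by_cases hz : z = 0
    · subst hz; simp
    · rw [OnePoint.map_some, sphInv_coe_of_ne hz, sphInv_coe_of_ne (mul_ne_zero hc hz),
        OnePoint.map_some, mul_inv]

theorem InChart.rescale {s : ℂ → OnePoint ℂ} {z₁ ζ c : ℂ} {r t M : ℝ} (hr : 0 < r)
    (h : InChart s (z₁ + r * ζ) (r * t) M) :
    InChart (fun w ↦ OnePoint.map (c * ·) (s (z₁ + r * w))) ζ t (‖c‖ * M) := by
  obtain ⟨u, hu, h⟩ := h
  have hmaps : ∀ w ∈ Metric.ball ζ t, z₁ + r * w ∈ Metric.ball (z₁ + r * ζ) (r * t) := by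
    intro w hw
    rw [Metric.mem_ball, dist_eq_norm] at hw ⊢
    have : z₁ + r * w - (z₁ + r * ζ) = r * (w - ζ) := by ring
    rw [this, norm_mul, Complex.norm_of_nonneg hr.le]
    gcongr
  refine ⟨fun w ↦ c * u (z₁ + r * w), ?_, fun w hw ↦ ⟨?_, ?_⟩⟩
  · refine DifferentiableOn.const_mul (hu.comp ?_ hmaps) c
    fun_prop
  · rw [norm_mul]; gcongr; exact (h _ (hmaps w hw)).1
  · simp only [(h _ (hmaps w hw)).2, OnePoint.map_some]

/-- At scale `ρ` around `z`, the map `s` is controlled in one of the two charts, with a bound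
adapted to the scaling `f ↦ ρ ^ (-α) f(z + ρ ·)`. -/
def Tame (α : ℝ) (s : ℂ → OnePoint ℂ) (z : ℂ) (ρ : ℝ) : Prop :=
  InChart s z ρ (2 * ρ ^ α) ∨ InChart (sphInv ∘ s) z ρ (2 * ρ ^ (-α))

/-- The rescaled map `ζ ↦ r ^ (-α) s(z + r ζ)`. -/
def sphRescale (α : ℝ) (s : ℂ → OnePoint ℂ) (z : ℂ) (r : ℝ) (ζ : ℂ) : OnePoint ℂ :=
  OnePoint.map (((r ^ (-α) : ℝ) : ℂ) * ·) (s (z + r * ζ))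

theorem Tame.rescale {α : ℝ} {s : ℂ → OnePoint ℂ} {z₁ ζ : ℂ} {r t : ℝ} (hr : 0 < r) (ht : 0 ≤ t)
    (h : Tame α s (z₁ + r * ζ) (r * t)) : Tame α (sphRescale α s z₁ r) ζ t := by
  have hr' := Real.rpow_pos_of_pos hr
  have key : ∀ β : ℝ, r ^ (-β) * (2 * (r * t) ^ β) = 2 * t ^ β := by
    intro β
    rw [Real.mul_rpow hr.le ht, Real.rpow_neg hr.le]
    have := (hr' β).ne'
    field_simp
  rcases h with h | h
  · left
    have := h.rescale (c := ((r ^ (-α) : ℝ) : ℂ)) hr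
    rw [Complex.norm_of_nonneg (hr' _).le, key] at this
    exact this
  · right
    have := h.rescale (c := ((r ^ (-(-α)) : ℝ) : ℂ)) hr
    rw [Complex.norm_of_nonneg (hr' _).le, key] at this
    convert this using 1
    funext w
    simp only [Function.comp, sphRescale]
    rw [sphInv_map_mul (by exact_mod_cast (hr' _).ne'), Real.rpow_neg hr.le (-α)]
    push_cast
    rfl

theorem sphRescale_sphRescale {α : ℝ} {s : ℂ → OnePoint ℂ} {z₁ : ℂ} {r : ℝ} (hr : 0 < r) :
    sphRescale α (sphRescale α s z₁ r) (-z₁ / r) r⁻¹ = s := by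
  funext w
  have hr0 : (r : ℂ) ≠ 0 := by exact_mod_cast hr.ne'
  simp only [sphRescale]
  have h1 : z₁ + r * (-z₁ / r + (r⁻¹ : ℝ) * w) = w := by
    push_cast; field_simp; ring
  rw [h1]
  induction s w using OnePoint.rec with
  | infty => rfl
  | coe z =>
    simp only [OnePoint.map_some]
    rw [← mul_assoc, ← Complex.ofReal_mul, ← Real.mul_rpow (by positivity) hr.le,
      inv_mul_cancel₀ hr.ne', Real.one_rpow, Complex.ofReal_one, one_mul]

theorem tame_of_tame_sphRescale {α : ℝ} {s : ℂ → OnePoint ℂ} {z₁ : ℂ} {r : ℝ} (hr : 0 < r)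
    (h : Tame α (sphRescale α s z₁ r) 0 1) : Tame α s z₁ r := by
  have hr0 : (r : ℂ) ≠ 0 := by exact_mod_cast hr.ne'
  have h2 : Tame α (sphRescale α (sphRescale α s z₁ r) (-z₁ / r) r⁻¹) z₁ r := by
    refine Tame.rescale (inv_pos.2 hr) hr.le ?_
    convert h using 1
    · push_cast; field_simp; ring
    · field_simp
  rwa [sphRescale_sphRescale hr] at h2

/-- A sphere-valued map is meromorphic on `U` when near each point it is holomorphic in one of the
two standard charts. -/
def SphMero (s : ℂ → OnePoint ℂ) (U : Set ℂ) : Prop :=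
  ∀ z ∈ U, ∃ r > 0, ∃ M, InChart s z r M ∨ InChart (sphInv ∘ s) z r M

theorem toSphere_of_continuousAt {f : ℂ → ℂ} {z : ℂ} (h : ContinuousAt f z) :
    toSphere f z = (f z : OnePoint ℂ) := by
  rw [toSphere, if_neg]
  exact not_tendsto_atTop_of_tendsto_nhds (h.norm.tendsto.mono_left nhdsWithin_le_nhds)

theorem exists_inChart_of_analyticAt {s : ℂ → OnePoint ℂ} {z : ℂ} {u : ℂ → ℂ}
    (hu : AnalyticAt ℂ u z) (h : ∀ᶠ w in 𝓝 z, s w = (u w : OnePoint ℂ)) :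
    ∃ r > 0, ∃ M, InChart s z r M := by
  have h1 : ∀ᶠ w in 𝓝 z, AnalyticAt ℂ u w := hu.eventually_analyticAt
  have h2 : ∀ᶠ w in 𝓝 z, ‖u w‖ < ‖u z‖ + 1 :=
    hu.continuousAt.norm.eventually_lt continuousAt_const (by simp)
  obtain ⟨r, hr, hb⟩ := Metric.eventually_nhds_iff_ball.1 (h1.and (h2.and h))
  exact ⟨r, hr, ‖u z‖ + 1, u, fun w hw ↦ (hb w hw).1.differentiableAt.differentiableWithinAt,
    fun w hw ↦ ⟨(hb w hw).2.1.le, (hb w hw).2.2⟩⟩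

theorem MeromorphicNiceOn.sphMero {f : ℂ → ℂ} {D : Set ℂ} (hf : MeromorphicNiceOn f D) :
    SphMero (toSphere f) D := by
  intro z hz
  have hm := hf.1 z hz
  rcases hf.2 z hz with h | h
  · have ha : AnalyticAt ℂ f z := hm.analyticAt h
    obtain ⟨r, hr, M, h⟩ := exists_inChart_of_analyticAt (s := toSphere f) ha (by
      filter_upwards [ha.eventually_analyticAt] with w hw
      exact toSphere_of_continuousAt hw.continuousAt)
    exact ⟨r, hr, M, Or.inl h⟩
  · have hlim : Tendsto (fun w ↦ (f w)⁻¹) (𝓝[≠] z) (𝓝 0) :=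
      tendsto_inv₀_cobounded.comp (tendsto_norm_atTop_iff_cobounded.1 h)
    have hc : ContinuousAt (Function.update (fun w ↦ (f w)⁻¹) z 0) z :=
      continuousAt_update_same.2 hlim
    have hmm : MeromorphicAt (Function.update (fun w ↦ (f w)⁻¹) z 0) z := by
      refine hm.inv.congr ?_
      filter_upwards [self_mem_nhdsWithin] with w hw
      rw [Function.update_of_ne hw]; rfl
    have ha := hmm.analyticAt hc
    obtain ⟨r, hr, M, h⟩ := exists_inChart_of_analyticAt (s := sphInv ∘ toSphere f) ha (by
      have h1 : ∀ᶠ w in 𝓝[≠] z, AnalyticAt ℂ f w := hm.eventually_analyticAt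
      have h2 : ∀ᶠ w in 𝓝[≠] z, f w ≠ 0 := by
        filter_upwards [h.eventually_gt_atTop 0] with w hw
        exact norm_pos_iff.1 hw
      have h3 := eventually_nhdsWithin_iff.1 (h1.and h2)
      filter_upwards [h3] with w hw
      rcases eq_or_ne w z with rfl | hne
      · simp only [Function.comp, Function.update_self]
        rw [toSphere, if_pos h, sphInv_infty]
      · rw [Function.update_of_ne hne, Function.comp,
          toSphere_of_continuousAt (hw hne).1.continuousAt, sphInv_coe_of_ne (hw hne).2])
    exact ⟨r, hr, M, Or.inr h⟩

/-- The finite part of a sphere-valued map, with value `0` at poles. -/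
def finPart (s : ℂ → OnePoint ℂ) (z : ℂ) : ℂ := (s z).elim 0 id

theorem finPart_of_coe {s : ℂ → OnePoint ℂ} {z c : ℂ} (h : s z = (c : OnePoint ℂ)) :
    finPart s z = c := by rw [finPart, h]; rfl

theorem eq_sphInv_of_sphInv_eq {x y : OnePoint ℂ} (h : sphInv x = y) : x = sphInv y := by
  rw [← h, sphInv_sphInv]

theorem finPart_of_sphInv_coe {s : ℂ → OnePoint ℂ} {z c : ℂ}
    (h : sphInv (s z) = (c : OnePoint ℂ)) : finPart s z = c⁻¹ := by
  rw [finPart, eq_sphInv_of_sphInv_eq h]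
  by_cases hc : c = 0
  · subst hc; simp
  · rw [sphInv_coe_of_ne hc]; rfl

theorem SphMero.dichotomy {s : ℂ → OnePoint ℂ} {D : Set ℂ} (hs : SphMero s D)
    {z : ℂ} (hz : z ∈ D) :
    (∀ᶠ w in 𝓝 z, s w = OnePoint.infty) ∨ ((∀ᶠ w in 𝓝[≠] z, s w ≠ OnePoint.infty) ∧
      MeromorphicAt (finPart s) z ∧ (ContinuousAt (finPart s) z ∨
        Tendsto (fun w => ‖finPart s w‖) (𝓝[≠] z) atTop) ∧ toSphere (finPart s) z = s z) := by
  obtain ⟨r, hr, M, ⟨u, hu, h⟩ | ⟨u, hu, h⟩⟩ := hs z hz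
  · right
    have hb := Metric.ball_mem_nhds z hr
    have heq : finPart s =ᶠ[𝓝 z] u := by
      filter_upwards [hb] with w hw
      exact finPart_of_coe (h w hw).2
    have hu' : AnalyticAt ℂ u z := hu.analyticAt hb
    have hg : AnalyticAt ℂ (finPart s) z := hu'.congr heq.symm
    refine ⟨?_, hg.meromorphicAt, Or.inl hg.continuousAt, ?_⟩
    · filter_upwards [nhdsWithin_le_nhds hb] with w hw
      rw [(h w hw).2]; exact OnePoint.coe_ne_infty _
    · rw [toSphere_of_continuousAt hg.continuousAt, (h z (Metric.mem_ball_self hr)).2,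
        heq.eq_of_nhds]
  · have hb := Metric.ball_mem_nhds z hr
    have heq : finPart s =ᶠ[𝓝 z] fun w ↦ (u w)⁻¹ := by
      filter_upwards [hb] with w hw
      exact finPart_of_sphInv_coe (h w hw).2
    have hu' : AnalyticAt ℂ u z := hu.analyticAt hb
    rcases hu'.eventually_eq_zero_or_eventually_ne_zero with h0 | h0
    · left
      filter_upwards [hb, h0] with w hw hw0
      have := (h w hw).2
      rw [hw0] at this
      simpa using eq_sphInv_of_sphInv_eq this
    · right
      have hm : MeromorphicAt (finPart s) z := by
        refine (hu'.meromorphicAt.inv).congr ?_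
        exact (heq.symm.filter_mono nhdsWithin_le_nhds)
      have hsz := eq_sphInv_of_sphInv_eq (h z (Metric.mem_ball_self hr)).2
      refine ⟨?_, hm, ?_⟩
      · filter_upwards [nhdsWithin_le_nhds hb, h0] with w hw hw0
        rw [eq_sphInv_of_sphInv_eq (h w hw).2, sphInv_coe_of_ne hw0]
        exact OnePoint.coe_ne_infty _
      by_cases huz : u z = 0
      · have ht : Tendsto (fun w => ‖finPart s w‖) (𝓝[≠] z) atTop := by
          refine tendsto_norm_cobounded_atTop.comp ?_
          refine Tendsto.congr' (heq.symm.filter_mono nhdsWithin_le_nhds) ?_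
          refine tendsto_inv₀_nhdsNE_zero.comp (tendsto_nhdsWithin_iff.2 ⟨?_, h0⟩)
          rw [← huz]
          exact hu'.continuousAt.tendsto.mono_left nhdsWithin_le_nhds
        refine ⟨Or.inr ht, ?_⟩
        rw [toSphere, if_pos ht, hsz, huz, sphInv_coe_zero]
      · have hc : ContinuousAt (finPart s) z :=
          (hu'.continuousAt.inv₀ huz).congr heq.symm
        refine ⟨Or.inl hc, ?_⟩
        rw [toSphere_of_continuousAt hc, hsz, sphInv_coe_of_ne huz, heq.eq_of_nhds]

theorem SphMero.eq_infty_or_nice {s : ℂ → OnePoint ℂ} {D : Set ℂ} (hs : SphMero s D)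
    (hD : IsPreconnected D) :
    (∀ z ∈ D, s z = OnePoint.infty) ∨
      (MeromorphicNiceOn (finPart s) D ∧ ∀ z ∈ D, toSphere (finPart s) z = s z) := by
  set U := {z | ∀ᶠ w in 𝓝 z, s w = OnePoint.infty} with hU
  set V := {z | ∀ᶠ w in 𝓝[≠] z, s w ≠ OnePoint.infty} with hV
  have hUo : IsOpen U := isOpen_setOfPred_eventually_nhds
  have hVo : IsOpen V := by
    rw [isOpen_iff_mem_nhds]
    intro z hz
    have hz' : ∀ᶠ w in 𝓝[≠] z, s w ≠ OnePoint.infty := hz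
    have h1 := eventually_eventually_nhdsWithin.2 hz'
    filter_upwards [eventually_nhdsWithin_iff.1 h1] with w hw
    rcases eq_or_ne w z with rfl | hne
    · exact hz
    · have := hw hne
      rw [(isOpen_compl_singleton).nhdsWithin_eq hne] at this
      exact this.filter_mono nhdsWithin_le_nhds
  have hdisj : ∀ z, z ∈ U → z ∈ V → False := by
    intro z hzu hzv
    have hzu' : ∀ᶠ w in 𝓝[≠] z, s w = OnePoint.infty :=
      (show ∀ᶠ w in 𝓝 z, _ from hzu).filter_mono nhdsWithin_le_nhds
    obtain ⟨w, h1, h2⟩ := (hzu'.and hzv).exists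
    exact h2 h1
  have hcov : D ⊆ U ∪ V := fun z hz ↦ (hs.dichotomy hz).imp id fun h ↦ h.1
  rcases isPreconnected_iff_subset_of_disjoint.1 hD U V hUo hVo hcov (by
    ext z; simp only [mem_inter_iff, mem_empty_iff_false, iff_false]
    exact fun h ↦ hdisj z h.2.1 h.2.2) with h | h
  · left
    exact fun z hz ↦ (show ∀ᶠ w in 𝓝 z, _ from h hz).self_of_nhds
  · right
    have key : ∀ z ∈ D, _ := fun z hz ↦ (hs.dichotomy hz).resolve_left fun h' ↦ hdisj z h' (h hz)
    exact ⟨⟨fun z hz ↦ (key z hz).2.1, fun z hz ↦ (key z hz).2.2.1⟩, fun z hz ↦ (key z hz).2.2.2⟩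

theorem Tame.of_sphInv {α : ℝ} {s : ℂ → OnePoint ℂ} {z : ℂ} {ρ : ℝ}
    (h : Tame (-α) (sphInv ∘ s) z ρ) : Tame α s z ρ := by
  rcases h with h | h
  · exact Or.inr h
  · left
    rw [neg_neg] at h
    convert h using 1
    funext w; simp

theorem InChart.eventually_tame {α : ℝ} (hα : α < 1) {s : ℂ → OnePoint ℂ} {z : ℂ} {r M : ℝ}
    (hr : 0 < r) (h : InChart s z r M) :
    ∃ δ > 0, ∀ w ∈ Metric.ball z δ, ∀ ρ, 0 < ρ → ρ < δ → Tame α s w ρ := by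
  obtain ⟨u, hu, h⟩ := h
  have hua : AnalyticAt ℂ u z := hu.analyticAt (Metric.ball_mem_nhds z hr)
  obtain ⟨L, t, ht, hL⟩ := (hua.contDiffAt (n := 1)).exists_lipschitzOnWith
  obtain ⟨δ₁, hδ₁, hb⟩ := Metric.mem_nhds_iff.1 (inter_mem ht (Metric.ball_mem_nhds z hr))
  have hlim : Tendsto (fun ρ : ℝ ↦ (L : ℝ) * ρ ^ (1 - α)) (𝓝 0) (𝓝 0) := by
    have : ContinuousAt (fun ρ : ℝ ↦ (L : ℝ) * ρ ^ (1 - α)) 0 :=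
      continuousAt_const.mul (Real.continuousAt_rpow_const 0 (1 - α) (Or.inr (by linarith)))
    simpa [ContinuousAt, Real.zero_rpow (show 1 - α ≠ 0 by linarith)] using this
  obtain ⟨δ₂, hδ₂, hsm⟩ := Metric.eventually_nhds_iff.1 (hlim.eventually_le_const
    (show (0 : ℝ) < 1 / 2 by norm_num))
  refine ⟨min (δ₁ / 2) δ₂, by positivity, fun w hw ρ hρ hρδ ↦ ?_⟩
  have hsub : Metric.ball w ρ ⊆ Metric.ball z δ₁ := by
    refine Metric.ball_subset_ball' ?_
    have h1 := (Metric.mem_ball.1 hw).trans_le (min_le_left _ _)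
    have h2 := hρδ.trans_le (min_le_left _ _)
    linarith
  have hLρ : (L : ℝ) * ρ ≤ ρ ^ α / 2 := by
    have h1 : (L : ℝ) * ρ ^ (1 - α) ≤ 1 / 2 := hsm (by
      rw [Real.dist_0_eq_abs, abs_of_pos hρ]; exact hρδ.trans_le (min_le_right _ _))
    have h2 : ρ = ρ ^ (1 - α) * ρ ^ α := by
      rw [← Real.rpow_add hρ]; simp
    have h3 := Real.rpow_pos_of_pos hρ α
    calc (L : ℝ) * ρ = (L * ρ ^ (1 - α)) * ρ ^ α := by rw [mul_assoc, ← h2]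
      _ ≤ 1 / 2 * ρ ^ α := by gcongr
      _ = _ := by ring
  have hdist : ∀ w' ∈ Metric.ball w ρ, ‖u w' - u w‖ ≤ ρ ^ α / 2 := by
    intro w' hw'
    have := hL.dist_le_mul w' (hb (hsub hw')).1 w (hb (hsub (Metric.mem_ball_self hρ))).1
    rw [← dist_eq_norm]
    refine this.trans (le_trans ?_ hLρ)
    have := (Metric.mem_ball.1 hw').le
    gcongr
  have hd : DifferentiableOn ℂ u (Metric.ball w ρ) :=
    hu.mono fun w' hw' ↦ (hb (hsub hw')).2
  have hs : ∀ w' ∈ Metric.ball w ρ, s w' = (u w' : OnePoint ℂ) :=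
    fun w' hw' ↦ (h w' (hb (hsub hw')).2).2
  have hpos := Real.rpow_pos_of_pos hρ α
  rcases le_total ‖u w‖ (ρ ^ α) with hle | hle
  · refine Or.inl ⟨u, hd, fun w' hw' ↦ ⟨?_, hs w' hw'⟩⟩
    have h1 := norm_add_le (u w) (u w' - u w)
    rw [add_sub_cancel] at h1
    linarith [hdist w' hw']
  · right
    have := InChart.sphInv (s := s) hd (half_pos hpos) fun w' hw' ↦ ⟨?_, hs w' hw'⟩
    · rwa [inv_div, div_eq_mul_inv, ← Real.rpow_neg hρ.le] at this
    · have h1 := norm_sub_norm_le (u w) (u w')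
      rw [norm_sub_rev] at h1
      linarith [hdist w' hw']

theorem SphMero.eventually_tame {α : ℝ} (hα : |α| < 1) {s : ℂ → OnePoint ℂ} {D : Set ℂ}
    (hs : SphMero s D) {z : ℂ} (hz : z ∈ D) :
    ∃ δ > 0, ∀ w ∈ Metric.ball z δ, ∀ ρ, 0 < ρ → ρ < δ → Tame α s w ρ := by
  obtain ⟨r, hr, M, h | h⟩ := hs z hz
  · exact h.eventually_tame (abs_lt.1 hα).2 hr
  · obtain ⟨δ, hδ, h⟩ := h.eventually_tame (α := -α) (by linarith [(abs_lt.1 hα).1]) hr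
    exact ⟨δ, hδ, fun w hw ρ h1 h2 ↦ (h w hw ρ h1 h2).of_sphInv⟩

theorem SphMero.tame_of_isCompact {α : ℝ} (hα : |α| < 1) {s : ℂ → OnePoint ℂ} {D K : Set ℂ}
    (hs : SphMero s D) (hK : IsCompact K) (hKD : K ⊆ D) :
    ∃ δ > 0, ∀ w ∈ K, ∀ ρ, 0 < ρ → ρ < δ → Tame α s w ρ := by
  refine hK.induction_on (p := fun t ↦ ∃ δ > 0, ∀ w ∈ t, ∀ ρ, 0 < ρ → ρ < δ → Tame α s w ρ)
    ⟨1, one_pos, by simp⟩ ?_ ?_ ?_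
  · rintro t t' htt ⟨δ, hδ, h⟩
    exact ⟨δ, hδ, fun w hw ↦ h w (htt hw)⟩
  · rintro t t' ⟨δ, hδ, h⟩ ⟨δ', hδ', h'⟩
    refine ⟨min δ δ', lt_min hδ hδ', fun w hw ρ h1 h2 ↦ ?_⟩
    rcases hw with hw | hw
    · exact h w hw ρ h1 (h2.trans_le (min_le_left _ _))
    · exact h' w hw ρ h1 (h2.trans_le (min_le_right _ _))
  · intro z hz
    obtain ⟨δ, hδ, h⟩ := hs.eventually_tame hα (hKD hz)
    exact ⟨_, mem_nhdsWithin_of_mem_nhds (Metric.ball_mem_nhds z hδ), δ, hδ, h⟩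

/-- **Zalcman's lemma**, in terms of the scale at which the maps are controlled. -/
theorem exists_zalcman {α : ℝ} (hα : |α| < 1) {𝓢 : Set (ℂ → OnePoint ℂ)} {D : Set ℂ}
    (hD : IsOpen D) (h𝓢 : ∀ s ∈ 𝓢, SphMero s D) {z₀ : ℂ} (hz₀ : z₀ ∈ D)
    (hbad : ∀ δ > 0, ∃ s ∈ 𝓢, ∃ w ∈ Metric.ball z₀ δ, ∃ ρ, 0 < ρ ∧ ρ < δ ∧ ¬ Tame α s w ρ)
    {ε : ℝ} (hε : 0 < ε) :
    ∃ s ∈ 𝓢, ∃ z₁ ρ₁, 0 < ρ₁ ∧ ρ₁ < ε ∧ ¬ Tame α s z₁ ρ₁ ∧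
      ∀ w, dist w z₁ < ρ₁ / ε → w ∈ D ∧ ∀ ρ, 0 < ρ → ρ < ρ₁ / 4 → Tame α s w ρ := by
  obtain ⟨R₀, hR₀, hR₀D⟩ := Metric.nhds_basis_closedBall.mem_iff.1 (hD.mem_nhds hz₀)
  set R := min R₀ 1 with hR
  have hRpos : 0 < R := lt_min hR₀ one_pos
  have hR1 : R ≤ 1 := min_le_right _ _
  have hRD : Metric.closedBall z₀ R ⊆ D :=
    (Metric.closedBall_subset_closedBall (min_le_left _ _)).trans hR₀D
  set η := ε / 4 with hη
  have hηpos : 0 < η := by positivity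
  obtain ⟨s, hs, w, hw, ρ, hρ, hρδ, hbad⟩ := hbad (min (R / 2) (η * (R / 2))) (by positivity)
  obtain ⟨δ, hδ, htame⟩ := (h𝓢 s hs).tame_of_isCompact hα (isCompact_closedBall z₀ R) hRD
  set A : Set ℝ := {q | ∃ w ρ, dist w z₀ < R ∧ 0 < ρ ∧ ¬ Tame α s w ρ ∧ q = ρ / (R - dist w z₀)}
    with hA
  have hAlb : ∀ q ∈ A, δ / R ≤ q := by
    rintro q ⟨w, ρ, hw, hρ, hb, rfl⟩
    have h1 : δ ≤ ρ := by
      by_contra! hlt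
      exact hb (htame w (Metric.mem_closedBall.2 hw.le) ρ hρ hlt)
    have h2 : 0 < R - dist w z₀ := by linarith
    have h3 : R - dist w z₀ ≤ R := by linarith [dist_nonneg (x := w) (y := z₀)]
    exact div_le_div₀ hρ.le h1 h2 h3
  have hAbdd : BddBelow A := ⟨δ / R, hAlb⟩
  have hwd : dist w z₀ < R / 2 := (Metric.mem_ball.1 hw).trans_le (min_le_left _ _)
  have hwA : ρ / (R - dist w z₀) ∈ A := ⟨w, ρ, by linarith, hρ, hbad, rfl⟩
  have hmpos : 0 < sInf A := (div_pos hδ hRpos).trans_le (le_csInf ⟨_, hwA⟩ hAlb)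
  have hmη : sInf A ≤ η := by
    refine (csInf_le hAbdd hwA).trans ?_
    rw [div_le_iff₀ (by linarith)]
    have h1 : ρ < η * (R / 2) := hρδ.trans_le (min_le_right _ _)
    nlinarith
  obtain ⟨q, ⟨z₁, ρ₁, hz₁, hρ₁, hb₁, rfl⟩, hq⟩ :=
    exists_lt_of_csInf_lt ⟨_, hwA⟩ (show sInf A < 2 * sInf A by linarith)
  have hd₁ : 0 < R - dist z₁ z₀ := by linarith
  rw [div_lt_iff₀ hd₁] at hq
  have hd₁' : R - dist z₁ z₀ ≤ 1 := by linarith [dist_nonneg (x := z₁) (y := z₀)]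
  have hρd : ρ₁ < ε / 2 * (R - dist z₁ z₀) := hq.trans_le (by gcongr; linarith)
  refine ⟨s, hs, z₁, ρ₁, hρ₁, ?_, hb₁, fun w hw ↦ ?_⟩
  · nlinarith
  · have h1 : dist w z₁ < (R - dist z₁ z₀) / 2 := by
      refine hw.trans ?_
      rw [div_lt_iff₀ hε]; linarith
    have h2 : (R - dist z₁ z₀) / 2 < R - dist w z₀ := by
      linarith [dist_triangle w z₁ z₀]
    have h3 : 0 < R - dist w z₀ := by linarith
    refine ⟨hRD (Metric.mem_closedBall.2 (by linarith)), fun ρ hρ hρ4 ↦ ?_⟩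
    by_contra hb
    have h4 := csInf_le hAbdd (show ρ / (R - dist w z₀) ∈ A from ⟨w, ρ, by linarith, hρ, hb, rfl⟩)
    rw [le_div_iff₀ h3] at h4
    nlinarith

theorem inChart_iff {s : ℂ → OnePoint ℂ} {z : ℂ} {ρ M : ℝ} : InChart s z ρ M ↔
    DifferentiableOn ℂ (finPart s) (Metric.ball z ρ) ∧
      ∀ w ∈ Metric.ball z ρ, ‖finPart s w‖ ≤ M ∧ s w = (finPart s w : OnePoint ℂ) := by
  refine ⟨fun ⟨u, hu, h⟩ ↦ ?_, fun h ↦ ⟨_, h⟩⟩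
  have heq : ∀ w ∈ Metric.ball z ρ, finPart s w = u w := fun w hw ↦ finPart_of_coe (h w hw).2
  refine ⟨hu.congr heq, fun w hw ↦ ?_⟩
  rw [heq w hw]
  exact h w hw

/-- The pointwise limit of sphere-valued maps along an ultrafilter. -/
def ultraLim {ι : Type*} (𝒰 : Ultrafilter ι) (S : ι → ℂ → OnePoint ℂ) (z : ℂ) : OnePoint ℂ :=
  (𝒰.map fun j ↦ S j z).lim

section

variable {ι : Type*} {𝒰 : Ultrafilter ι} {S : ι → ℂ → OnePoint ℂ}

theorem tendsto_ultraLim (z : ℂ) :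
    Tendsto (fun j ↦ S j z) 𝒰 (𝓝 (ultraLim 𝒰 S z)) :=
  (𝒰.map fun j ↦ S j z).le_nhds_lim

theorem ultraLim_eq {z : ℂ} {x : OnePoint ℂ} (h : Tendsto (fun j ↦ S j z) 𝒰 (𝓝 x)) :
    ultraLim 𝒰 S z = x :=
  tendsto_nhds_unique (tendsto_ultraLim z) h

theorem ultraLim_sphInv : ultraLim 𝒰 (fun j ↦ sphInv ∘ S j) = sphInv ∘ ultraLim 𝒰 S := by
  funext z
  exact ultraLim_eq ((continuous_sphInv.tendsto _).comp (tendsto_ultraLim z))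

theorem tendsto_finPart {z w : ℂ} {r M : ℝ} (h : ∀ᶠ j in 𝒰, InChart (S j) z r M)
    (hw : w ∈ Metric.ball z r) :
    Tendsto (fun j ↦ finPart (S j) w) 𝒰 (𝓝 (finPart (ultraLim 𝒰 S) w)) ∧
      ‖finPart (ultraLim 𝒰 S) w‖ ≤ M ∧
      ultraLim 𝒰 S w = (finPart (ultraLim 𝒰 S) w : OnePoint ℂ) := by
  have hb : ∀ᶠ j in 𝒰, finPart (S j) w ∈ Metric.closedBall (0 : ℂ) M := by
    filter_upwards [h] with j hj
    rw [mem_closedBall_zero_iff]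
    exact ((inChart_iff.1 hj).2 w hw).1
  obtain ⟨c, hc, hlim⟩ := (isCompact_closedBall (0 : ℂ) M).ultrafilter_le_nhds
    (𝒰.map fun j ↦ finPart (S j) w) (le_principal_iff.2 hb)
  have hlim' : Tendsto (fun j ↦ finPart (S j) w) 𝒰 (𝓝 c) := hlim
  have hS : ultraLim 𝒰 S w = (c : OnePoint ℂ) := by
    refine ultraLim_eq (((OnePoint.continuous_coe.tendsto c).comp hlim').congr' ?_)
    filter_upwards [h] with j hj
    exact ((inChart_iff.1 hj).2 w hw).2.symm
  rw [finPart_of_coe hS]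
  exact ⟨hlim', mem_closedBall_zero_iff.1 hc, hS⟩

/-- **Montel's theorem** along an ultrafilter. -/
theorem tendstoLocallyUniformlyOn_finPart {z : ℂ} {r M : ℝ}
    (h : ∀ᶠ j in 𝒰, InChart (S j) z r M) :
    TendstoLocallyUniformlyOn (fun j ↦ finPart (S j)) (finPart (ultraLim 𝒰 S)) 𝒰
      (Metric.ball z r) := by
  rw [Metric.tendstoLocallyUniformlyOn_iff]
  intro ε hε w₀ hw₀
  set R := r - dist w₀ z with hR
  have hRpos : 0 < R := sub_pos.2 hw₀
  have hM : 0 ≤ M := (norm_nonneg _).trans (tendsto_finPart h hw₀).2.1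
  have hsub : Metric.ball w₀ R ⊆ Metric.ball z r := Metric.ball_subset_ball' (by linarith)
  set δ := min R (ε * R / (4 * (2 * M + 1))) with hδ
  have hδpos : 0 < δ := by positivity
  have hlip : ∀ j, InChart (S j) z r M → ∀ w ∈ Metric.ball w₀ δ,
      dist (finPart (S j) w) (finPart (S j) w₀) ≤ ε / 4 := by
    intro j hj w hw
    obtain ⟨hd, hb⟩ := inChart_iff.1 hj
    have hm : MapsTo (finPart (S j)) (Metric.ball w₀ R)
        (Metric.closedBall (finPart (S j) w₀) (2 * M + 1)) := by
      intro w' hw'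
      rw [Metric.mem_closedBall, dist_eq_norm]
      refine (norm_sub_le _ _).trans ?_
      linarith [(hb w' (hsub hw')).1, (hb w₀ hw₀).1]
    have hwδ := Metric.mem_ball.1 hw
    refine (Complex.dist_le_div_mul_dist_of_mapsTo_ball (hd.mono hsub) hm
      (Metric.mem_ball.2 (hwδ.trans_le (min_le_left _ _)))).trans ?_
    calc (2 * M + 1) / R * dist w w₀ ≤ (2 * M + 1) / R * (ε * R / (4 * (2 * M + 1))) := by
          have := (hwδ.trans_le (min_le_right _ _)).le
          gcongr
      _ = ε / 4 := by field_simp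
  refine ⟨Metric.ball w₀ δ, mem_nhdsWithin_of_mem_nhds (Metric.ball_mem_nhds _ hδpos), ?_⟩
  have hlim₀ := (tendsto_finPart h hw₀).1
  filter_upwards [h, Metric.tendsto_nhds.1 hlim₀ (ε / 4) (by positivity)] with j hj hj₀ w hw
  have h1 : dist (finPart (ultraLim 𝒰 S) w) (finPart (ultraLim 𝒰 S) w₀) ≤ ε / 4 := by
    have hw' : w ∈ Metric.ball z r :=
      hsub (Metric.ball_subset_ball (min_le_left _ _) hw)
    refine le_of_tendsto ((tendsto_finPart h hw').1.dist hlim₀) ?_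
    filter_upwards [h] with i hi
    exact hlip i hi w hw
  have h2 := hlip j hj w hw
  have h3 := dist_triangle4 (finPart (ultraLim 𝒰 S) w) (finPart (ultraLim 𝒰 S) w₀)
    (finPart (S j) w₀) (finPart (S j) w)
  rw [dist_comm _ (finPart (S j) w₀), dist_comm (finPart (S j) w₀) (finPart (S j) w)] at h3
  linarith

theorem inChart_ultraLim {z : ℂ} {r M : ℝ} (h : ∀ᶠ j in 𝒰, InChart (S j) z r M) :
    InChart (ultraLim 𝒰 S) z r M := by
  refine inChart_iff.2 ⟨?_, fun w hw ↦ (tendsto_finPart h hw).2⟩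
  refine (tendstoLocallyUniformlyOn_finPart h).differentiableOn ?_ Metric.isOpen_ball
  filter_upwards [h] with j hj
  exact (inChart_iff.1 hj).1

theorem sphMero_ultraLim {U : Set ℂ} (h : ∀ z ∈ U, ∃ r > 0, ∃ M, ∀ᶠ j in 𝒰,
    InChart (S j) z r M ∨ InChart (sphInv ∘ S j) z r M) : SphMero (ultraLim 𝒰 S) U := by
  intro z hz
  obtain ⟨r, hr, M, h⟩ := h z hz
  refine ⟨r, hr, M, (Ultrafilter.eventually_or.1 h).imp inChart_ultraLim fun h ↦ ?_⟩
  rw [← ultraLim_sphInv]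
  exact inChart_ultraLim h

theorem exists_inChart_of_ultraLim_ne_infty {z : ℂ} {r M : ℝ} (hr : 0 < r)
    (h : ∀ᶠ j in 𝒰, InChart (S j) z r M ∨ InChart (sphInv ∘ S j) z r M)
    (hz : ultraLim 𝒰 S z ≠ OnePoint.infty) :
    ∃ r' > 0, ∃ M', ∀ᶠ j in 𝒰, InChart (S j) z r' M' := by
  rcases Ultrafilter.eventually_or.1 h with h | h
  · exact ⟨r, hr, M, h⟩
  set v := finPart (ultraLim 𝒰 fun j ↦ sphInv ∘ S j) with hv
  have hzr : z ∈ Metric.ball z r := Metric.mem_ball_self hr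
  obtain ⟨-, -, hvz⟩ := tendsto_finPart h hzr
  have hv0 : v z ≠ 0 := by
    intro h0
    rw [ultraLim_sphInv, Function.comp, ← ultraLim_sphInv, ← hv, h0] at hvz
    exact hz (by simpa using eq_sphInv_of_sphInv_eq hvz)
  have hloc := tendstoLocallyUniformlyOn_finPart h
  have hcont : ContinuousAt v z := ((inChart_iff.1 (inChart_ultraLim h)).1.differentiableAt
    (Metric.ball_mem_nhds z hr)).continuousAt
  have hm : 0 < ‖v z‖ / 4 := div_pos (norm_pos_iff.2 hv0) (by norm_num)
  obtain ⟨t, ht, hunif⟩ := Metric.tendstoLocallyUniformlyOn_iff.1 hloc _ hm z hzr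
  rw [Metric.isOpen_ball.nhdsWithin_eq hzr] at ht
  have h2 : ∀ᶠ w in 𝓝 z, dist (v w) (v z) < ‖v z‖ / 4 := Metric.tendsto_nhds.1 hcont _ hm
  obtain ⟨r', hr', hb⟩ := Metric.eventually_nhds_iff_ball.1
    (((show ∀ᶠ w in 𝓝 z, w ∈ t from ht).and h2).and (Metric.ball_mem_nhds z hr))
  refine ⟨r', hr', (‖v z‖ / 4)⁻¹, ?_⟩
  filter_upwards [h, hunif] with j hj hju
  obtain ⟨hd, hjb⟩ := inChart_iff.1 hj
  have := InChart.sphInv (s := sphInv ∘ S j) (hd.mono fun w hw ↦ (hb w hw).2) hm fun w hw ↦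
    ⟨?_, (hjb w (hb w hw).2).2⟩
  · convert this using 1
    funext w; simp
  · have h3 := hju w (hb w hw).1.1
    have h4 := (hb w hw).1.2
    have h5 := dist_triangle (v z) (v w) (finPart (sphInv ∘ S j) w)
    have h6 := norm_sub_norm_le (v z) (finPart (sphInv ∘ S j) w)
    rw [dist_comm (v z) (v w), dist_eq_norm (v z)] at h5
    linarith

end

theorem sphDist_coe_coe (z w : ℂ) : sphDist (z : OnePoint ℂ) (w : OnePoint ℂ) =
    ‖z - w‖ / (Real.sqrt (1 + ‖z‖ ^ 2) * Real.sqrt (1 + ‖w‖ ^ 2)) := rfl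

theorem sphDist_infty_coe (w : ℂ) : sphDist OnePoint.infty (w : OnePoint ℂ) =
    1 / Real.sqrt (1 + ‖w‖ ^ 2) := rfl

theorem sphDist_coe_infty (w : ℂ) : sphDist (w : OnePoint ℂ) OnePoint.infty =
    1 / Real.sqrt (1 + ‖w‖ ^ 2) := rfl

theorem sphDist_coe_coe_le (z w : ℂ) : sphDist (z : OnePoint ℂ) (w : OnePoint ℂ) ≤ dist z w := by
  rw [sphDist_coe_coe, dist_eq_norm]
  refine div_le_self (norm_nonneg _) ?_
  have h (x : ℂ) : 1 ≤ Real.sqrt (1 + ‖x‖ ^ 2) := Real.one_le_sqrt.2 (by nlinarith [norm_nonneg x])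
  nlinarith [h z, h w]

theorem sphDist_sphInv (x y : OnePoint ℂ) : sphDist (sphInv x) (sphInv y) = sphDist x y := by
  have hs {z : ℂ} (hz : z ≠ 0) : Real.sqrt (1 + ‖z⁻¹‖ ^ 2) = Real.sqrt (1 + ‖z‖ ^ 2) / ‖z‖ := by
    have h0 : 0 < ‖z‖ := norm_pos_iff.2 hz
    have : 1 + ‖z⁻¹‖ ^ 2 = (1 + ‖z‖ ^ 2) / ‖z‖ ^ 2 := by
      rw [norm_inv]; field_simp; ring
    rw [this, Real.sqrt_div (by positivity), Real.sqrt_sq h0.le]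
  induction x using OnePoint.rec with
  | infty =>
    induction y using OnePoint.rec with
    | infty => simp [sphDist_coe_coe]; rfl
    | coe w =>
      by_cases hw : w = 0
      · subst hw; rw [sphInv_infty, sphInv_coe_zero]; rfl
      · have h0 : 0 < ‖w‖ := norm_pos_iff.2 hw
        rw [sphInv_infty, sphInv_coe_of_ne hw, sphDist_coe_coe, sphDist_infty_coe, hs hw]
        simp only [zero_sub, norm_neg, norm_inv, norm_zero]
        field_simp
        simp
  | coe z =>
    by_cases hz : z = 0
    · subst hz
      rw [sphInv_coe_zero]
      induction y using OnePoint.rec with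
      | infty => rw [sphInv_infty]; rfl
      | coe w =>
        by_cases hw : w = 0
        · subst hw; rw [sphInv_coe_zero, sphDist_coe_coe]; simp; rfl
        · have h0 : 0 < ‖w‖ := norm_pos_iff.2 hw
          rw [sphInv_coe_of_ne hw, sphDist_coe_coe, sphDist_infty_coe, hs hw]
          simp
    · have h0 : 0 < ‖z‖ := norm_pos_iff.2 hz
      rw [sphInv_coe_of_ne hz]
      induction y using OnePoint.rec with
      | infty =>
        rw [sphInv_infty, sphDist_coe_coe, sphDist_coe_infty, hs hz]
        simp only [sub_zero, norm_inv, norm_zero]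
        field_simp
        simp
      | coe w =>
        by_cases hw : w = 0
        · subst hw; rw [sphInv_coe_zero, sphDist_coe_coe, sphDist_coe_infty, hs hz]; simp
        · have h0' : 0 < ‖w‖ := norm_pos_iff.2 hw
          rw [sphInv_coe_of_ne hw, sphDist_coe_coe, sphDist_coe_coe, hs hz, hs hw,
            inv_sub_inv hz hw, norm_div, norm_mul, norm_sub_rev]
          field_simp

theorem eventually_sphDist_ultraLim_lt {ι : Type*} {𝒰 : Ultrafilter ι} {S : ι → ℂ → OnePoint ℂ}
    {K : Set ℂ} (hK : IsCompact K) (h : ∀ z ∈ K, ∃ r > 0, ∃ M, ∀ᶠ j in 𝒰,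
      InChart (S j) z r M ∨ InChart (sphInv ∘ S j) z r M) {ε : ℝ} (hε : 0 < ε) :
    ∀ᶠ j in 𝒰, ∀ z ∈ K, sphDist (S j z) (ultraLim 𝒰 S z) < ε := by
  have key : ∀ (S : ι → ℂ → OnePoint ℂ) (z : ℂ) (r M : ℝ), 0 < r →
      (∀ᶠ j in 𝒰, InChart (S j) z r M) → ∃ t ∈ 𝓝 z, ∀ᶠ j in 𝒰, ∀ w ∈ t,
        sphDist (S j w) (ultraLim 𝒰 S w) < ε := by
    intro S z r M hr h
    have hzr : z ∈ Metric.ball z r := Metric.mem_ball_self hr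
    obtain ⟨t, ht, hunif⟩ := Metric.tendstoLocallyUniformlyOn_iff.1
      (tendstoLocallyUniformlyOn_finPart h) ε hε z hzr
    rw [Metric.isOpen_ball.nhdsWithin_eq hzr] at ht
    refine ⟨t ∩ Metric.ball z r, inter_mem ht (Metric.ball_mem_nhds z hr), ?_⟩
    filter_upwards [h, hunif] with j hj hju w hw
    rw [((inChart_iff.1 hj).2 w hw.2).2, (tendsto_finPart h hw.2).2.2]
    refine (sphDist_coe_coe_le _ _).trans_lt ?_
    rw [dist_comm]
    exact hju w hw.1
  refine hK.induction_on
    (p := fun t ↦ ∀ᶠ j in 𝒰, ∀ z ∈ t, sphDist (S j z) (ultraLim 𝒰 S z) < ε) (by simp) ?_ ?_ ?_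
  · intro t t' htt h
    filter_upwards [h] with j hj z hz using hj z (htt hz)
  · intro t t' h h'
    filter_upwards [h, h'] with j hj hj' z hz using hz.elim (hj z) (hj' z)
  · intro z hz
    obtain ⟨r, hr, M, h⟩ := h z hz
    rcases Ultrafilter.eventually_or.1 h with h | h
    · obtain ⟨t, ht, h⟩ := key S z r M hr h
      exact ⟨t, mem_nhdsWithin_of_mem_nhds ht, h⟩
    · obtain ⟨t, ht, h⟩ := key _ z r M hr h
      refine ⟨t, mem_nhdsWithin_of_mem_nhds ht, ?_⟩
      filter_upwards [h] with j hj w hw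
      have := hj w hw
      rwa [ultraLim_sphInv, Function.comp, Function.comp, sphDist_sphInv] at this

theorem exists_compact_exhaustion {D : Set ℂ} (hD : IsOpen D) :
    ∃ K : ℕ → Set ℂ, Monotone K ∧ (∀ n, IsCompact (K n) ∧ K n ⊆ D) ∧
      ∀ C ⊆ D, IsCompact C → ∃ n, C ⊆ K n := by
  have : LocallyCompactSpace D := hD.locallyCompactSpace
  let E : CompactExhaustion D := CompactExhaustion.choice D
  refine ⟨fun n ↦ (Subtype.val : D → ℂ) '' E n, ?_, fun n ↦
    ⟨(E.isCompact n).image continuous_subtype_val, by simp⟩, fun C hC hCc ↦ ?_⟩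
  · exact monotone_nat_of_le_succ fun n ↦ image_mono (E.subset_succ n)
  · have : IsCompact ((Subtype.val : D → ℂ) ⁻¹' C) := by
      rw [Subtype.isCompact_iff, Subtype.image_preimage_coe, inter_eq_right.2 hC]
      exact hCc
    obtain ⟨n, hn⟩ := E.exists_superset_of_isCompact this
    exact ⟨n, fun z hz ↦ ⟨⟨z, hC hz⟩, hn hz, rfl⟩⟩

theorem Tame.exists_inChart {ι : Type*} {l : Filter ι} {α : ℝ} {S : ι → ℂ → OnePoint ℂ} {z : ℂ}
    {ρ : ℝ} (hρ : 0 < ρ) (h : ∀ᶠ j in l, Tame α (S j) z ρ) :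
    ∃ r > 0, ∃ M, ∀ᶠ j in l, InChart (S j) z r M ∨ InChart (sphInv ∘ S j) z r M := by
  refine ⟨ρ, hρ, max (2 * ρ ^ α) (2 * ρ ^ (-α)), ?_⟩
  filter_upwards [h] with j hj
  exact hj.imp (fun h ↦ h.mono subset_rfl (le_max_left _ _))
    fun h ↦ h.mono subset_rfl (le_max_right _ _)

theorem normalFamilyOn_of_tame {α : ℝ} {𝓕 : Set (ℂ → ℂ)} {D : Set ℂ} (hD : IsOpen D)
    (hconn : IsPreconnected D)
    (htame : ∀ z ∈ D, ∃ δ > 0, ∀ f ∈ 𝓕, ∀ w ∈ Metric.ball z δ, ∀ ρ, 0 < ρ → ρ < δ →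
      Tame α (toSphere f) w ρ) : NormalFamilyOn 𝓕 D := by
  intro f hf
  set S : ℕ → ℂ → OnePoint ℂ := fun j ↦ toSphere (f j) with hS
  have hch : ∀ z ∈ D, ∃ r > 0, ∃ M, ∀ᶠ j in (hyperfilter ℕ : Filter ℕ),
      InChart (S j) z r M ∨ InChart (sphInv ∘ S j) z r M := by
    intro z hz
    obtain ⟨δ, hδ, h⟩ := htame z hz
    exact Tame.exists_inChart (half_pos hδ) (Eventually.of_forall fun j ↦
      h (f j) (hf j) z (Metric.mem_ball_self hδ) (δ / 2) (half_pos hδ) (half_lt_self hδ))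
  obtain ⟨K, hKm, hK, hKex⟩ := exists_compact_exhaustion hD
  set L := ultraLim (hyperfilter ℕ) S with hL
  obtain ⟨φ, hφ, hφK⟩ := extraction_forall_of_frequently
    (P := fun n j ↦ ∀ z ∈ K n, sphDist (S j z) (L z) < 1 / ((n : ℝ) + 1)) fun n ↦ by
      have := eventually_sphDist_ultraLim_lt (hK n).1 (fun z hz ↦ hch z ((hK n).2 hz))
        (ε := 1 / ((n : ℝ) + 1)) (by positivity)
      exact this.frequently.filter_mono Nat.hyperfilter_le_atTop
  have hconv : ∀ C ⊆ D, IsCompact C → ∀ ε > 0, ∀ᶠ j in atTop, ∀ z ∈ C,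
      sphDist (toSphere (f (φ j)) z) (L z) < ε := by
    intro C hCD hC ε hε
    obtain ⟨n, hn⟩ := hKex C hCD hC
    filter_upwards [eventually_ge_atTop n,
      (tendsto_one_div_add_atTop_nhds_zero_nat (𝕜 := ℝ)).eventually_lt_const hε] with j hj hjε z hz
    exact (hφK j z (hKm hj (hn hz))).trans hjε
  refine ⟨φ, hφ, ?_⟩
  rcases (sphMero_ultraLim hch).eq_infty_or_nice hconn with h | ⟨hn, h⟩
  · right
    intro C hCD hC ε hε
    filter_upwards [hconv C hCD hC ε hε] with j hj z hz
    rw [← h z (hCD hz)]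
    exact hj z hz
  · left
    refine ⟨finPart L, hn, fun C hCD hC ε hε ↦ ?_⟩
    filter_upwards [hconv C hCD hC ε hε] with j hj z hz
    rw [h z (hCD hz)]
    exact hj z hz

section

variable {ι : Type*} {𝒰 : Ultrafilter ι} {S : ι → ℂ → OnePoint ℂ}

theorem eventually_inChart_of_ultraLim_eq_coe (h : ∀ z, ∃ r > 0, ∃ M, ∀ᶠ j in 𝒰,
    InChart (S j) z r M ∨ InChart (sphInv ∘ S j) z r M) {c : ℂ} (hc : ‖c‖ ≤ 1)
    (hconst : ∀ z, ultraLim 𝒰 S z = (c : OnePoint ℂ)) : ∀ᶠ j in 𝒰, InChart (S j) 0 1 2 := by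
  have key : ∀ᶠ j in 𝒰, ∀ z ∈ Metric.closedBall (0 : ℂ) 1,
      DifferentiableAt ℂ (finPart (S j)) z ∧ ‖finPart (S j) z‖ ≤ 2 ∧
        S j z = (finPart (S j) z : OnePoint ℂ) := by
    refine (isCompact_closedBall (0 : ℂ) 1).induction_on (p := fun t ↦ ∀ᶠ j in 𝒰, ∀ z ∈ t,
      DifferentiableAt ℂ (finPart (S j)) z ∧ ‖finPart (S j) z‖ ≤ 2 ∧
        S j z = (finPart (S j) z : OnePoint ℂ)) (by simp) ?_ ?_ ?_
    · intro t t' htt h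
      filter_upwards [h] with j hj z hz using hj z (htt hz)
    · intro t t' h h'
      filter_upwards [h, h'] with j hj hj' z hz using hz.elim (hj z) (hj' z)
    · intro z _
      obtain ⟨r₀, hr₀, M₀, h⟩ := h z
      obtain ⟨r, hr, M, h⟩ := exists_inChart_of_ultraLim_ne_infty hr₀ h (by
        rw [hconst]; exact OnePoint.coe_ne_infty c)
      have hzr : z ∈ Metric.ball z r := Metric.mem_ball_self hr
      obtain ⟨t, ht, hunif⟩ := Metric.tendstoLocallyUniformlyOn_iff.1
        (tendstoLocallyUniformlyOn_finPart h) 1 one_pos z hzr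
      rw [Metric.isOpen_ball.nhdsWithin_eq hzr] at ht
      refine ⟨t ∩ Metric.ball z r, mem_nhdsWithin_of_mem_nhds
        (inter_mem ht (Metric.ball_mem_nhds z hr)), ?_⟩
      filter_upwards [h, hunif] with j hj hju w hw
      obtain ⟨hd, hb⟩ := inChart_iff.1 hj
      refine ⟨hd.differentiableAt (Metric.isOpen_ball.mem_nhds hw.2), ?_, (hb w hw.2).2⟩
      have h1 := hju w hw.1
      rw [finPart_of_coe (hconst w), dist_comm, dist_eq_norm] at h1
      have h2 := norm_sub_norm_le (finPart (S j) w) c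
      linarith
  filter_upwards [key] with j hj
  have hsub : Metric.ball (0 : ℂ) 1 ⊆ Metric.closedBall 0 1 := Metric.ball_subset_closedBall
  exact inChart_iff.2 ⟨fun z hz ↦ (hj z (hsub hz)).1.differentiableWithinAt,
    fun z hz ↦ (hj z (hsub hz)).2⟩

theorem not_ultraLim_const {α : ℝ} (h : ∀ z, ∃ r > 0, ∃ M, ∀ᶠ j in 𝒰,
    InChart (S j) z r M ∨ InChart (sphInv ∘ S j) z r M)
    (hnt : ∀ j, ¬ Tame α (S j) 0 1) (x : OnePoint ℂ) : ¬ ∀ z, ultraLim 𝒰 S z = x := by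
  intro hx
  have hB : ∀ c : ℂ, ‖c‖ ≤ 1 → sphInv x = (c : OnePoint ℂ) → False := by
    intro c hc hxc
    have h' : ∀ z, ∃ r > 0, ∃ M, ∀ᶠ j in 𝒰,
        InChart (sphInv ∘ S j) z r M ∨ InChart (sphInv ∘ (sphInv ∘ S j)) z r M := by
      intro z
      obtain ⟨r, hr, M, h⟩ := h z
      refine ⟨r, hr, M, h.mono fun j hj ↦ hj.symm.imp id fun hj ↦ ?_⟩
      convert hj using 1
      funext w; simp
    have := eventually_inChart_of_ultraLim_eq_coe h' hc (fun z ↦ by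
      rw [ultraLim_sphInv, Function.comp, hx, hxc])
    obtain ⟨j, hj⟩ := this.exists
    exact hnt j (Or.inr (by simpa using hj))
  induction x using OnePoint.rec with
  | infty => exact hB 0 (by simp) sphInv_infty
  | coe c =>
    rcases le_total ‖c‖ 1 with hc | hc
    · obtain ⟨j, hj⟩ := (eventually_inChart_of_ultraLim_eq_coe h hc hx).exists
      exact hnt j (Or.inl (by simpa using hj))
    · have hc0 : c ≠ 0 := norm_pos_iff.1 (one_pos.trans_le hc)
      exact hB c⁻¹ (by rw [norm_inv]; exact inv_le_one_of_one_le₀ hc) (sphInv_coe_of_ne hc0)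

end

theorem MeromorphicNiceOn.meromorphicOrderAt_sub_ne_top {g : ℂ → ℂ}
    (hg : MeromorphicNiceOn g univ) (hnc : ∀ x, ¬ ∀ z, toSphere g z = x) (b z : ℂ) :
    meromorphicOrderAt (fun w ↦ g w - b) z ≠ ⊤ := by
  intro htop
  have hm : MeromorphicOn (fun w ↦ g w - b) univ := fun w hw ↦
    (hg.1 w hw).fun_sub (MeromorphicAt.const b w)
  have hall : ∀ w, meromorphicOrderAt (fun w ↦ g w - b) w = ⊤ := by
    intro w
    by_contra hw
    exact hm.meromorphicOrderAt_ne_top_of_isPreconnected (x := w) isPreconnected_univ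
      (mem_univ w) (mem_univ z) hw htop
  refine hnc b fun w ↦ ?_
  have hev : ∀ᶠ w' in 𝓝[≠] w, g w' = b := by
    filter_upwards [meromorphicOrderAt_eq_top_iff.1 (hall w)] with w' hw'
    exact sub_eq_zero.1 hw'
  have hlim : Tendsto g (𝓝[≠] w) (𝓝 b) :=
    tendsto_const_nhds.congr' (hev.mono fun _ h ↦ h.symm)
  rcases hg.2 w (mem_univ w) with hc | hc
  · rw [toSphere_of_continuousAt hc, tendsto_nhds_unique
      (hc.tendsto.mono_left nhdsWithin_le_nhds) hlim]
  · exact (not_tendsto_atTop_of_tendsto_nhds hlim.norm hc).elim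

section

variable {ι : Type*} {l : Filter ι} {F G : ι → ℂ → ℂ} {f g : ℂ → ℂ} {U : Set ℂ}

/-- Locally uniform convergence of functions that are eventually holomorphic on `U`. -/
def TendstoHolo (F : ι → ℂ → ℂ) (f : ℂ → ℂ) (l : Filter ι) (U : Set ℂ) : Prop :=
  TendstoLocallyUniformlyOn F f l U ∧ ∀ᶠ j in l, DifferentiableOn ℂ (F j) U

theorem TendstoHolo.differentiableOn [l.NeBot] (hU : IsOpen U) (h : TendstoHolo F f l U) :
    DifferentiableOn ℂ f U := h.1.differentiableOn h.2 hU

theorem TendstoHolo.deriv (hU : IsOpen U) (h : TendstoHolo F f l U) :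
    TendstoHolo (fun j ↦ deriv (F j)) (deriv f) l U :=
  ⟨h.1.deriv h.2 hU, h.2.mono fun _ hj ↦ hj.deriv hU⟩

theorem TendstoHolo.iteratedDeriv (hU : IsOpen U) (h : TendstoHolo F f l U) (n : ℕ) :
    TendstoHolo (fun j ↦ iteratedDeriv n (F j)) (iteratedDeriv n f) l U := by
  induction n with
  | zero => simpa only [iteratedDeriv_zero] using h
  | succ n ih => simpa only [iteratedDeriv_succ] using ih.deriv hU

theorem TendstoHolo.mul [l.NeBot] (hU : IsOpen U) (hF : TendstoHolo F f l U)
    (hG : TendstoHolo G g l U) : TendstoHolo (fun j ↦ F j * G j) (f * g) l U :=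
  ⟨hF.1.mul₀ hG.1 (hF.differentiableOn hU).continuousOn (hG.differentiableOn hU).continuousOn,
    by filter_upwards [hF.2, hG.2] with j h1 h2 using h1.mul h2⟩

theorem tendstoHolo_const {c : ℂ} : TendstoHolo (fun _ : ι ↦ fun _ ↦ c) (fun _ ↦ c) l U := by
  refine ⟨?_, Eventually.of_forall fun _ ↦ differentiableOn_const c⟩
  rw [Metric.tendstoLocallyUniformlyOn_iff]
  exact fun ε hε x _ ↦ ⟨univ, univ_mem, Eventually.of_forall fun _ _ _ ↦ by simpa using hε⟩

theorem TendstoHolo.pow [l.NeBot] (hU : IsOpen U) (hF : TendstoHolo F f l U) (n : ℕ) :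
    TendstoHolo (fun j ↦ F j ^ n) (f ^ n) l U := by
  induction n with
  | zero =>
    simp only [pow_zero]
    exact tendstoHolo_const (c := 1)
  | succ n ih => simpa only [pow_succ] using ih.mul hU hF

theorem TendstoHolo.prod [l.NeBot] (hU : IsOpen U) {κ : Type*} (s : Finset κ)
    {F : κ → ι → ℂ → ℂ} {f : κ → ℂ → ℂ} (hF : ∀ i ∈ s, TendstoHolo (F i) (f i) l U) :
    TendstoHolo (fun j ↦ ∏ i ∈ s, F i j) (∏ i ∈ s, f i) l U := by
  induction s using Finset.induction_on with
  | empty =>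
    simp only [Finset.prod_empty]
    exact tendstoHolo_const (c := 1)
  | insert a s ha ih =>
    simp only [Finset.prod_insert ha]
    exact (hF a (Finset.mem_insert_self _ _)).mul hU
      (ih fun i hi ↦ hF i (Finset.mem_insert_of_mem hi))

theorem TendstoHolo.sub_const (hF : TendstoHolo F f l U) (c : ℂ) :
    TendstoHolo (fun j w ↦ F j w - c) (fun w ↦ f w - c) l U := by
  refine ⟨?_, hF.2.mono fun _ hj ↦ hj.sub_const c⟩
  rw [Metric.tendstoLocallyUniformlyOn_iff]
  have := Metric.tendstoLocallyUniformlyOn_iff.1 hF.1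
  simpa only [dist_sub_right] using this

theorem TendstoHolo.diffMonomial [l.NeBot] (hU : IsOpen U) (hF : TendstoHolo F f l U) {k n : ℕ}
    (nn tt : Fin k → ℕ) :
    TendstoHolo (fun j ↦ diffMonomial n nn tt (F j)) (diffMonomial n nn tt f) l U := by
  have h := (hF.pow hU n).mul hU (TendstoHolo.prod hU Finset.univ
    fun i _ ↦ (hF.pow hU (nn i)).iteratedDeriv hU (tt i))
  convert h using 1
  · funext j w; simp [_root_.diffMonomial]
  · funext w; simp [_root_.diffMonomial]

/-- Existence of zeros near a zero of the limit, in **Hurwitz's theorem**. -/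
theorem TendstoHolo.eventually_exists_zero [l.NeBot] (hU : IsOpen U) (hF : TendstoHolo F f l U)
    {z : ℂ} (hz : z ∈ U) (h0 : f z = 0) (hne : ∀ᶠ w in 𝓝[≠] z, f w ≠ 0) {t : Set ℂ}
    (ht : t ∈ 𝓝 z) : ∀ᶠ j in l, ∃ w ∈ t, F j w = 0 := by
  obtain ⟨R, hR, hb⟩ := Metric.eventually_nhds_iff_ball.1
    ((eventually_nhdsWithin_iff.1 hne).and (inter_mem ht (hU.mem_nhds hz)))
  set ρ := R / 2 with hρ
  have hρ0 : 0 < ρ := by positivity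
  have hsub : Metric.closedBall z ρ ⊆ Metric.ball z R :=
    Metric.closedBall_subset_ball (half_lt_self hR)
  have hsubU : Metric.closedBall z ρ ⊆ U := fun w hw ↦ (hb w (hsub hw)).2.2
  have hcont : ContinuousOn f (Metric.closedBall z ρ) :=
    (hF.differentiableOn hU).continuousOn.mono hsubU
  obtain ⟨w₀, hw₀, hmin⟩ := (isCompact_sphere z ρ).exists_isMinOn
    (NormedSpace.sphere_nonempty.2 hρ0.le)
    ((hcont.mono Metric.sphere_subset_closedBall).norm)
  set m := ‖f w₀‖ with hm
  have hm0 : 0 < m := by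
    refine norm_pos_iff.2 ((hb w₀ (hsub (Metric.sphere_subset_closedBall hw₀))).1 ?_)
    rintro rfl
    rw [Metric.mem_sphere, dist_self] at hw₀
    exact hρ0.ne hw₀
  have hunif := Metric.tendstoUniformlyOn_iff.1
    ((tendstoLocallyUniformlyOn_iff_forall_isCompact hU).1 hF.1 _ hsubU (isCompact_closedBall z ρ))
    (m / 3) (by positivity)
  filter_upwards [hunif, hF.2] with j hj hd
  by_contra! hcon
  have hnz : ∀ w ∈ Metric.closedBall z ρ, F j w ≠ 0 := fun w hw ↦ hcon w (hb w (hsub hw)).2.1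
  have hinv : DifferentiableOn ℂ (fun w ↦ (F j w)⁻¹) (Metric.closedBall z ρ) :=
    (hd.mono hsubU).inv hnz
  have hdc : DiffContOnCl ℂ (fun w ↦ (F j w)⁻¹) (Metric.ball z ρ) :=
    hinv.diffContOnCl_ball subset_rfl
  have hbd := Complex.norm_le_of_forall_mem_frontier_norm_le Metric.isBounded_ball hdc
    (C := (2 * m / 3)⁻¹) (fun w hw ↦ by
      rw [frontier_ball z hρ0.ne'] at hw
      have h1 := hj w (Metric.sphere_subset_closedBall hw)
      have h2 : m ≤ ‖f w‖ := hmin hw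
      have h3 := norm_sub_norm_le (f w) (F j w)
      rw [dist_eq_norm] at h1
      rw [norm_inv]
      exact inv_anti₀ (by positivity) (by linarith))
    (subset_closure (Metric.mem_ball_self hρ0))
  have h1 := hj z (Metric.mem_closedBall_self hρ0.le)
  rw [h0, dist_eq_norm, zero_sub, norm_neg] at h1
  have h4 : 0 < ‖F j z‖ := norm_pos_iff.2 (hnz z (Metric.mem_closedBall_self hρ0.le))
  rw [norm_inv, inv_le_inv₀ h4 (by positivity)] at hbd
  linarith

/-- Multiplicities of zeros do not drop in the limit. -/
theorem TendstoHolo.le_analyticOrderAt [l.NeBot] (hU : IsOpen U) (hF : TendstoHolo F f l U)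
    {m : ℕ∞} (hm : ∀ᶠ j in l, ∀ w ∈ U, F j w = 0 → m ≤ analyticOrderAt (F j) w)
    {z : ℂ} (hz : z ∈ U) (h0 : f z = 0) : m ≤ analyticOrderAt f z := by
  have hfa : AnalyticAt ℂ f z := (hF.differentiableOn hU).analyticAt (hU.mem_nhds hz)
  by_contra! hlt
  obtain ⟨p, hp⟩ := ENat.ne_top_iff_exists.1 hlt.ne_top
  have hne : ∀ᶠ w in 𝓝[≠] z, f w ≠ 0 := by
    refine hfa.eventually_eq_zero_or_eventually_ne_zero.resolve_left fun h ↦ ?_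
    exact hlt.ne_top (analyticOrderAt_eq_top.2 h)
  have hpd := ((analyticOrderAt_eq_nat_iff_iteratedDeriv_eq_zero hfa).1 hp.symm).2
  have hI := hF.iteratedDeriv hU p
  set v := _root_.iteratedDeriv p f with hv
  have hvc : ContinuousAt v z :=
    (hI.differentiableOn hU).continuousOn.continuousAt (hU.mem_nhds hz)
  have hv0 : 0 < ‖v z‖ / 2 := half_pos (norm_pos_iff.2 hpd)
  obtain ⟨t, ht, hunif⟩ := Metric.tendstoLocallyUniformlyOn_iff.1 hI.1 _ hv0 z hz
  rw [hU.nhdsWithin_eq hz] at ht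
  have h2 : ∀ᶠ w in 𝓝 z, dist (v w) (v z) < ‖v z‖ / 2 := Metric.tendsto_nhds.1 hvc _ hv0
  have hex := hF.eventually_exists_zero hU hz h0 hne
    (inter_mem (inter_mem ht h2) (hU.mem_nhds hz))
  obtain ⟨j, ⟨w, ⟨⟨hwt, hw2⟩, hwU⟩, hw0⟩, hju, hjm, hjd⟩ :=
    (hex.and (hunif.and (hm.and hF.2))).exists
  have hja : AnalyticAt ℂ (F j) w := hjd.analyticAt (hU.mem_nhds hwU)
  have h3 : ((p + 1 : ℕ) : ℕ∞) ≤ analyticOrderAt (F j) w := by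
    refine le_trans ?_ (hjm w hwU hw0)
    rw [← hp] at hlt
    push_cast
    exact Order.add_one_le_of_lt hlt
  have h4 := (natCast_le_analyticOrderAt_iff_iteratedDeriv_eq_zero hja).1 h3 p (Nat.lt_succ_self p)
  have h5 := hju w hwt
  rw [h4, dist_zero_right] at h5
  have h6 : dist (v w) (v z) < ‖v z‖ / 2 := hw2
  rw [dist_comm, dist_eq_norm] at h6
  linarith [norm_sub_norm_le (v z) (v w)]

end

theorem iteratedDeriv_comp_affine (h : ℂ → ℂ) (z ρ : ℂ) (t : ℕ) :
    iteratedDeriv t (fun ζ ↦ h (z + ρ * ζ)) = fun ζ ↦ ρ ^ t * iteratedDeriv t h (z + ρ * ζ) := by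
  induction t with
  | zero => simp
  | succ t ih =>
    funext ζ
    rw [iteratedDeriv_succ, ih, deriv_const_mul_field, iteratedDeriv_succ,
      deriv_comp_mul_left ρ (fun x ↦ iteratedDeriv t h (z + x)) ζ,
      deriv_comp_const_add (iteratedDeriv t h) z (ρ * ζ), smul_eq_mul, pow_succ]
    ring

theorem diffMonomial_rescale {k n : ℕ} (nn tt : Fin k → ℕ) (f : ℂ → ℂ) (c z ρ ζ : ℂ) :
    diffMonomial n nn tt (fun ζ ↦ c * f (z + ρ * ζ)) ζ =
      c ^ (n + ∑ j, nn j) * ρ ^ (∑ j, tt j) * diffMonomial n nn tt f (z + ρ * ζ) := by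
  have h : ∀ j, iteratedDeriv (tt j) ((fun ζ ↦ c * f (z + ρ * ζ)) ^ nn j) ζ =
      c ^ nn j * (ρ ^ tt j * iteratedDeriv (tt j) (f ^ nn j) (z + ρ * ζ)) := by
    intro j
    have : (fun ζ ↦ c * f (z + ρ * ζ)) ^ nn j =
        fun ζ ↦ c ^ nn j * (fun ζ ↦ (f ^ nn j) (z + ρ * ζ)) ζ := by
      funext ζ; simp [mul_pow]
    rw [this, iteratedDeriv_const_mul_field, iteratedDeriv_comp_affine]
  simp only [diffMonomial, h, Finset.prod_mul_distrib, Finset.prod_pow_eq_pow_sum, mul_pow, pow_add]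
  ring

theorem diffMonomial_congr {k n : ℕ} (nn tt : Fin k → ℕ) {f g : ℂ → ℂ} {z : ℂ}
    (h : f =ᶠ[𝓝 z] g) : diffMonomial n nn tt f =ᶠ[𝓝 z] diffMonomial n nn tt g := by
  have h1 : ∀ j, iteratedDeriv (tt j) (f ^ nn j) =ᶠ[𝓝 z] iteratedDeriv (tt j) (g ^ nn j) :=
    fun j ↦ (h.pow_const (nn j)).iteratedDeriv (tt j)
  filter_upwards [h, eventually_all.2 h1] with w hw hw1
  simp only [diffMonomial, hw, hw1]

theorem merOrder_eq_meromorphicOrderAt {f : ℂ → ℂ} {z : ℂ} (hf : MeromorphicAt f z) :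
    merOrder f z = meromorphicOrderAt f z := by
  rw [merOrder]
  split_ifs with h1 h2
  · exact (meromorphicOrderAt_eq_top_iff.2 h1).symm
  · refine ((meromorphicOrderAt_eq_int_iff hf).2 ?_).symm
    simpa only [smul_eq_mul] using h2.choose_spec
  · refine (h2 ?_).elim
    obtain ⟨g, hg, hg0, h⟩ := (meromorphicOrderAt_ne_top_iff hf).1
      (fun h ↦ h1 (meromorphicOrderAt_eq_top_iff.1 h))
    exact ⟨_, g, hg, hg0, h.mono fun w hw ↦ by simpa only [smul_eq_mul] using hw⟩

theorem toSphere_of_ne_infty {f : ℂ → ℂ} {z : ℂ} (h : toSphere f z ≠ OnePoint.infty) :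
    toSphere f z = (f z : OnePoint ℂ) := by
  rw [toSphere] at h ⊢
  split_ifs with h1
  · simp [h1] at h
  · rfl

theorem finPart_sphRescale {α ρ : ℝ} {f : ℂ → ℂ} {z ζ c : ℂ}
    (h : sphRescale α (toSphere f) z ρ ζ = (c : OnePoint ℂ)) :
    finPart (sphRescale α (toSphere f) z ρ) ζ = ((ρ ^ (-α) : ℝ) : ℂ) * f (z + ρ * ζ) := by
  have h1 : toSphere f (z + ρ * ζ) ≠ OnePoint.infty := by
    intro h1
    rw [sphRescale, h1] at h
    exact OnePoint.infty_ne_coe c h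
  exact finPart_of_coe (by rw [sphRescale, toSphere_of_ne_infty h1]; rfl)

section

variable {k n : ℕ} {nn tt : Fin k → ℕ}

/-- The multiplicity condition on the values of the monomial passes to the rescaled function. -/
theorem le_analyticOrderAt_diffMonomial_sphRescale {α ρ : ℝ} (hρ : 0 < ρ)
    (hα : α * (n + ∑ j, nn j : ℕ) = (∑ j, tt j : ℕ)) {f : ℂ → ℂ} {z b : ℂ} {D U : Set ℂ}
    {m : ℕ∞} (hf : MeromorphicOn f D) (hU : IsOpen U) (hUD : ∀ ζ ∈ U, z + ρ * ζ ∈ D)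
    (hd : DifferentiableOn ℂ (finPart (sphRescale α (toSphere f) z ρ)) U)
    (hfin : ∀ ζ ∈ U, sphRescale α (toSphere f) z ρ ζ =
      (finPart (sphRescale α (toSphere f) z ρ) ζ : OnePoint ℂ))
    (hm : ∀ w ∈ D, diffMonomial n nn tt f w - b = 0 →
      m.map (fun x : ℕ ↦ (x : ℤ)) ≤ merOrder (fun w ↦ diffMonomial n nn tt f w - b) w)
    {ζ : ℂ} (hζ : ζ ∈ U)
    (h0 : diffMonomial n nn tt (finPart (sphRescale α (toSphere f) z ρ)) ζ - b = 0) :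
    m ≤ analyticOrderAt
      (fun w ↦ diffMonomial n nn tt (finPart (sphRescale α (toSphere f) z ρ)) w - b) ζ := by
  set u := finPart (sphRescale α (toSphere f) z ρ) with hu
  have hc : (((ρ ^ (-α) : ℝ) : ℂ)) ^ (n + ∑ j, nn j) * (ρ : ℂ) ^ (∑ j, tt j) = 1 := by
    rw [← Complex.ofReal_pow, ← Complex.ofReal_pow, ← Complex.ofReal_mul,
      ← Real.rpow_natCast, ← Real.rpow_mul hρ.le, neg_mul, hα, ← Real.rpow_natCast ρ,
      ← Real.rpow_add hρ, neg_add_cancel, Real.rpow_zero, Complex.ofReal_one]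
  have hev : ∀ᶠ w in 𝓝 ζ, u w = ((ρ ^ (-α) : ℝ) : ℂ) * f (z + ρ * w) := by
    filter_upwards [hU.mem_nhds hζ] with w hw using finPart_sphRescale (hfin w hw)
  have hP : ∀ᶠ w in 𝓝 ζ, diffMonomial n nn tt u w - b =
      diffMonomial n nn tt f (z + ρ * w) - b := by
    filter_upwards [diffMonomial_congr nn tt hev (n := n)] with w hw
    rw [hw, diffMonomial_rescale, hc, one_mul]
  have hua : AnalyticAt ℂ u ζ := hd.analyticAt (hU.mem_nhds hζ)
  have hWa : AnalyticAt ℂ (fun w ↦ diffMonomial n nn tt u w - b) ζ := by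
    refine AnalyticAt.sub ?_ analyticAt_const
    refine (hua.pow n).mul (Finset.analyticAt_fun_prod _ fun j _ ↦ ?_)
    rw [iteratedDeriv_eq_iterate]
    exact (hua.pow (nn j)).iterated_deriv (tt j)
  have hD : z + ρ * ζ ∈ D := hUD ζ hζ
  have hle := hm _ hD (by rw [← hP.self_of_nhds, h0])
  have hPm : MeromorphicAt (fun w ↦ diffMonomial n nn tt f w - b) (z + ρ * ζ) :=
    (hf _ hD).diffMonomial.sub (MeromorphicAt.const b _)
  have hA : AnalyticAt ℂ (fun w : ℂ ↦ z + ρ * w) ζ := by fun_prop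
  have hA' : deriv (fun w : ℂ ↦ z + ρ * w) ζ ≠ 0 := by
    have : HasDerivAt (fun w : ℂ ↦ z + ρ * w) (ρ * 1) ζ :=
      ((hasDerivAt_id ζ).const_mul (ρ : ℂ)).const_add z
    rw [this.deriv, mul_one]
    exact_mod_cast hρ.ne'
  have hcongr := meromorphicOrderAt_congr (hP.filter_mono (nhdsWithin_le_nhds (s := {ζ}ᶜ)))
  rw [hWa.meromorphicOrderAt_eq] at hcongr
  rw [merOrder_eq_meromorphicOrderAt hPm,
    ← meromorphicOrderAt_comp_of_deriv_ne_zero (f := fun w ↦ diffMonomial n nn tt f w - b)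
      hA hA'] at hle
  replace hle := hle.trans_eq hcongr.symm
  revert hle
  cases m <;> cases analyticOrderAt (fun w ↦ diffMonomial n nn tt u w - b) ζ <;> simp

/-- A family that fails to be normal yields, after blowing up, a nonconstant meromorphic function
in the plane with the same ramification. -/
theorem exists_meromorphic_of_not_normalFamilyOn {q : ℕ} {a : Fin q → ℂ} {l : Fin q → ℕ∞}
    (hτN : ∑ j, tt j < n + ∑ j, nn j) {D : Set ℂ} (hD : IsOpen D)
    (hconn : IsPreconnected D) {𝓕 : Set (ℂ → ℂ)} (hmero : ∀ f ∈ 𝓕, MeromorphicNiceOn f D)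
    (hmult : ∀ f ∈ 𝓕, ∀ i, ∀ z ∈ D, diffMonomial n nn tt f z - a i = 0 →
      (l i).map (fun x : ℕ ↦ (x : ℤ)) ≤ merOrder (fun w ↦ diffMonomial n nn tt f w - a i) z)
    (hnot : ¬ NormalFamilyOn 𝓕 D) :
    ∃ g : ℂ → ℂ, Meromorphic g ∧ (∀ b z, meromorphicOrderAt (fun w ↦ g w - b) z ≠ ⊤) ∧
      ∀ i z, 0 ≤ meromorphicOrderAt g z →
        0 < meromorphicOrderAt (fun w ↦ diffMonomial n nn tt g w - a i) z →
        (l i).map (fun x : ℕ ↦ (x : ℤ)) ≤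
          meromorphicOrderAt (fun w ↦ diffMonomial n nn tt g w - a i) z := by
  set α : ℝ := (∑ j, tt j : ℕ) / (n + ∑ j, nn j : ℕ) with hαdef
  have hN : (0 : ℝ) < (n + ∑ j, nn j : ℕ) := by exact_mod_cast (Nat.zero_le _).trans_lt hτN
  have hαN : α * (n + ∑ j, nn j : ℕ) = (∑ j, tt j : ℕ) := div_mul_cancel₀ _ hN.ne'
  have hα : |α| < 1 := by
    rw [abs_of_nonneg (by positivity), hαdef, div_lt_one hN]
    exact_mod_cast hτN
  obtain ⟨z₀, hz₀, hbad⟩ : ∃ z₀ ∈ D, ∀ δ > 0, ∃ f ∈ 𝓕, ∃ w ∈ Metric.ball z₀ δ, ∃ ρ,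
      0 < ρ ∧ ρ < δ ∧ ¬ Tame α (toSphere f) w ρ := by
    by_contra! h
    exact hnot (normalFamilyOn_of_tame hD hconn h)
  have hzal : ∀ j : ℕ, ∃ f ∈ 𝓕, ∃ z₁ ρ₁, 0 < ρ₁ ∧ ρ₁ < 1 / ((j : ℝ) + 1) ∧
      ¬ Tame α (toSphere f) z₁ ρ₁ ∧ ∀ w, dist w z₁ < ρ₁ / (1 / ((j : ℝ) + 1)) →
        w ∈ D ∧ ∀ ρ, 0 < ρ → ρ < ρ₁ / 4 → Tame α (toSphere f) w ρ := by
    intro j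
    obtain ⟨s, ⟨f, hf, rfl⟩, h⟩ := exists_zalcman hα (𝓢 := toSphere '' 𝓕) hD
      (by rintro _ ⟨f, hf, rfl⟩; exact (hmero f hf).sphMero) hz₀
      (fun δ hδ ↦ by
        obtain ⟨f, hf, h⟩ := hbad δ hδ
        exact ⟨_, mem_image_of_mem _ hf, h⟩) (ε := 1 / ((j : ℝ) + 1)) (by positivity)
    exact ⟨f, hf, h⟩
  choose f hf z ρ hρ hρ₁ hnt hgood using hzal
  set S : ℕ → ℂ → OnePoint ℂ := fun j ↦ sphRescale α (toSphere (f j)) (z j) (ρ j) with hS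
  have hgood' : ∀ (j : ℕ) (ζ : ℂ), ‖ζ‖ < j + 1 → z j + ρ j * ζ ∈ D ∧ Tame α (S j) ζ (1 / 5) := by
    intro j ζ hζ
    have h := hgood j (z j + ρ j * ζ) (by
      rw [dist_eq_norm, add_sub_cancel_left, norm_mul, Complex.norm_real, Real.norm_eq_abs,
        abs_of_pos (hρ j), one_div, div_inv_eq_mul]
      exact mul_lt_mul_of_pos_left hζ (hρ j))
    exact ⟨h.1, Tame.rescale (hρ j) (by norm_num)
      (h.2 _ (mul_pos (hρ j) (by norm_num)) (by linarith [hρ j]))⟩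
  have hntS : ∀ j, ¬ Tame α (S j) 0 1 := fun j h ↦ hnt j (tame_of_tame_sphRescale (hρ j) h)
  set 𝒰 : Ultrafilter ℕ := hyperfilter ℕ with h𝒰
  have hlarge : ∀ R : ℝ, ∀ᶠ j : ℕ in 𝒰, R < j + 1 := by
    intro R
    refine Eventually.filter_mono Nat.hyperfilter_le_atTop ?_
    filter_upwards [tendsto_natCast_atTop_atTop.eventually_ge_atTop R] with j hj
    linarith
  have hchart : ∀ ζ, ∃ r > 0, ∃ M, ∀ᶠ j in 𝒰,
      InChart (S j) ζ r M ∨ InChart (sphInv ∘ S j) ζ r M := fun ζ ↦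
    Tame.exists_inChart (ρ := 1 / 5) (by norm_num) ((hlarge ‖ζ‖).mono fun j hj ↦ (hgood' j ζ hj).2)
  have hnconst := not_ultraLim_const hchart hntS
  obtain ⟨hg, hgL⟩ := ((sphMero_ultraLim fun ζ _ ↦ hchart ζ).eq_infty_or_nice
    (D := univ) isPreconnected_univ).resolve_left fun h ↦ hnconst _ fun ζ ↦ h ζ (mem_univ ζ)
  set g := finPart (ultraLim 𝒰 S) with hgdef
  refine ⟨g, fun ζ ↦ hg.1 ζ (mem_univ ζ), hg.meromorphicOrderAt_sub_ne_top fun x hx ↦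
    hnconst x fun ζ ↦ (hgL ζ (mem_univ ζ)).symm.trans (hx ζ), fun i ζ hζ hpos ↦ ?_⟩
  have hne : ultraLim 𝒰 S ζ ≠ OnePoint.infty := by
    rw [← hgL ζ (mem_univ ζ), toSphere, if_neg]
    · exact OnePoint.coe_ne_infty _
    · rw [tendsto_norm_atTop_iff_cobounded,
        tendsto_cobounded_iff_meromorphicOrderAt_neg (hg.1 ζ (mem_univ ζ))]
      exact hζ.not_gt
  obtain ⟨r, hr, M, hrM⟩ := hchart ζ
  obtain ⟨r', hr', M', hM'⟩ := exists_inChart_of_ultraLim_ne_infty hr hrM hne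
  have hζU : ζ ∈ Metric.ball ζ r' := Metric.mem_ball_self hr'
  have hF : TendstoHolo (fun j ↦ finPart (S j)) g (𝒰 : Filter ℕ) (Metric.ball ζ r') :=
    ⟨tendstoLocallyUniformlyOn_finPart hM', hM'.mono fun j hj ↦ (inChart_iff.1 hj).1⟩
  have hW := (hF.diffMonomial Metric.isOpen_ball (n := n) nn tt).sub_const (a i)
  have hWa := (hW.differentiableOn Metric.isOpen_ball).analyticAt
    (Metric.isOpen_ball.mem_nhds hζU)
  rw [hWa.meromorphicOrderAt_eq] at hpos ⊢
  have h0 : diffMonomial n nn tt g ζ - a i = 0 := by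
    by_contra h0
    rw [hWa.analyticOrderAt_eq_zero.2 h0] at hpos
    exact lt_irrefl _ hpos
  have hle := hW.le_analyticOrderAt Metric.isOpen_ball (m := l i) (by
    filter_upwards [hM', hlarge (‖ζ‖ + r')] with j hj hjR w hw hw0
    obtain ⟨hj1, hj2⟩ := inChart_iff.1 hj
    refine le_analyticOrderAt_diffMonomial_sphRescale (hρ j) hαN (hmero _ (hf j)).1
      Metric.isOpen_ball (fun w hw ↦ (hgood' j w ?_).1) hj1 (fun w hw ↦ (hj2 w hw).2)
      (hmult _ (hf j) i) hw hw0
    have := norm_sub_norm_le w ζ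
    rw [Metric.mem_ball, dist_eq_norm] at hw
    linarith) hζU h0
  exact ENat.monotone_map_iff.2 (fun a b hab ↦ by exact_mod_cast hab) hle

end

/-- **Dethloff et al.'s normality criterion for meromorphic functions.**
Here `l i : ℕ∞` (a positive integer or `+∞`), and "all zeros of
`fⁿ (f^{n₁})^{(t₁)} ⋯ (f^{n_k})^{(t_k)} − a i` have multiplicity at least `l i`" is expressed
via the order `merOrder`. -/
theorem dethloff_normality_meromorphic (q : ℕ) (hq : 1 ≤ q)
    (a : Fin q → ℂ) (ha_ne : ∀ i, a i ≠ 0) (ha_inj : Function.Injective a)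
    (l : Fin q → ℕ∞) (n : ℕ) (k : ℕ) (hk : 1 ≤ k)
    (nn tt : Fin k → ℕ) (hnn : ∀ j, 1 ≤ nn j) (htt : ∀ j, 1 ≤ tt j)
    (D : Set ℂ) (hD : IsOpen D) (hDconn : IsConnected D)
    (𝓕 : Set (ℂ → ℂ)) (hmero : ∀ f ∈ 𝓕, MeromorphicNiceOn f D)
    -- hypothesis (a)
    (hnt : ∀ j, tt j ≤ nn j) (hl : ∀ i, 2 ≤ l i)
    -- hypothesis (b)
    (hsum : ∑ i, ((l i : ℝ≥0∞))⁻¹ <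
      ENNReal.ofReal (((q : ℝ) * n - 2 + ∑ j, (q : ℝ) * ((nn j : ℝ) - (tt j : ℝ))) /
        ((n : ℝ) + ∑ j, ((nn j : ℝ) + (tt j : ℝ)))))
    -- multiplicity hypothesis: all zeros of fⁿ(f^{n₁})^{(t₁)}⋯(f^{n_k})^{(t_k)} − aᵢ
    -- have multiplicity at least lᵢ
    (hmult : ∀ f ∈ 𝓕, ∀ i : Fin q, ∀ z ∈ D,
      (f z) ^ n * (∏ j, iteratedDeriv (tt j) (f ^ (nn j)) z) - a i = 0 →
        (l i).map (fun x : ℕ => (x : ℤ)) ≤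
          merOrder (fun w => (f w) ^ n * (∏ j, iteratedDeriv (tt j) (f ^ (nn j)) w) - a i) z) :
    NormalFamilyOn 𝓕 D := by
  have hl0 : ∀ i, l i ≠ 0 := fun i ↦ (two_pos.trans_le (hl i)).ne'
  set N : ℝ := ((n + ∑ j, nn j : ℕ) : ℝ) with hN
  set τ : ℝ := ((∑ j, tt j : ℕ) : ℝ) with hτ
  have hnum : (q : ℝ) * n - 2 + ∑ j, (q : ℝ) * ((nn j : ℝ) - (tt j : ℝ)) = q * (N - τ) - 2 := by
    rw [← Finset.mul_sum, Finset.sum_sub_distrib, hN, hτ]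
    push_cast
    ring
  have hden : (n : ℝ) + ∑ j, ((nn j : ℝ) + (tt j : ℝ)) = N + τ := by
    rw [Finset.sum_add_distrib, hN, hτ]
    push_cast
    ring
  rw [hnum, hden] at hsum
  have hdiv : 0 < (q * (N - τ) - 2) / (N + τ) := ENNReal.ofReal_pos.1 (bot_le.trans_lt hsum)
  have hNτ0 : 0 ≤ N + τ := by positivity
  have hpos : 0 < N + τ := hNτ0.lt_of_ne fun h ↦ by simp [← h] at hdiv
  have hnumpos : 0 < q * (N - τ) - 2 := (div_pos_iff_of_pos_right hpos).1 hdiv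
  have hτN : ∑ j, tt j < n + ∑ j, nn j := by
    have h : 0 < N - τ := pos_of_mul_pos_right (by linarith : 0 < (q : ℝ) * (N - τ)) (by positivity)
    exact Nat.cast_lt.1 (sub_pos.1 h)
  have htop : ∀ i, ((l i : ℝ≥0∞))⁻¹ ≠ ⊤ := fun i ↦ by
    simpa [ENNReal.inv_ne_top] using hl0 i
  have hsum' : (N + τ) * ∑ i, ((l i : ℝ≥0∞)⁻¹).toReal < q * (N - τ) - 2 := by
    rw [← ENNReal.toReal_sum fun i _ ↦ htop i, mul_comm, ← lt_div_iff₀ hpos]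
    exact (ENNReal.lt_ofReal_iff_toReal_lt (ENNReal.sum_ne_top.2 fun i _ ↦ htop i)).1 hsum
  by_contra hnot
  obtain ⟨g, hg, hnc, hgl⟩ := exists_meromorphic_of_not_normalFamilyOn hτN hD
    hDconn.isPreconnected hmero hmult hnot
  exact not_diffMonomial_totally_ramified hq hl0 hk hnn hnt hτN hg hnc ha_ne ha_inj hgl hsum'

end
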